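/- Let (η, u) be a solution of (SSW) on [0,1]×[0,T] with η ∈ C([0,T]; C⁴[0,1]), u ∈ C([0,T]; C₀⁴), η₀' ∈ C₀³, η₀''' ∈ C₀¹, u₀'' ∈ C₀², and suppose 1 + η(x,t)/2 ≥ β > 0 on [0,1]×[0,T] for some constant β. For N ≥ 2 and h = 1/N, let (η_h, u_h) be the solution on [0,T] of the semidiscrete Galerkin problem in the continuous piecewise linear spaces S_h × S_{h,0}: (∂_t η_h, φ) + (∂_x u_h, φ) + (1/2)(∂_x(η_h u_h), φ) = 0 for all φ ∈ S_h, (∂_t u_h, χ) + (∂_x η_h, χ) + (3/2)(u_h ∂_x u_h, χ) + (1/2)(η_h ∂_x η_h, χ) = 0 for all χ ∈ S_{h,0}, with η_h(0) = Pη₀, u_h(0) = P₀u₀. Then there exists a constant C independent of h such that max_{0≤t≤T} (‖η(·,t) − η_h(t)‖ + ‖u(·,t) − u_h(t)‖) ≤ C h² and max_{0≤t≤T} (‖η(·,t) − η_h(t)‖_{L^∞} + ‖u(·,t) − u_h(t)‖_{L^∞}) ≤ C h². -/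

import Mathlib

noncomputable section
open Set

/-- The L²(0,1) inner product of two real functions. -/
def ip (f g : ℝ → ℝ) : ℝ := ∫ y in (0:ℝ)..1, f y * g y

/-- The L²(0,1) norm. -/
def nrm (f : ℝ → ℝ) : ℝ := Real.sqrt (∫ y in (0:ℝ)..1, (f y)^2)

/-- `g` is the L²(0,1)-orthogonal projection of `f` onto `S`. -/
def IsL2ProjOn (S : Set (ℝ → ℝ)) (f g : ℝ → ℝ) : Prop :=
  g ∈ S ∧ ∀ χ ∈ S, ip (fun y => f y - g y) χ = 0

/-- The space `S_h` of `C^k` piecewise polynomials of degree ≤ r-1 on the partition `x`. -/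
def Sh (N r k : ℕ) (x : ℕ → ℝ) : Set (ℝ → ℝ) :=
  {φ | ContDiffOn ℝ k φ (Icc (0:ℝ) 1) ∧
    ∀ j < N, ∃ p : Polynomial ℝ, p.natDegree ≤ r - 1 ∧
      ∀ y ∈ Icc (x j) (x (j+1)), φ y = Polynomial.eval y p}

/-- The subspace `S_{h,0}` of functions in `S_h` vanishing at 0 and 1. -/
def Sh0 (N r k : ℕ) (x : ℕ → ℝ) : Set (ℝ → ℝ) :=
  {φ | φ ∈ Sh N r k x ∧ φ 0 = 0 ∧ φ 1 = 0}

/-- `x 0 = 0 < x 1 < ⋯ < x N = 1` is a partition of `[0,1]`. -/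
def IsPartition (N : ℕ) (x : ℕ → ℝ) : Prop :=
  x 0 = 0 ∧ x N = 1 ∧ ∀ i < N, x i < x (i+1)

/-- `h` is the maximal meshlength of the partition `x`. -/
def IsMeshSize (N : ℕ) (x : ℕ → ℝ) (h : ℝ) : Prop :=
  (∀ i < N, x (i+1) - x i ≤ h) ∧ ∃ i < N, x (i+1) - x i = h

/-- The partition is quasiuniform with constant γ : `h ≤ γ · min meshlength`. -/
def QuasiUniform (N : ℕ) (x : ℕ → ℝ) (h γ : ℝ) : Prop :=
  ∀ i < N, h ≤ γ * (x (i+1) - x i)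

/-- `fs j` is the j-th time derivative of `fs 0` on `[0,1]×[0,T]` for `j ≤ m`,
each being r times continuously differentiable in space and jointly continuous:
an encoding of `fs 0 ∈ C^m([0,T]; C^r[0,1])`. -/
def SmoothChain (T : ℝ) (r m : ℕ) (fs : ℕ → ℝ → ℝ → ℝ) : Prop :=
  (∀ j < m, ∀ y ∈ Icc (0:ℝ) 1, ∀ t ∈ Icc (0:ℝ) T,
    HasDerivWithinAt (fun s => fs j y s) (fs (j+1) y t) (Icc (0:ℝ) T) t) ∧
  (∀ j ≤ m, ∀ t ∈ Icc (0:ℝ) T, ContDiffOn ℝ r (fun y => fs j y t) (Icc (0:ℝ) 1)) ∧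
  (∀ j ≤ m, ContinuousOn (fun p : ℝ × ℝ => fs j p.1 p.2) ((Icc (0:ℝ) 1) ×ˢ (Icc (0:ℝ) T)))

/-- `(η,u)` (with time derivatives `ηt`, `ut`) solves the symmetric shallow water
system on `[0,1]×[0,T]` with homogeneous boundary conditions for `u`. -/
def SSW (T : ℝ) (η u ηt ut : ℝ → ℝ → ℝ) : Prop :=
  (∀ y ∈ Icc (0:ℝ) 1, ∀ t ∈ Icc (0:ℝ) T,
    ηt y t + derivWithin (fun z => u z t) (Icc (0:ℝ) 1) y
      + (1/2) * derivWithin (fun z => η z t * u z t) (Icc (0:ℝ) 1) y = 0 ∧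
    ut y t + derivWithin (fun z => η z t) (Icc (0:ℝ) 1) y
      + (3/2) * (u y t * derivWithin (fun z => u z t) (Icc (0:ℝ) 1) y)
      + (1/2) * (η y t * derivWithin (fun z => η z t) (Icc (0:ℝ) 1) y) = 0) ∧
  (∀ t ∈ Icc (0:ℝ) T, u 0 t = 0 ∧ u 1 t = 0)

/-- `(ηh, uh)` (with time derivatives `dηh`, `duh`) is a `C¹` in time solution of the
standard Galerkin semidiscretization of the symmetric shallow water system in
`Sh N r k x × Sh0 N r k x` on `[0,T]`. -/
def SolvesSSWGalerkin (N r k : ℕ) (x : ℕ → ℝ) (T : ℝ)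
    (ηh uh dηh duh : ℝ → ℝ → ℝ) : Prop :=
  (∀ t ∈ Icc (0:ℝ) T, ηh t ∈ Sh N r k x ∧ uh t ∈ Sh0 N r k x ∧
      dηh t ∈ Sh N r k x ∧ duh t ∈ Sh0 N r k x) ∧
  (∀ y ∈ Icc (0:ℝ) 1, ∀ t ∈ Icc (0:ℝ) T,
      HasDerivWithinAt (fun s => ηh s y) (dηh t y) (Icc (0:ℝ) T) t ∧
      HasDerivWithinAt (fun s => uh s y) (duh t y) (Icc (0:ℝ) T) t) ∧
  (∀ y ∈ Icc (0:ℝ) 1, ContinuousOn (fun t => dηh t y) (Icc (0:ℝ) T) ∧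
      ContinuousOn (fun t => duh t y) (Icc (0:ℝ) T)) ∧
  (∀ t ∈ Icc (0:ℝ) T,
      (∀ φ ∈ Sh N r k x,
        ip (dηh t) φ + ip (deriv (uh t)) φ
          + (1/2) * ip (deriv (fun y => ηh t y * uh t y)) φ = 0) ∧
      (∀ χ ∈ Sh0 N r k x,
        ip (duh t) χ + ip (deriv (ηh t)) χ
          + (3/2) * ip (fun y => uh t y * deriv (uh t) y) χ
          + (1/2) * ip (fun y => ηh t y * deriv (ηh t) y) χ = 0))

theorem gron {E E' : ℝ → ℝ} {S C D : ℝ} (hC : 0 ≤ C) (hD : 0 ≤ D)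
    (hc : ContinuousOn E (Icc 0 S)) (hd : ∀ t ∈ Ioo 0 S, HasDerivAt E (E' t) t)
    (hle : ∀ t ∈ Ioo 0 S, E' t ≤ C * E t + D) :
    ∀ t ∈ Icc 0 S, E t ≤ (E 0 + D * t) * Real.exp (C * t) := by
  intro t ht
  have key : AntitoneOn (fun t => E t * Real.exp (-(C * t)) - D * t) (Icc 0 S) := by
    apply antitoneOn_of_hasDerivWithinAt_nonpos (convex_Icc 0 S)
      (f' := fun t => (E' t * Real.exp (-(C * t)) + E t * (Real.exp (-(C * t)) * (-(C * 1)))) - D * 1)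
    · fun_prop
    · intro x hx
      rw [interior_Icc] at hx
      have h1 : HasDerivAt (fun t => Real.exp (-(C * t))) (Real.exp (-(C * x)) * (-(C * 1))) x :=
        (((hasDerivAt_id x).const_mul C).neg).exp
      exact (((hd x hx).mul h1).sub ((hasDerivAt_id x).const_mul D)).hasDerivWithinAt
    · intro x hx
      rw [interior_Icc] at hx
      have h1 := hle x hx
      have h2 : 0 < Real.exp (-(C * x)) := Real.exp_pos _
      have h3 : Real.exp (-(C * x)) ≤ 1 := by
        rw [Real.exp_le_one_iff]; nlinarith [hx.1]
      nlinarith [mul_le_mul_of_nonneg_right h1 h2.le, mul_le_mul_of_nonneg_left h3 hD]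
  have h0 : (0:ℝ) ∈ Icc 0 S := ⟨le_rfl, ht.1.trans ht.2⟩
  have := key h0 ht ht.1
  simp only [mul_zero, neg_zero, Real.exp_zero, mul_one, sub_zero] at this
  have h2 : 0 < Real.exp (C * t) := Real.exp_pos _
  have h4 : Real.exp (-(C * t)) * Real.exp (C * t) = 1 := by rw [← Real.exp_add]; simp
  calc E t = (E t * Real.exp (-(C * t))) * Real.exp (C * t) := by rw [mul_assoc, h4, mul_one]
    _ ≤ _ := by apply mul_le_mul_of_nonneg_right _ h2.le; linarith

theorem boot {Y : ℝ → ℝ} {S B : ℝ} (hc : ContinuousOn Y (Icc 0 S))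
    (h : ∀ s ∈ Icc 0 S, (∀ r, 0 ≤ r → r < s → Y r ≤ B) → Y s < B) :
    ∀ s ∈ Icc 0 S, Y s ≤ B := by
  by_contra hcon
  push Not at hcon
  obtain ⟨s1, hs1, hY⟩ := hcon
  set A := Icc 0 s1 ∩ Y ⁻¹' (Ici B) with hA
  have hcl : IsClosed A :=
    (hc.mono (Icc_subset_Icc_right hs1.2)).preimage_isClosed_of_isClosed isClosed_Icc isClosed_Ici
  have hne : A.Nonempty := ⟨s1, ⟨hs1.1, le_rfl⟩, hY.le⟩
  have hbd : BddBelow A := ⟨0, fun x hx => hx.1.1⟩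
  have hm := hcl.csInf_mem hne hbd
  have := h (sInf A) ⟨hm.1.1, hm.1.2.trans hs1.2⟩ (by
    intro r hr0 hr
    by_contra hh
    push Not at hh
    have : r ∈ A := ⟨⟨hr0, hr.le.trans hm.1.2⟩, hh.le⟩
    exact absurd (csInf_le hbd this) (not_le.mpr hr))
  exact absurd hm.2 (not_le.mpr this)

/-- derivative on the closed unit interval -/
def D01 (f f' : ℝ → ℝ) : Prop := ∀ x ∈ Icc (0:ℝ) 1, HasDerivWithinAt f (f' x) (Icc 0 1) x

theorem D01.cont {f f' : ℝ → ℝ} (h : D01 f f') : ContinuousOn f (Icc 0 1) :=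
  fun x hx => (h x hx).continuousWithinAt

theorem ftcOn {a b : ℝ} (hab : a ≤ b) {f f' : ℝ → ℝ}
    (h : ∀ x ∈ Icc a b, HasDerivWithinAt f (f' x) (Icc a b) x)
    (hc : ContinuousOn f' (Icc a b)) : ∫ x in a..b, f' x = f b - f a := by
  apply intervalIntegral.integral_eq_sub_of_hasDerivAt_of_le hab
  · exact fun x hx => (h x hx).continuousWithinAt
  · intro x hx
    exact (h x (Ioo_subset_Icc_self hx)).hasDerivAt (Icc_mem_nhds hx.1 hx.2)
  · exact hc.intervalIntegrable_of_Icc hab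

theorem D01.ftc {f f' : ℝ → ℝ} (h : D01 f f') (hc : ContinuousOn f' (Icc 0 1)) :
    ∫ x in (0:ℝ)..1, f' x = f 1 - f 0 := ftcOn zero_le_one h hc

theorem D01.ftc2 {f f' : ℝ → ℝ} (h : D01 f f') (hc : ContinuousOn f' (Icc 0 1)) {a b : ℝ}
    (ha : 0 ≤ a) (hab : a ≤ b) (hb : b ≤ 1) :
    ∫ x in a..b, f' x = f b - f a :=
  ftcOn hab (fun x hx => (h x ⟨ha.trans hx.1, hx.2.trans hb⟩).mono
    (Icc_subset_Icc ha hb)) (hc.mono (Icc_subset_Icc ha hb))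

theorem D01.mul {f f' g g' : ℝ → ℝ} (hf : D01 f f') (hg : D01 g g') :
    D01 (fun x => f x * g x) (fun x => f' x * g x + f x * g' x) :=
  fun x hx => (hf x hx).mul (hg x hx)

theorem D01.add {f f' g g' : ℝ → ℝ} (hf : D01 f f') (hg : D01 g g') :
    D01 (fun x => f x + g x) (fun x => f' x + g' x) :=
  fun x hx => (hf x hx).add (hg x hx)

theorem D01.sub {f f' g g' : ℝ → ℝ} (hf : D01 f f') (hg : D01 g g') :
    D01 (fun x => f x - g x) (fun x => f' x - g' x) :=
  fun x hx => (hf x hx).sub (hg x hx)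

theorem D01.const_mul {f f' : ℝ → ℝ} (c : ℝ) (hf : D01 f f') :
    D01 (fun x => c * f x) (fun x => c * f' x) :=
  fun x hx => (hf x hx).const_mul c

theorem ii01 {f : ℝ → ℝ} (hc : ContinuousOn f (Icc 0 1)) :
    IntervalIntegrable f MeasureTheory.volume 0 1 := hc.intervalIntegrable_of_Icc zero_le_one

theorem int01_mono {f g : ℝ → ℝ} (hf : ContinuousOn f (Icc 0 1)) (hg : ContinuousOn g (Icc 0 1))
    (h : ∀ x ∈ Icc (0:ℝ) 1, f x ≤ g x) : ∫ x in (0:ℝ)..1, f x ≤ ∫ x in (0:ℝ)..1, g x :=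
  intervalIntegral.integral_mono_on zero_le_one (ii01 hf) (ii01 hg) h

theorem int01_nonneg {f : ℝ → ℝ} (h : ∀ x ∈ Icc (0:ℝ) 1, 0 ≤ f x) :
    0 ≤ ∫ x in (0:ℝ)..1, f x :=
  intervalIntegral.integral_nonneg zero_le_one h

/-- integration by parts with vanishing boundary terms -/
theorem D01.ibp {f f' g g' : ℝ → ℝ} (hf : D01 f f') (hg : D01 g g')
    (hf' : ContinuousOn f' (Icc 0 1)) (hg' : ContinuousOn g' (Icc 0 1))
    (h0 : f 0 * g 0 = 0) (h1 : f 1 * g 1 = 0) :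
    ∫ x in (0:ℝ)..1, f x * g' x = - ∫ x in (0:ℝ)..1, f' x * g x := by
  have c1 := hf.cont
  have c2 := hg.cont
  have := (hf.mul hg).ftc (by fun_prop)
  rw [intervalIntegral.integral_add (ii01 (by fun_prop)) (ii01 (by fun_prop)), h0, h1] at this
  linarith

/-- Sobolev inequality with parameter -/
theorem D01.sob {f f' : ℝ → ℝ} (hf : D01 f f') (hf' : ContinuousOn f' (Icc 0 1)) {κ : ℝ} (hκ : 0 < κ)
    {x : ℝ} (hx : x ∈ Icc (0:ℝ) 1) :
    f x ^ 2 ≤ (1 + 1/κ) * (∫ y in (0:ℝ)..1, f y ^ 2) + κ * ∫ y in (0:ℝ)..1, f' y ^ 2 := by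
  have c1 := hf.cont
  have hd := hf.mul hf
  have hdc : ContinuousOn (fun x => f' x * f x + f x * f' x) (Icc 0 1) := by fun_prop
  set I := ∫ y in (0:ℝ)..1, ((1/κ) * f y ^ 2 + κ * f' y ^2) with hI
  have hcI : ContinuousOn (fun y => (1/κ) * f y ^ 2 + κ * f' y ^2) (Icc 0 1) := by fun_prop
  have hyo : ∀ y, f' y * f y + f y * f' y ≤ (1/κ) * f y ^ 2 + κ * f' y ^2 ∧
      -(f' y * f y + f y * f' y) ≤ (1/κ) * f y ^ 2 + κ * f' y ^2 := by
    intro y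
    have e1 : (1/κ) * f y ^ 2 + κ * f' y ^2 - (f' y * f y + f y * f' y)
        = (1/κ) * (f y - κ * f' y)^2 := by field_simp; ring
    have e2 : (1/κ) * f y ^ 2 + κ * f' y ^2 + (f' y * f y + f y * f' y)
        = (1/κ) * (f y + κ * f' y)^2 := by field_simp; ring
    have p1 : 0 ≤ (1/κ) * (f y - κ * f' y)^2 := by positivity
    have p2 : 0 ≤ (1/κ) * (f y + κ * f' y)^2 := by positivity
    constructor <;> linarith
  have hpart : ∀ a b, 0 ≤ a → a ≤ b → b ≤ 1 →
      |f b * f b - f a * f a| ≤ I := by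
    intro a b ha hab hb
    have hsub : Icc a b ⊆ Icc 0 1 := Icc_subset_Icc ha hb
    have hle : (∫ y in a..b, ((1/κ) * f y ^ 2 + κ * f' y ^2)) ≤ I := by
      apply intervalIntegral.integral_mono_interval ha hab hb
      · exact Filter.Eventually.of_forall fun y => by positivity
      · exact ii01 hcI
    rw [← hd.ftc2 hdc ha hab hb, abs_le]
    have i1 := (hcI.mono hsub).intervalIntegrable_of_Icc (μ := MeasureTheory.volume) hab
    have i2 := (hdc.mono hsub).intervalIntegrable_of_Icc (μ := MeasureTheory.volume) hab
    constructor
    · have := intervalIntegral.integral_mono_on hab i2.neg i1 (fun y _ => (hyo y).2)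
      simp only [Pi.neg_apply, intervalIntegral.integral_neg] at this
      linarith
    · have := intervalIntegral.integral_mono_on hab i2 i1 (fun y _ => (hyo y).1)
      linarith
  have hpt : ∀ y ∈ Icc (0:ℝ) 1, f x ^2 ≤ f y ^2 + I := by
    intro y hy
    rcases le_total x y with h | h
    · have := (abs_le.1 (hpart x y hx.1 h hy.2)).1; nlinarith
    · have := (abs_le.1 (hpart y x hy.1 h hx.2)).2; nlinarith
  have h3 := int01_mono (f := fun _ => f x ^2) (g := fun y => f y ^2 + I) (by fun_prop) (by fun_prop) hpt
  rw [intervalIntegral.integral_add (ii01 (by fun_prop)) (ii01 (by fun_prop))] at h3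
  simp only [intervalIntegral.integral_const, sub_zero, one_smul] at h3
  have hI2 : I = (1/κ) * (∫ y in (0:ℝ)..1, f y ^ 2) + κ * ∫ y in (0:ℝ)..1, f' y ^ 2 := by
    rw [hI, intervalIntegral.integral_add (ii01 (by fun_prop)) (ii01 (by fun_prop)),
      intervalIntegral.integral_const_mul, intervalIntegral.integral_const_mul]
  rw [hI2] at h3
  linarith

theorem dui {f f' : ℝ → ℝ → ℝ} {S : ℝ}
    (hf : ContinuousOn (fun p : ℝ × ℝ => f p.1 p.2) (Icc 0 1 ×ˢ Icc 0 S))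
    (hf' : ContinuousOn (fun p : ℝ × ℝ => f' p.1 p.2) (Icc 0 1 ×ˢ Icc 0 S))
    (hd : ∀ y ∈ Icc (0:ℝ) 1, ∀ s ∈ Icc 0 S, HasDerivWithinAt (f y) (f' y s) (Icc 0 S) s) :
    ContinuousOn (fun s => ∫ y in (0:ℝ)..1, f y s) (Icc 0 S) ∧
    ∀ s ∈ Ioo 0 S, HasDerivAt (fun s => ∫ y in (0:ℝ)..1, f y s) (∫ y in (0:ℝ)..1, f' y s) s := by
  have hK : IsCompact ((Icc (0:ℝ) 1) ×ˢ (Icc 0 S)) := isCompact_Icc.prod isCompact_Icc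
  obtain ⟨M, hM⟩ := hK.exists_bound_of_continuousOn hf
  obtain ⟨M', hM'⟩ := hK.exists_bound_of_continuousOn hf'
  have hsec : ∀ g : ℝ → ℝ → ℝ, ContinuousOn (fun p : ℝ × ℝ => g p.1 p.2) (Icc 0 1 ×ˢ Icc 0 S) →
      ∀ s ∈ Icc 0 S, ContinuousOn (fun y => g y s) (Icc 0 1) := by
    intro g hg s hs
    exact hg.comp (f := fun y : ℝ => (y, s)) (by fun_prop) (fun y hy => ⟨hy, hs⟩)
  have hmeas : ∀ g : ℝ → ℝ → ℝ, ContinuousOn (fun p : ℝ × ℝ => g p.1 p.2) (Icc 0 1 ×ˢ Icc 0 S) →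
      ∀ s ∈ Icc 0 S, MeasureTheory.AEStronglyMeasurable (fun y => g y s)
        (MeasureTheory.volume.restrict (Set.uIoc (0:ℝ) 1)) := by
    intro g hg s hs
    exact (ii01 (hsec g hg s hs)).def'.aestronglyMeasurable
  have hu : ∀ y, y ∈ Set.uIoc (0:ℝ) 1 → y ∈ Icc (0:ℝ) 1 := by
    intro y hy; rw [uIoc_of_le zero_le_one] at hy; exact Ioc_subset_Icc_self hy
  constructor
  · intro s hs
    apply intervalIntegral.continuousWithinAt_of_dominated_interval (bound := fun _ => M)
    · filter_upwards [self_mem_nhdsWithin] with r hr using hmeas f hf r hr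
    · filter_upwards [self_mem_nhdsWithin] with r hr
      exact Filter.Eventually.of_forall fun y hy => hM (y, r) ⟨hu y hy, hr⟩
    · exact intervalIntegrable_const
    · exact Filter.Eventually.of_forall fun y hy => (hd y (hu y hy) s hs).continuousWithinAt
  · intro s hs
    have hs' := Ioo_subset_Icc_self hs
    refine (intervalIntegral.hasDerivAt_integral_of_dominated_loc_of_deriv_le (F' := fun s y => f' y s)
      (F := fun s y => f y s)
      (bound := fun _ => M') (s := Ioo 0 S) (Ioo_mem_nhds hs.1 hs.2) ?_ ?_ ?_ ?_ ?_ ?_).2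
    · filter_upwards [Ioo_mem_nhds hs.1 hs.2] with r hr using hmeas f hf r (Ioo_subset_Icc_self hr)
    · exact ii01 (hsec f hf s hs')
    · exact hmeas f' hf' s hs'
    · exact Filter.Eventually.of_forall fun y hy r hr =>
        hM' (y, r) ⟨hu y hy, Ioo_subset_Icc_self hr⟩
    · exact intervalIntegrable_const
    · exact Filter.Eventually.of_forall fun y hy r hr =>
        (hd y (hu y hy) r (Ioo_subset_Icc_self hr)).hasDerivAt (Icc_mem_nhds hr.1 hr.2)

/-- sequence of successive derivatives -/
def IsJet (P : ℕ → ℝ → ℝ) : Prop := ∀ k x, HasDerivAt (P k) (P (k+1) x) x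

/-- vanishing of derivatives of a given parity at the end points -/
def Van (e : ℕ) (P : ℕ → ℝ → ℝ) : Prop := ∀ k, Odd (k + e) → P k 0 = 0 ∧ P k 1 = 0

theorem IsJet.cont {P : ℕ → ℝ → ℝ} (h : IsJet P) (k : ℕ) : Continuous (P k) :=
  continuous_iff_continuousAt.2 fun x => (h k x).continuousAt

theorem IsJet.d01 {P : ℕ → ℝ → ℝ} (h : IsJet P) (k : ℕ) : D01 (P k) (P (k+1)) :=
  fun x _ => (h k x).hasDerivWithinAt

theorem IsJet.ibp {F P : ℕ → ℝ → ℝ} (hF : IsJet F) (hP : IsJet P) {e e' : ℕ} (vF : Van e F)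
    (vP : Van e' P) {a b : ℕ} (hab : Odd (a + b + e + e')) :
    ∫ x in (0:ℝ)..1, F a x * P (b+1) x = - ∫ x in (0:ℝ)..1, F (a+1) x * P b x := by
  have : Odd (a + e) ∨ Odd (b + e') := by
    by_contra hc
    push Not at hc
    rw [Nat.not_odd_iff_even, Nat.not_odd_iff_even] at hc
    have := hc.1.add hc.2
    rw [show a + e + (b + e') = a + b + e + e' by ring, ← Nat.not_odd_iff_even] at this
    exact this hab
  apply (hF.d01 a).ibp (hP.d01 b) (hF.cont _).continuousOn (hP.cont _).continuousOn
  · rcases this with h | h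
    · rw [(vF a h).1, zero_mul]
    · rw [(vP b h).1, mul_zero]
  · rcases this with h | h
    · rw [(vF a h).2, zero_mul]
    · rw [(vP b h).2, mul_zero]

/-- iterated integration by parts -/
theorem IsJet.ibpn {F P : ℕ → ℝ → ℝ} (hF : IsJet F) (hP : IsJet P) {e e' : ℕ} (vF : Van e F)
    (vP : Van e' P) (j : ℕ) : ∀ {a b : ℕ} (_ : Even (a + b + j + e + e')),
    ∫ x in (0:ℝ)..1, F a x * P (b+j) x = (-1)^j * ∫ x in (0:ℝ)..1, F (a+j) x * P b x := by
  induction j with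
  | zero => intro a b _; simp
  | succ j ih =>
    intro a b hab
    have h1 := hF.ibp hP vF vP (a := a) (b := b + j) (by
      rw [show a + b + (j+1) + e + e' = a + (b+j) + e + e' + 1 by ring] at hab
      rcases Nat.even_or_odd (a + (b+j) + e + e') with h | h
      · exact absurd (h.add_one) (Nat.not_odd_iff_even.2 hab)
      · exact h)
    have h2 := ih (a := a+1) (b := b) (by convert hab using 1; ring)
    rw [show b + (j+1) = b + j + 1 by ring, h1, h2, show a + (j+1) = a+1+j by ring]
    ring

def jsum (n : ℕ) (c : ℕ → ℝ) (𝓔 : ℕ → ℕ → ℝ → ℝ) : ℕ → ℝ → ℝ :=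
  fun j x => ∑ k ∈ Finset.range n, c k * 𝓔 k j x

structure Fam (𝓔 : ℕ → ℕ → ℝ → ℝ) (μ : ℕ → ℝ) (e : ℕ) : Prop where
  jet : ∀ k, IsJet (𝓔 k)
  van : ∀ k, Van e (𝓔 k)
  eig : ∀ k j x, 𝓔 k (j+2) x = - (μ k)^2 * 𝓔 k j x
  orth : ∀ k l, ∫ x in (0:ℝ)..1, 𝓔 k 0 x * 𝓔 l 0 x = if k = l then 1 else 0
  mono : ∀ k l, k ≤ l → μ k ≤ μ l
  nonneg : ∀ k, 0 ≤ μ k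
  big : ∀ k, μ k = 0 ∨ 1 ≤ μ k
  lower : ∀ k : ℕ, (k:ℝ) ≤ μ k
  compl : ∀ g g' : ℝ → ℝ, D01 g g' → ContinuousOn g' (Icc 0 1) → (e = 0 ∨ (g 0 = 0 ∧ g 1 = 0)) →
    ∀ δ > 0, ∃ m c, ∫ x in (0:ℝ)..1, (g x - jsum m c 𝓔 0 x)^2 ≤ δ

namespace Fam

theorem jetS {𝓔 : ℕ → ℕ → ℝ → ℝ} {μ : ℕ → ℝ} {e : ℕ} (F : Fam 𝓔 μ e) (n : ℕ) (c : ℕ → ℝ) : IsJet (jsum n c 𝓔) := by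
  intro j x
  exact HasDerivAt.fun_sum fun k _ => (F.jet k j x).const_mul (c k)

theorem vanS {𝓔 : ℕ → ℕ → ℝ → ℝ} {μ : ℕ → ℝ} {e : ℕ} (F : Fam 𝓔 μ e) (n : ℕ) (c : ℕ → ℝ) : Van e (jsum n c 𝓔) := by
  intro j hj
  constructor
  · exact Finset.sum_eq_zero fun k _ => by rw [(F.van k j hj).1, mul_zero]
  · exact Finset.sum_eq_zero fun k _ => by rw [(F.van k j hj).2, mul_zero]

theorem eig2 {𝓔 : ℕ → ℕ → ℝ → ℝ} {μ : ℕ → ℝ} {e : ℕ} (F : Fam 𝓔 μ e) (k j : ℕ) (x : ℝ) : 𝓔 k (2*j) x = (-1)^j * (μ k)^(2*j) * 𝓔 k 0 x := by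
  induction j with
  | zero => simp
  | succ j ih => rw [show 2*(j+1) = 2*j+2 by ring, F.eig, ih]; ring

theorem jsum_even {𝓔 : ℕ → ℕ → ℝ → ℝ} {μ : ℕ → ℝ} {e : ℕ} (F : Fam 𝓔 μ e) (n : ℕ) (c : ℕ → ℝ) (j : ℕ) (x : ℝ) :
    jsum n c 𝓔 (2*j) x = (-1)^j * jsum n (fun k => (μ k)^(2*j) * c k) 𝓔 0 x := by
  simp only [jsum, Finset.mul_sum]
  exact Finset.sum_congr rfl fun k _ => by rw [F.eig2]; ring

theorem pair {𝓔 : ℕ → ℕ → ℝ → ℝ} {μ : ℕ → ℝ} {e : ℕ} (F : Fam 𝓔 μ e) (n : ℕ) (c : ℕ → ℝ) {g : ℝ → ℝ} (hg : ContinuousOn g (Icc 0 1)) :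
    ∫ x in (0:ℝ)..1, g x * jsum n c 𝓔 0 x
      = ∑ k ∈ Finset.range n, c k * ∫ x in (0:ℝ)..1, g x * 𝓔 k 0 x := by
  simp only [jsum, Finset.mul_sum]
  rw [intervalIntegral.integral_finsetSum]
  · refine Finset.sum_congr rfl fun k _ => ?_
    rw [← intervalIntegral.integral_const_mul]
    congr 1; ext x; ring
  · intro k _
    have := ((F.jet k).cont 0).continuousOn (s := Icc 0 1)
    exact ii01 (by fun_prop)

theorem coef {𝓔 : ℕ → ℕ → ℝ → ℝ} {μ : ℕ → ℝ} {e : ℕ} (F : Fam 𝓔 μ e) (n : ℕ) (c : ℕ → ℝ) {k : ℕ} (hk : k < n) :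
    ∫ x in (0:ℝ)..1, 𝓔 k 0 x * jsum n c 𝓔 0 x = c k := by
  rw [F.pair n c ((F.jet k).cont 0).continuousOn]
  simp only [F.orth]
  simp [hk]

theorem pairS {𝓔 : ℕ → ℕ → ℝ → ℝ} {μ : ℕ → ℝ} {e : ℕ} (F : Fam 𝓔 μ e) (n : ℕ) (c d : ℕ → ℝ) :
    ∫ x in (0:ℝ)..1, jsum n c 𝓔 0 x * jsum n d 𝓔 0 x = ∑ k ∈ Finset.range n, d k * c k := by
  rw [F.pair n d ((F.jetS n c).cont 0).continuousOn]
  refine Finset.sum_congr rfl fun k hk => ?_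
  rw [← F.coef n c (Finset.mem_range.1 hk)]
  congr 2; ext x; ring

theorem energy {𝓔 : ℕ → ℕ → ℝ → ℝ} {μ : ℕ → ℝ} {e : ℕ} (F : Fam 𝓔 μ e) (n : ℕ) (c : ℕ → ℝ) (j : ℕ) :
    ∫ x in (0:ℝ)..1, (jsum n c 𝓔 j x)^2 = ∑ k ∈ Finset.range n, (μ k)^(2*j) * c k ^2 := by
  have h := (F.jetS n c).ibpn (F.jetS n c) (F.vanS n c) (F.vanS n c) j (a := 0) (b := j)
    (by rw [show 0 + j + j + e + e = 2 * (j + e) by ring]; exact even_two_mul _)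
  rw [zero_add] at h
  have h2 : (∫ x in (0:ℝ)..1, (jsum n c 𝓔 j x)^2) = ∫ x in (0:ℝ)..1, jsum n c 𝓔 j x * jsum n c 𝓔 j x := by
    congr 1; ext x; ring
  have h3 : (-1:ℝ)^j * (-1)^j = 1 := by rw [← mul_pow]; simp
  have h5 : (∫ x in (0:ℝ)..1, jsum n c 𝓔 j x * jsum n c 𝓔 j x)
      = (-1)^j * ((-1)^j * ∫ x in (0:ℝ)..1, jsum n c 𝓔 j x * jsum n c 𝓔 j x) := by
    rw [← mul_assoc, h3, one_mul]
  rw [h2, h5, ← h]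
  have h4 : (∫ x in (0:ℝ)..1, jsum n c 𝓔 0 x * jsum n c 𝓔 (j+j) x)
      = (-1)^j * ∫ x in (0:ℝ)..1, jsum n c 𝓔 0 x * jsum n (fun k => (μ k)^(2*j) * c k) 𝓔 0 x := by
    rw [← intervalIntegral.integral_const_mul]
    congr 1; ext x; rw [show j + j = 2*j by ring, F.jsum_even]; ring
  rw [h4, F.pairS, ← mul_assoc, h3, one_mul]
  exact Finset.sum_congr rfl fun k _ => by ring

/-- Fourier coefficients -/
theorem dist {𝓔 : ℕ → ℕ → ℝ → ℝ} {μ : ℕ → ℝ} {e : ℕ} (F : Fam 𝓔 μ e) (n : ℕ) (c : ℕ → ℝ) {g : ℝ → ℝ} (hg : ContinuousOn g (Icc 0 1)) :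
    ∫ x in (0:ℝ)..1, (g x - jsum n c 𝓔 0 x)^2 = (∫ x in (0:ℝ)..1, g x ^2)
      - ∑ k ∈ Finset.range n, (∫ x in (0:ℝ)..1, g x * 𝓔 k 0 x)^2
      + ∑ k ∈ Finset.range n, ((∫ x in (0:ℝ)..1, g x * 𝓔 k 0 x) - c k)^2 := by
  have hc := ((F.jetS n c).cont 0).continuousOn (s := Icc 0 1)
  have e1 : ∀ x, (g x - jsum n c 𝓔 0 x)^2 = g x ^2 - 2 * (g x * jsum n c 𝓔 0 x)
      + jsum n c 𝓔 0 x * jsum n c 𝓔 0 x := fun x => by ring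
  simp only [e1]
  rw [intervalIntegral.integral_add (ii01 (by fun_prop)) (ii01 (by fun_prop)),
    intervalIntegral.integral_sub (ii01 (by fun_prop)) (ii01 (by fun_prop)),
    intervalIntegral.integral_const_mul, F.pair n c hg, F.pairS, sub_add, sub_add, Finset.mul_sum,
    ← Finset.sum_sub_distrib, ← Finset.sum_sub_distrib]
  congr 2
  funext k; ring

theorem two {R : ℕ → ℝ → ℝ} (hR : IsJet R) {e : ℕ} (vR : Van e R) {k : ℕ} (hk : Even k)
    {g g1 g2 : ℝ → ℝ} (h1 : D01 g g1) (h2 : D01 g1 g2) (hc : ContinuousOn g2 (Icc 0 1))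
    (hb : (e = 0 ∧ g1 0 = 0 ∧ g1 1 = 0) ∨ (e = 1 ∧ g 0 = 0 ∧ g 1 = 0)) :
    ∫ x in (0:ℝ)..1, g2 x * R k x = ∫ x in (0:ℝ)..1, g x * R (k+2) x := by
  have a1 := h2.ibp (hR.d01 k) hc (hR.cont _).continuousOn
    (by
      rcases hb with h | h
      · rw [h.2.1, zero_mul]
      · rw [(vR k (by rw [h.1]; exact hk.add_one)).1, mul_zero])
    (by
      rcases hb with h | h
      · rw [h.2.2, zero_mul]
      · rw [(vR k (by rw [h.1]; exact hk.add_one)).2, mul_zero])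
  have a2 := h1.ibp (hR.d01 (k+1)) h2.cont (hR.cont _).continuousOn
    (by
      rcases hb with h | h
      · rw [(vR (k+1) (by rw [h.1]; exact hk.add_one)).1, mul_zero]
      · rw [h.2.1, zero_mul])
    (by
      rcases hb with h | h
      · rw [(vR (k+1) (by rw [h.1]; exact hk.add_one)).2, mul_zero]
      · rw [h.2.2, zero_mul])
  linarith

theorem bess {f f1 : ℝ → ℝ} (hf : ContinuousOn f (Icc 0 1)) (hf1 : ContinuousOn f1 (Icc 0 1))
    (h : ∫ x in (0:ℝ)..1, f x * f1 x = ∫ x in (0:ℝ)..1, f1 x ^ 2) :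
    ∫ x in (0:ℝ)..1, f1 x ^ 2 ≤ ∫ x in (0:ℝ)..1, f x ^ 2 := by
  have h0 : 0 ≤ ∫ x in (0:ℝ)..1, (f x - f1 x)^2 := int01_nonneg fun x _ => sq_nonneg _
  have e1 : ∀ x, (f x - f1 x)^2 = f x ^2 - 2 * (f x * f1 x) + f1 x ^ 2 := fun x => by ring
  simp only [e1] at h0
  rw [intervalIntegral.integral_add (ii01 (by fun_prop)) (ii01 (by fun_prop)),
    intervalIntegral.integral_sub (ii01 (by fun_prop)) (ii01 (by fun_prop)),
    intervalIntegral.integral_const_mul, h] at h0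
  linarith

/-- pairing with an even derivative of the Fourier partial sum -/
theorem pairEven {𝓔 : ℕ → ℕ → ℝ → ℝ} {μ : ℕ → ℝ} {e : ℕ} (F : Fam 𝓔 μ e) (n j : ℕ)
    {g : ℝ → ℝ} (hg : ContinuousOn g (Icc 0 1)) :
    ∫ x in (0:ℝ)..1, g x * jsum n (fun k => ∫ x in (0:ℝ)..1, g x * 𝓔 k 0 x) 𝓔 (2*j) x
      = (-1)^j * ∫ x in (0:ℝ)..1, (jsum n (fun k => ∫ x in (0:ℝ)..1, g x * 𝓔 k 0 x) 𝓔 j x)^2 := by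
  rw [F.energy]
  simp only [F.jsum_even n _ j]
  have e1 : ∀ x, g x * ((-1)^j * jsum n (fun k => (μ k)^(2*j) * ∫ x in (0:ℝ)..1, g x * 𝓔 k 0 x) 𝓔 0 x)
    = (-1)^j * (g x * jsum n (fun k => (μ k)^(2*j) * ∫ x in (0:ℝ)..1, g x * 𝓔 k 0 x) 𝓔 0 x) :=
    fun x => by ring
  simp only [e1]
  rw [intervalIntegral.integral_const_mul, F.pair _ _ hg]
  congr 1
  exact Finset.sum_congr rfl fun k _ => by ring

theorem bessel1 {𝓔 : ℕ → ℕ → ℝ → ℝ} {μ : ℕ → ℝ} {e : ℕ} (F : Fam 𝓔 μ e) (n : ℕ)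
    {g g1 : ℝ → ℝ} (h1 : D01 g g1) (hc : ContinuousOn g1 (Icc 0 1))
    (hb : e = 0 ∨ (g 0 = 0 ∧ g 1 = 0)) :
    ∫ x in (0:ℝ)..1, (jsum n (fun k => ∫ x in (0:ℝ)..1, g x * 𝓔 k 0 x) 𝓔 1 x)^2
      ≤ ∫ x in (0:ℝ)..1, g1 x ^ 2 := by
  set c := fun k => ∫ x in (0:ℝ)..1, g x * 𝓔 k 0 x with hcdef
  have J := F.jetS n c
  apply bess hc (J.cont 1).continuousOn
  have a := h1.ibp (J.d01 1) hc (J.cont _).continuousOn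
    (by
      rcases hb with h | h
      · rw [(F.vanS n c 1 (by rw [h]; exact odd_one)).1, mul_zero]
      · rw [h.1, zero_mul])
    (by
      rcases hb with h | h
      · rw [(F.vanS n c 1 (by rw [h]; exact odd_one)).2, mul_zero]
      · rw [h.2, zero_mul])
  have b := F.pairEven n 1 h1.cont
  norm_num at b
  linarith

theorem bessel2 {𝓔 : ℕ → ℕ → ℝ → ℝ} {μ : ℕ → ℝ} {e : ℕ} (F : Fam 𝓔 μ e) (n : ℕ)
    {g g1 g2 : ℝ → ℝ} (h1 : D01 g g1) (h2 : D01 g1 g2) (hc : ContinuousOn g2 (Icc 0 1))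
    (hb : (e = 0 ∧ g1 0 = 0 ∧ g1 1 = 0) ∨ (e = 1 ∧ g 0 = 0 ∧ g 1 = 0)) :
    ∫ x in (0:ℝ)..1, (jsum n (fun k => ∫ x in (0:ℝ)..1, g x * 𝓔 k 0 x) 𝓔 2 x)^2
      ≤ ∫ x in (0:ℝ)..1, g2 x ^ 2 := by
  set c := fun k => ∫ x in (0:ℝ)..1, g x * 𝓔 k 0 x with hcdef
  have J := F.jetS n c
  apply bess hc (J.cont 2).continuousOn
  have a := two J (F.vanS n c) even_two h1 h2 hc hb
  have b := F.pairEven n 2 h1.cont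
  norm_num at b
  rw [a]; exact b

theorem bessel4 {𝓔 : ℕ → ℕ → ℝ → ℝ} {μ : ℕ → ℝ} {e : ℕ} (F : Fam 𝓔 μ e) (n : ℕ)
    {g g1 g2 g3 g4 : ℝ → ℝ} (h1 : D01 g g1) (h2 : D01 g1 g2) (h3 : D01 g2 g3) (h4 : D01 g3 g4)
    (hc : ContinuousOn g4 (Icc 0 1))
    (hb : (e = 0 ∧ g1 0 = 0 ∧ g1 1 = 0) ∨ (e = 1 ∧ g 0 = 0 ∧ g 1 = 0))
    (hb' : (e = 0 ∧ g3 0 = 0 ∧ g3 1 = 0) ∨ (e = 1 ∧ g2 0 = 0 ∧ g2 1 = 0)) :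
    ∫ x in (0:ℝ)..1, (jsum n (fun k => ∫ x in (0:ℝ)..1, g x * 𝓔 k 0 x) 𝓔 4 x)^2
      ≤ ∫ x in (0:ℝ)..1, g4 x ^ 2 := by
  set c := fun k => ∫ x in (0:ℝ)..1, g x * 𝓔 k 0 x with hcdef
  have J := F.jetS n c
  apply bess hc (J.cont 4).continuousOn
  have a' := two J (F.vanS n c) (k := 4) (by decide) h3 h4 hc hb'
  have a := two J (F.vanS n c) (k := 6) (by decide) h1 h2 h3.cont hb
  have b := F.pairEven n 4 h1.cont
  norm_num at b a a'
  rw [a', a]; exact b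

theorem bessel3 {𝓔 : ℕ → ℕ → ℝ → ℝ} {μ : ℕ → ℝ} {e : ℕ} (F : Fam 𝓔 μ e) (n : ℕ)
    {g g1 g2 g3 : ℝ → ℝ} (h1 : D01 g g1) (h2 : D01 g1 g2) (h3 : D01 g2 g3)
    (hc : ContinuousOn g3 (Icc 0 1))
    (hb : (e = 0 ∧ g1 0 = 0 ∧ g1 1 = 0) ∨ (e = 1 ∧ g 0 = 0 ∧ g 1 = 0 ∧ g2 0 = 0 ∧ g2 1 = 0)) :
    ∫ x in (0:ℝ)..1, (jsum n (fun k => ∫ x in (0:ℝ)..1, g x * 𝓔 k 0 x) 𝓔 3 x)^2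
      ≤ ∫ x in (0:ℝ)..1, g3 x ^ 2 := by
  set c := fun k => ∫ x in (0:ℝ)..1, g x * 𝓔 k 0 x with hcdef
  have J := F.jetS n c
  apply bess hc (J.cont 3).continuousOn
  have a' := h3.ibp (J.d01 3) hc (J.cont _).continuousOn
    (by
      rcases hb with h | h
      · rw [(F.vanS n c 3 (by rw [h.1]; decide)).1, mul_zero]
      · rw [h.2.2.2.1, zero_mul])
    (by
      rcases hb with h | h
      · rw [(F.vanS n c 3 (by rw [h.1]; decide)).2, mul_zero]
      · rw [h.2.2.2.2, zero_mul])
  have a := two J (F.vanS n c) (k := 4) (by decide) h1 h2 h3.cont (by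
    rcases hb with h | h
    · exact Or.inl h
    · exact Or.inr ⟨h.1, h.2.1, h.2.2.1⟩)
  have b := F.pairEven n 3 h1.cont
  norm_num at b a a'
  linarith

theorem approx {𝓔 : ℕ → ℕ → ℝ → ℝ} {μ : ℕ → ℝ} {e : ℕ} (F : Fam 𝓔 μ e) (n : ℕ)
    {g g1 : ℝ → ℝ} (h1 : D01 g g1) (hc : ContinuousOn g1 (Icc 0 1))
    (hb : e = 0 ∨ (g 0 = 0 ∧ g 1 = 0)) :
    (n:ℝ)^2 * ∫ x in (0:ℝ)..1, (g x - jsum n (fun k => ∫ x in (0:ℝ)..1, g x * 𝓔 k 0 x) 𝓔 0 x)^2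
      ≤ ∫ x in (0:ℝ)..1, g1 x ^ 2 := by
  set c := fun k => ∫ x in (0:ℝ)..1, g x * 𝓔 k 0 x with hcdef
  apply le_of_forall_pos_le_add
  intro δ hδ
  have hpos : (0:ℝ) < (n:ℝ)^2 + 1 := by positivity
  obtain ⟨m, d, hm⟩ := F.compl g g1 h1 hc hb (δ / ((n:ℝ)^2+1)) (by positivity)
  rw [F.dist m d h1.cont] at hm
  rw [F.dist n c h1.cont]
  have z : ∑ k ∈ Finset.range n, ((∫ x in (0:ℝ)..1, g x * 𝓔 k 0 x) - c k)^2 = 0 :=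
    Finset.sum_eq_zero fun k _ => by simp [hcdef]
  rw [z]
  have z2 : 0 ≤ ∑ k ∈ Finset.range m, ((∫ x in (0:ℝ)..1, g x * 𝓔 k 0 x) - d k)^2 :=
    Finset.sum_nonneg fun k _ => sq_nonneg _
  have b1 := F.bessel1 (n+m) h1 hc hb
  rw [F.energy] at b1
  change ∑ k ∈ Finset.range (n+m), μ k ^ (2*1) * c k ^ 2 ≤ _ at b1
  change (∫ x in (0:ℝ)..1, g x ^2) - ∑ k ∈ Finset.range m, c k ^2 + _ ≤ _ at hm
  change (n:ℝ)^2 * ((∫ x in (0:ℝ)..1, g x ^2) - ∑ k ∈ Finset.range n, c k ^2 + 0) ≤ _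
  have s1 : ∑ k ∈ Finset.range m, c k ^2 ≤ ∑ k ∈ Finset.range (n+m), c k ^2 :=
    Finset.sum_le_sum_of_subset_of_nonneg (Finset.range_mono (by omega)) fun k _ _ => sq_nonneg _
  rw [Finset.sum_range_add] at s1 b1
  have s2 : 0 ≤ ∑ k ∈ Finset.range n, μ k ^ (2*1) * c k ^ 2 :=
    Finset.sum_nonneg fun k _ => mul_nonneg (pow_nonneg (F.nonneg k) _) (sq_nonneg _)
  have s3 : (n:ℝ)^2 * ∑ k ∈ Finset.range m, c (n+k) ^2 ≤ ∑ k ∈ Finset.range m, μ (n+k) ^ (2*1) * c (n+k) ^ 2 := by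
    rw [Finset.mul_sum]
    refine Finset.sum_le_sum fun k _ => mul_le_mul_of_nonneg_right ?_ (sq_nonneg _)
    rw [mul_one]
    apply pow_le_pow_left₀ (by positivity)
    exact (F.lower n).trans (F.mono _ _ (by omega))
  have s4 : (n:ℝ)^2 * ((∫ x in (0:ℝ)..1, g x ^2) - ∑ k ∈ Finset.range m, c k ^2) ≤ δ := by
    have : (∫ x in (0:ℝ)..1, g x ^2) - ∑ k ∈ Finset.range m, c k ^2 ≤ δ / ((n:ℝ)^2+1) := by linarith
    calc _ ≤ (n:ℝ)^2 * (δ / ((n:ℝ)^2+1)) := mul_le_mul_of_nonneg_left this (by positivity)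
      _ ≤ ((n:ℝ)^2+1) * (δ / ((n:ℝ)^2+1)) := by gcongr; linarith
      _ = δ := by field_simp
  have s5 := mul_le_mul_of_nonneg_left s1 (sq_nonneg (n:ℝ))
  nlinarith

end Fam

/-- trigonometric jet -/
def tj (A l φ : ℝ) : ℕ → ℝ → ℝ := fun j x => A * l^j * Real.cos (l * x + j * (Real.pi/2) + φ)

theorem tj_jet (A l φ : ℝ) : IsJet (tj A l φ) := by
  intro j x
  have h : HasDerivAt (fun x => l * x + j * (Real.pi/2) + φ) (l*1) x :=
    (((hasDerivAt_id x).const_mul l).add_const _).add_const _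
  have h2 := (h.cos).const_mul (A * l^j)
  have e : tj A l φ (j+1) x = A * l^j * (-Real.sin (l * x + j * (Real.pi/2) + φ) * (l*1)) := by
    simp only [tj]
    rw [show l * x + ((j+1:ℕ):ℝ) * (Real.pi/2) + φ = (l * x + j * (Real.pi/2) + φ) + Real.pi/2 by push_cast; ring,
      Real.cos_add_pi_div_two]
    ring
  rw [e]; exact h2

theorem tj_eig (A l φ : ℝ) (j : ℕ) (x : ℝ) : tj A l φ (j+2) x = -l^2 * tj A l φ j x := by
  simp only [tj]
  rw [show l * x + ((j+2:ℕ):ℝ) * (Real.pi/2) + φ = (l * x + j * (Real.pi/2) + φ) + Real.pi by push_cast; ring,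
    Real.cos_add_pi]
  ring

theorem tj_van (A : ℝ) (m e : ℕ) : Van e (tj A (m * Real.pi) (-(e * (Real.pi/2)))) := by
  intro j hj
  have key : ∀ i : ℤ, Odd i → Real.cos (i * (Real.pi/2)) = 0 := by
    intro i hi
    obtain ⟨r, rfl⟩ := hi
    rw [Real.cos_eq_zero_iff]
    exact ⟨r, by push_cast; ring⟩
  have hodd : Odd ((j:ℤ) - e) := by
    have : Odd ((j:ℤ) + e) := by exact_mod_cast hj
    rw [show (j:ℤ) - e = (j + e) - 2 * e by ring]
    exact this.sub_even (even_two_mul _)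
  constructor
  · simp only [tj]
    have := key ((j:ℤ) - e) hodd
    rw [show (m * Real.pi) * 0 + j * (Real.pi/2) + -(e * (Real.pi/2)) = (((j:ℤ) - e : ℤ) : ℝ) * (Real.pi/2) by push_cast; ring, this, mul_zero]
  · simp only [tj]
    have := key ((j:ℤ) - e + 2 * m) (hodd.add_even (even_two_mul _))
    rw [show (m * Real.pi) * 1 + j * (Real.pi/2) + -(e * (Real.pi/2)) = (((j:ℤ) - e + 2 * m : ℤ) : ℝ) * (Real.pi/2) by push_cast; ring, this, mul_zero]

/-- orthogonality from eigenvalue relation -/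
theorem orth_of {f g : ℕ → ℝ → ℝ} (hf : IsJet f) (hg : IsJet g) {e : ℕ} (vf : Van e f) (vg : Van e g)
    {l m : ℝ} (ef : ∀ x, f 2 x = -l^2 * f 0 x) (eg : ∀ x, g 2 x = -m^2 * g 0 x)
    (hlm : l^2 ≠ m^2) : ∫ x in (0:ℝ)..1, f 0 x * g 0 x = 0 := by
  have h := hf.ibpn hg vf vg 2 (a := 0) (b := 0) (by
    rw [show 0+0+2+e+e = 2 * (1+e) by ring]; exact even_two_mul _)
  simp only [zero_add, ef, eg] at h
  have e1 : ∀ x, f 0 x * (-m^2 * g 0 x) = -m^2 * (f 0 x * g 0 x) := fun x => by ring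
  have e2 : ∀ x, -l^2 * f 0 x * g 0 x = -l^2 * (f 0 x * g 0 x) := fun x => by ring
  simp only [e1, e2, intervalIntegral.integral_const_mul] at h
  have : (l^2 - m^2) * ∫ x in (0:ℝ)..1, f 0 x * g 0 x = 0 := by linarith
  rcases mul_eq_zero.1 this with h | h
  · exact absurd (sub_eq_zero.1 h) hlm
  · exact h

theorem tj_norm (m e : ℕ) (hm : m ≠ 0) :
    ∫ x in (0:ℝ)..1, tj (Real.sqrt 2) (m * Real.pi) (-(e * (Real.pi/2))) 0 x
      * tj (Real.sqrt 2) (m * Real.pi) (-(e * (Real.pi/2))) 0 x = 1 := by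
  set l := (m:ℝ) * Real.pi with hl
  have hl0 : l ≠ 0 := mul_ne_zero (by exact_mod_cast hm) Real.pi_ne_zero
  set f := tj (Real.sqrt 2) l (-(e * (Real.pi/2))) with hf
  have J : IsJet f := tj_jet _ _ _
  have V : Van e f := tj_van _ _ _
  have h := J.ibpn J V V 1 (a := 0) (b := 1) (by
    rw [show 0+1+1+e+e = 2 * (1+e) by ring]; exact even_two_mul _)
  have e2 : ∀ x, f 2 x = -l^2 * f 0 x := fun x => tj_eig _ _ _ 0 x
  norm_num at h
  simp only [e2] at h
  have e1 : ∀ x, f 1 x * f 1 x = 2 * l^2 - l^2 * (f 0 x * f 0 x) := by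
    intro x
    simp only [hf, tj]
    rw [show l * x + ((1:ℕ):ℝ) * (Real.pi/2) + -(e * (Real.pi/2)) = (l * x + ((0:ℕ):ℝ) * (Real.pi/2) + -(e * (Real.pi/2))) + Real.pi/2 by push_cast; ring,
      Real.cos_add_pi_div_two]
    have h1 := Real.sin_sq_add_cos_sq (l * x + ((0:ℕ):ℝ) * (Real.pi/2) + -(e * (Real.pi/2)))
    have h2 : Real.sqrt 2 ^ 2 = 2 := Real.sq_sqrt (by norm_num)
    linear_combination (Real.sqrt 2 ^ 2 * l^2) * h1 + l^2 * h2
  have e3 : ∀ x, f 0 x * (-l^2 * f 0 x) = -l^2 * (f 0 x * f 0 x) := fun x => by ring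
  have hc := J.cont 0
  simp only [e1, e3, intervalIntegral.integral_const_mul] at h
  rw [intervalIntegral.integral_sub (by simp) ((by fun_prop : Continuous fun x => l^2 * (f 0 x * f 0 x)).intervalIntegrable _ _),
    intervalIntegral.integral_const_mul (l^2)] at h
  simp only [intervalIntegral.integral_const, sub_zero, one_smul] at h
  have : l^2 * ((∫ x in (0:ℝ)..1, f 0 x * f 0 x) - 1) = 0 := by linarith
  rcases mul_eq_zero.1 this with h | h
  · exact absurd h (pow_ne_zero 2 hl0)
  · linarith

def ec : ℕ → ℕ → ℝ → ℝ := fun k => tj (if k = 0 then 1 else Real.sqrt 2) (k * Real.pi) (-((0:ℕ) * (Real.pi/2)))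
def es : ℕ → ℕ → ℝ → ℝ := fun k => tj (Real.sqrt 2) ((k+1:ℕ) * Real.pi) (-((1:ℕ) * (Real.pi/2)))

theorem ec_zero (k : ℕ) (x : ℝ) : ec k 0 x = (if k = 0 then 1 else Real.sqrt 2) * Real.cos (k * Real.pi * x) := by
  simp [ec, tj]
theorem es_zero (k : ℕ) (x : ℝ) : es k 0 x = Real.sqrt 2 * Real.sin ((k+1) * Real.pi * x) := by
  simp only [es, tj, pow_zero, mul_one]
  rw [← Real.cos_sub_pi_div_two]
  congr 2; push_cast; ring

/-- `f` is a finite cosine sum -/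
def CosSum (f : ℝ → ℝ) : Prop := ∃ (m : ℕ) (c : ℕ → ℝ), ∀ x, f x = ∑ k ∈ Finset.range m, c k * Real.cos (k * Real.pi * x)

theorem CosSum.ext_range {f : ℝ → ℝ} {m : ℕ} {c : ℕ → ℝ}
    (h : ∀ x, f x = ∑ k ∈ Finset.range m, c k * Real.cos (k * Real.pi * x)) (n : ℕ) :
    ∃ c' : ℕ → ℝ, ∀ x, f x = ∑ k ∈ Finset.range (m+n), c' k * Real.cos (k * Real.pi * x) := by
  refine ⟨fun k => if k < m then c k else 0, fun x => ?_⟩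
  rw [h, Finset.sum_range_add]
  have : ∑ k ∈ Finset.range n, (if m + k < m then c (m+k) else 0) * Real.cos (((m+k:ℕ):ℝ) * Real.pi * x) = 0 :=
    Finset.sum_eq_zero fun k _ => by rw [if_neg (by omega), zero_mul]
  rw [this, add_zero]
  exact Finset.sum_congr rfl fun k hk => by simp only [if_pos (Finset.mem_range.1 hk)]

theorem CosSum.add {f g : ℝ → ℝ} (hf : CosSum f) (hg : CosSum g) : CosSum (fun x => f x + g x) := by
  obtain ⟨m, c, h⟩ := hf
  obtain ⟨n, d, h'⟩ := hg
  obtain ⟨c', hc⟩ := CosSum.ext_range h n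
  obtain ⟨d', hd⟩ := CosSum.ext_range h' m
  refine ⟨m+n, fun k => c' k + d' k, fun x => ?_⟩
  simp only [hc, hd]; rw [add_comm n m, ← Finset.sum_add_distrib]
  exact Finset.sum_congr rfl fun k _ => by ring

theorem CosSum.smul {f : ℝ → ℝ} (a : ℝ) (hf : CosSum f) : CosSum (fun x => a * f x) := by
  obtain ⟨m, c, h⟩ := hf
  refine ⟨m, fun k => a * c k, fun x => ?_⟩
  simp only [h, Finset.mul_sum]
  exact Finset.sum_congr rfl fun k _ => by ring

theorem CosSum.cos (k : ℕ) : CosSum (fun x => Real.cos (k * Real.pi * x)) := by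
  refine ⟨k+1, fun i => if i = k then 1 else 0, fun x => ?_⟩
  simp

theorem CosSum.sum {ι : Type} (s : Finset ι) {f : ι → ℝ → ℝ} (h : ∀ i ∈ s, CosSum (f i)) :
    CosSum (fun x => ∑ i ∈ s, f i x) := by
  classical
  induction s using Finset.induction_on with
  | empty => exact ⟨0, 0, fun x => by simp⟩
  | insert a s ha ih =>
    simp only [Finset.sum_insert ha]
    exact (h a (Finset.mem_insert_self _ _)).add (ih fun i hi => h i (Finset.mem_insert_of_mem hi))

theorem CosSum.mulcos {f : ℝ → ℝ} (hf : CosSum f) : CosSum (fun x => Real.cos (Real.pi * x) * f x) := by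
  obtain ⟨m, c, h⟩ := hf
  have : ∀ k : ℕ, CosSum (fun x => Real.cos (Real.pi * x) * Real.cos (k * Real.pi * x)) := by
    intro k
    rcases k with _ | k
    · simpa using CosSum.cos 1
    · have h2 := ((CosSum.cos k).smul (1/2)).add ((CosSum.cos (k+2)).smul (1/2))
      convert h2 using 2 with x
      have a1 := Real.cos_add ((k+1) * Real.pi * x) (Real.pi * x)
      have a2 := Real.cos_sub ((k+1) * Real.pi * x) (Real.pi * x)
      rw [show ((k+1:ℝ) * Real.pi * x) + Real.pi * x = ((k+2:ℕ):ℝ) * Real.pi * x by push_cast; ring] at a1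
      rw [show ((k+1:ℝ) * Real.pi * x) - Real.pi * x = (k:ℝ) * Real.pi * x by ring] at a2
      rw [a1, a2]; push_cast; ring
  have h3 := CosSum.sum (Finset.range m) (fun k _ => (this k).smul (c k))
  convert h3 using 2 with x
  rw [h, Finset.mul_sum]
  exact Finset.sum_congr rfl fun k _ => by ring

theorem CosSum.pow (n : ℕ) : CosSum (fun x => Real.cos (Real.pi * x) ^ n) := by
  induction n with
  | zero => simpa using CosSum.cos 0
  | succ n ih =>
    have := ih.mulcos
    simpa [pow_succ, mul_comm] using this

theorem CosSum.poly (p : Polynomial ℝ) : CosSum (fun x => p.eval (Real.cos (Real.pi * x))) := by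
  simp only [Polynomial.eval_eq_sum_range]
  exact CosSum.sum _ fun i _ => (CosSum.pow i).smul _

/-- uniform density of cosine sums -/
theorem cosDense {g : ℝ → ℝ} (hg : ContinuousOn g (Icc 0 1)) {δ : ℝ} (hδ : 0 < δ) :
    ∃ f, CosSum f ∧ ∀ x ∈ Icc (0:ℝ) 1, |g x - f x| ≤ δ := by
  have hG : ContinuousOn (fun y => g (Real.arccos y / Real.pi)) (Icc (-1) 1) := by
    apply hg.comp (by fun_prop)
    intro y _
    exact ⟨div_nonneg (Real.arccos_nonneg y) Real.pi_pos.le, (div_le_one Real.pi_pos).2 (Real.arccos_le_pi y)⟩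
  obtain ⟨p, hp⟩ := exists_polynomial_near_of_continuousOn (-1) 1 _ hG δ hδ
  refine ⟨_, CosSum.poly p, fun x hx => ?_⟩
  have := hp (Real.cos (Real.pi * x)) ⟨Real.neg_one_le_cos _, Real.cos_le_one _⟩
  rw [Real.arccos_cos (by have := Real.pi_pos; nlinarith [hx.1]) (by have := Real.pi_pos; nlinarith [hx.2]),
    mul_div_cancel_left₀ _ Real.pi_ne_zero, abs_sub_comm] at this
  exact this.le

theorem sq_small {g f : ℝ → ℝ} (hg : ContinuousOn g (Icc 0 1)) (hf : ContinuousOn f (Icc 0 1)) {δ : ℝ}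
    (h : ∀ x ∈ Icc (0:ℝ) 1, |g x - f x| ≤ δ) : ∫ x in (0:ℝ)..1, (g x - f x)^2 ≤ δ^2 := by
  have := int01_mono (f := fun x => (g x - f x)^2) (g := fun _ => δ^2) (by fun_prop) (by fun_prop)
    (fun x hx => sq_le_sq' (by have := (abs_le.1 (h x hx)).1; linarith) (abs_le.1 (h x hx)).2)
  simpa using this

theorem ec_jet (k : ℕ) : IsJet (ec k) := tj_jet _ _ _
theorem es_jet (k : ℕ) : IsJet (es k) := tj_jet _ _ _

theorem sqrt2_ne : Real.sqrt 2 ≠ 0 := by positivity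

theorem pi_sq_ne {k l : ℕ} (h : k ≠ l) : ((k:ℝ) * Real.pi)^2 ≠ ((l:ℝ) * Real.pi)^2 := by
  rw [Ne, sq_eq_sq₀ (by positivity) (by positivity), mul_left_inj' Real.pi_ne_zero]
  exact_mod_cast h

theorem famC : Fam ec (fun k => k * Real.pi) 0 where
  jet := ec_jet
  van k := tj_van _ _ _
  eig k j x := tj_eig _ _ _ _ _
  orth k l := by
    split_ifs with h
    · subst h
      by_cases hk : k = 0
      · subst hk; simp [ec_zero]
      · simp only [ec, if_neg hk]
        exact tj_norm k 0 hk
    · exact orth_of (ec_jet k) (ec_jet l) (tj_van _ _ _) (tj_van _ _ _) (fun x => tj_eig _ _ _ _ _)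
        (fun x => tj_eig _ _ _ _ _) (pi_sq_ne h)
  mono k l h := by gcongr
  nonneg k := by positivity
  big k := by
    rcases k with _ | k
    · simp
    · right
      have := Real.pi_gt_three
      push_cast
      nlinarith [Nat.cast_nonneg (α := ℝ) k]
  lower k := by
    have := Real.pi_gt_three
    nlinarith [Nat.cast_nonneg (α := ℝ) k]
  compl g g' hg hg' _ δ hδ := by
    obtain ⟨f, ⟨m, c, hf⟩, hfd⟩ := cosDense hg.cont (δ := min 1 δ) (by positivity)
    set d := fun k : ℕ => c k / (if k = 0 then 1 else Real.sqrt 2) with hd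
    have e : ∀ x, f x = jsum m d ec 0 x := by
      intro x
      rw [hf]
      refine Finset.sum_congr rfl fun k _ => ?_
      rw [ec_zero]
      simp only [hd]
      split_ifs with h
      · simp
      · field_simp
    refine ⟨m, d, ?_⟩
    have hc : Continuous (jsum m d ec 0) := by
      unfold jsum
      exact continuous_finsetSum _ fun k _ => ((ec_jet k).cont 0).const_mul _
    have := sq_small hg.cont hc.continuousOn (fun x hx => by rw [← e]; exact hfd x hx)
    refine this.trans ?_
    have a1 := min_le_left 1 δ
    have a2 := min_le_right 1 δ
    have a3 : 0 < min 1 δ := by positivity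
    nlinarith

theorem famS : Fam es (fun k => (k+1:ℕ) * Real.pi) 1 where
  jet := es_jet
  van k := tj_van _ _ _
  eig k j x := tj_eig _ _ _ _ _
  orth k l := by
    split_ifs with h
    · subst h
      exact tj_norm (k+1) 1 (by omega)
    · exact orth_of (es_jet k) (es_jet l) (tj_van _ _ _) (tj_van _ _ _) (fun x => tj_eig _ _ _ _ _)
        (fun x => tj_eig _ _ _ _ _) (pi_sq_ne (by omega))
  mono k l h := by gcongr
  nonneg k := by positivity
  big k := by
    right
    have := Real.pi_gt_three
    push_cast
    nlinarith [Nat.cast_nonneg (α := ℝ) k]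
  lower k := by
    have := Real.pi_gt_three
    push_cast
    nlinarith [Nat.cast_nonneg (α := ℝ) k]
  compl g g' hg hg' hb δ hδ := by
    have hb : g 0 = 0 ∧ g 1 = 0 := by simpa using hb
    obtain ⟨f, ⟨m, c, hf⟩, hfd⟩ := cosDense hg' (δ := min 1 δ / 2) (by positivity)
    obtain ⟨c, hf⟩ := CosSum.ext_range hf 1
    set d := fun k : ℕ => c (k+1) / (Real.sqrt 2 * ((k+1) * Real.pi)) with hd
    have J : IsJet (jsum m d es) := by
      intro j x
      exact HasDerivAt.fun_sum fun k _ => (es_jet k j x).const_mul (d k)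
    have e : ∀ x, f x = c 0 + jsum m d es 1 x := by
      intro x
      rw [hf, Finset.sum_range_succ', add_comm]
      congr 1
      · simp
      refine Finset.sum_congr rfl fun k _ => ?_
      have : es k 1 x = Real.sqrt 2 * ((k+1) * Real.pi) * Real.cos (((k+1:ℕ):ℝ) * Real.pi * x) := by
        simp only [es, tj, pow_one]
        rw [show ((k+1:ℕ):ℝ) * Real.pi * x + ((1:ℕ):ℝ) * (Real.pi/2) + -(((1:ℕ):ℝ) * (Real.pi/2)) = ((k+1:ℕ):ℝ) * Real.pi * x by ring]
        push_cast; ring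
      rw [this]
      simp only [hd]
      have := sqrt2_ne
      have := Real.pi_ne_zero
      have : (k+1:ℝ) ≠ 0 := by positivity
      field_simp
    set δ' := min 1 δ / 2 with hδ'
    have hH : ∀ x ∈ Icc (0:ℝ) 1, HasDerivWithinAt (fun x => g x - jsum m d es 0 x - c 0 * x)
        (g' x - jsum m d es 1 x - c 0 * 1) (Icc 0 1) x := fun x hx =>
      ((hg x hx).sub (J.d01 0 x hx)).sub ((hasDerivWithinAt_id x _).const_mul (c 0))
    have hz : jsum m d es 0 0 = 0 ∧ jsum m d es 0 1 = 0 := by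
      constructor
      · exact Finset.sum_eq_zero fun k _ => by rw [show es k 0 0 = 0 from (tj_van _ _ _ 0 (by decide)).1, mul_zero]
      · exact Finset.sum_eq_zero fun k _ => by rw [show es k 0 1 = 0 from (tj_van _ _ _ 0 (by decide)).2, mul_zero]
    have hbd : ∀ x ∈ Icc (0:ℝ) 1, |g x - jsum m d es 0 x - c 0 * x| ≤ δ' := by
      intro x hx
      have := (convex_Icc (0:ℝ) 1).norm_image_sub_le_of_norm_hasDerivWithin_le (C := δ') hH
        (fun y hy => by
          have := hfd y hy
          rw [e] at this
          rw [Real.norm_eq_abs]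
          convert this using 2; ring) (x := 0) (y := x) (by simp) hx
      rw [hz.1, hb.1] at this
      simp only [Real.norm_eq_abs, mul_zero, sub_zero] at this
      rw [abs_of_nonneg hx.1] at this
      have hδ0 : 0 ≤ δ' := by positivity
      nlinarith [hx.2]
    have h1 := hbd 1 (by simp)
    rw [hz.2, hb.2] at h1
    have hc0 : |c 0| ≤ δ' := by simpa using h1
    refine ⟨m, d, ?_⟩
    have hfin : ∀ x ∈ Icc (0:ℝ) 1, |g x - jsum m d es 0 x| ≤ min 1 δ := by
      intro x hx
      have h2 := abs_le.1 (hbd x hx)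
      have h3 := abs_le.1 hc0
      have e5 : min 1 δ = 2 * δ' := by rw [hδ']; ring
      rw [e5, abs_le]
      constructor <;> nlinarith [hx.1, hx.2]
    refine (sq_small hg.cont (J.cont 0).continuousOn hfin).trans ?_
    have a1 := min_le_left 1 δ
    have a2 := min_le_right 1 δ
    have a3 : 0 < min 1 δ := by positivity
    nlinarith

theorem globalODE {E : Type} [NormedAddCommGroup E] [InnerProductSpace ℝ E] [FiniteDimensional ℝ E]
    (V : E → E) (hV : ContDiff ℝ 1 V) (h0 : ∀ x, inner ℝ x (V x) = 0) (x0 : E) {S : ℝ} (hS : 0 ≤ S) :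
    ∃ y : ℝ → E, y 0 = x0 ∧ ∀ s ∈ Icc 0 S, HasDerivWithinAt y (V (y s)) (Icc 0 S) s := by
  have : CompleteSpace E := FiniteDimensional.complete ℝ E
  let χ : ContDiffBump (0:E) := ⟨‖x0‖ + 1, ‖x0‖ + 2, by positivity, by linarith⟩
  set G : E → E := fun x => χ x • V x with hG
  have hGs : HasCompactSupport G := χ.hasCompactSupport.smul_right
  have hGd : ContDiff ℝ 1 G := (χ.contDiff).smul hV
  obtain ⟨K, hK⟩ := ContDiff.lipschitzWith_of_hasCompactSupport hGs hGd (by norm_num)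
  obtain ⟨L, hL⟩ := hGs.exists_bound_of_continuous hGd.continuous
  have hL0 : 0 ≤ L := (norm_nonneg _).trans (hL 0)
  have pl : IsPicardLindelof (fun _ => G) (tmin := 0) (tmax := S) ⟨0, le_rfl, hS⟩ x0
      ⟨L * S, by positivity⟩ 0 ⟨L, hL0⟩ K :=
    { lipschitzOnWith := fun t _ => hK.lipschitzOnWith
      continuousOn := fun x _ => continuousOn_const
      norm_le := fun t _ x _ => hL x
      mul_max_le := by simp only [sub_zero, sub_self, max_eq_left hS, NNReal.coe_zero]; exact le_rfl }
  obtain ⟨y, hy0, hy⟩ := pl.exists_eq_forall_mem_Icc_hasDerivWithinAt₀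
  have hn : ∀ s ∈ Icc 0 S, ‖y s‖ ^ 2 = ‖x0‖^2 := by
    intro s hs
    have hd : ∀ s ∈ Icc 0 S, HasDerivWithinAt (fun s => ‖y s‖^2) 0 (Icc 0 S) s := by
      intro s hs
      have := (hy s hs).norm_sq
      have z : inner ℝ (y s) (G (y s)) = 0 := by simp [hG, inner_smul_right, h0]
      rw [z, mul_zero] at this
      exact this
    have := (convex_Icc 0 S).norm_image_sub_le_of_norm_hasDerivWithin_le (C := 0) hd (by simp)
      (x := 0) (y := s) ⟨le_rfl, hS⟩ hs
    have h2 : ‖y s‖^2 - ‖y 0‖^2 = 0 := by simpa using this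
    have hy0' : y 0 = x0 := hy0
    rw [hy0'] at h2; linarith
  refine ⟨y, hy0, fun s hs => ?_⟩
  have := hy s hs
  have z : χ (y s) = 1 := by
    apply χ.one_of_mem_closedBall
    have h1 : ‖y s‖ = ‖x0‖ := by
      have := hn s hs
      rwa [sq_eq_sq₀ (norm_nonneg _) (norm_nonneg _)] at this
    simp only [Metric.mem_closedBall, dist_zero_right]
    rw [h1]; simp [χ]
  simpa [hG, z] using this

/-- first flux, differentiated once -/
def f1 (P Q : ℕ → ℝ → ℝ) (x : ℝ) : ℝ := Q 1 x + (1/2) * (P 1 x * Q 0 x + P 0 x * Q 1 x)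
/-- second flux, differentiated once -/
def f2 (P Q : ℕ → ℝ → ℝ) (x : ℝ) : ℝ := P 1 x + (3/2) * (Q 0 x * Q 1 x) + (1/2) * (P 0 x * P 1 x)

theorem f1_cont {P Q : ℕ → ℝ → ℝ} (hP : IsJet P) (hQ : IsJet Q) : Continuous (f1 P Q) := by
  have := hP.cont 0; have := hP.cont 1; have := hQ.cont 0; have := hQ.cont 1
  unfold f1; fun_prop

theorem f2_cont {P Q : ℕ → ℝ → ℝ} (hP : IsJet P) (hQ : IsJet Q) : Continuous (f2 P Q) := by
  have := hP.cont 0; have := hP.cont 1; have := hQ.cont 0; have := hQ.cont 1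
  unfold f2; fun_prop

theorem f_cons {P Q : ℕ → ℝ → ℝ} (hP : IsJet P) (hQ : IsJet Q) (vQ : Van 1 Q) :
    ∫ x in (0:ℝ)..1, (f1 P Q x * P 0 x + f2 P Q x * Q 0 x) = 0 := by
  have c1 := hP.cont 0; have c2 := hP.cont 1; have c3 := hQ.cont 0; have c4 := hQ.cont 1
  have hd : D01 (fun x => P 0 x * Q 0 x + (1/2) * (P 0 x * P 0 x * Q 0 x) + (1/2) * (Q 0 x * Q 0 x * Q 0 x))
      (fun x => f1 P Q x * P 0 x + f2 P Q x * Q 0 x) := by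
    intro x hx
    have a := hP.d01 0 x hx
    have b := hQ.d01 0 x hx
    have t := ((a.mul b).add (((a.mul a).mul b).const_mul (1/2))).add (((b.mul b).mul b).const_mul (1/2))
    exact t.congr_deriv (by simp only [f1, f2, Pi.mul_apply, zero_add]; ring)
  rw [hd.ftc (by have := f1_cont hP hQ; have := f2_cont hP hQ; fun_prop)]
  have v := vQ 0 (by decide)
  simp [v.1, v.2]

/-- a bounded linear functional version of the integral against a continuous weight -/
theorem quadPoly (n : ℕ) (w : ℝ → ℝ) (hw : Continuous w) {𝓔 𝓖 : ℕ → ℕ → ℝ → ℝ}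
    (h1 : ∀ k, IsJet (𝓔 k)) (h2 : ∀ k, IsJet (𝓖 k)) (i j : ℕ)
    {X : Type} [NormedAddCommGroup X] [NormedSpace ℝ X] {a b : EuclideanSpace ℝ (Fin n ⊕ Fin n) → ℕ → ℝ}
    (ha : ∀ k, ContDiff ℝ 1 (fun x => a x k)) (hb : ∀ k, ContDiff ℝ 1 (fun x => b x k)) :
    ContDiff ℝ 1 (fun x => ∫ y in (0:ℝ)..1, jsum n (a x) 𝓔 i y * jsum n (b x) 𝓖 j y * w y) := by
  have e : ∀ x, (∫ y in (0:ℝ)..1, jsum n (a x) 𝓔 i y * jsum n (b x) 𝓖 j y * w y)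
      = ∑ k ∈ Finset.range n, ∑ l ∈ Finset.range n, a x k * b x l *
        ∫ y in (0:ℝ)..1, 𝓔 k i y * 𝓖 l j y * w y := by
    intro x
    have e2 : ∀ y, jsum n (a x) 𝓔 i y * jsum n (b x) 𝓖 j y * w y
      = ∑ k ∈ Finset.range n, ∑ l ∈ Finset.range n, a x k * b x l * (𝓔 k i y * 𝓖 l j y * w y) := by
      intro y
      simp only [jsum]
      rw [Finset.sum_mul_sum, Finset.sum_mul]
      simp only [Finset.sum_mul]
      exact Finset.sum_congr rfl fun k _ => Finset.sum_congr rfl fun l _ => by ring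
    simp only [e2]
    have hc : ∀ k l, Continuous (fun y => a x k * b x l * (𝓔 k i y * 𝓖 l j y * w y)) := by
      intro k l
      have := (h1 k).cont i; have := (h2 l).cont j
      fun_prop
    rw [intervalIntegral.integral_finsetSum fun k _ => (continuous_finsetSum _ fun l _ => hc k l).intervalIntegrable _ _]
    refine Finset.sum_congr rfl fun k _ => ?_
    rw [intervalIntegral.integral_finsetSum fun l _ => (hc k l).intervalIntegrable _ _]
    exact Finset.sum_congr rfl fun l _ => intervalIntegral.integral_const_mul _ _
  simp only [e]
  refine ContDiff.sum fun k _ => ContDiff.sum fun l _ => ?_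
  exact ((ha k).mul (hb l)).mul contDiff_const

theorem linPoly (n : ℕ) (w : ℝ → ℝ) (hw : Continuous w) {𝓔 : ℕ → ℕ → ℝ → ℝ}
    (h1 : ∀ k, IsJet (𝓔 k)) (i : ℕ)
    {X : Type} [NormedAddCommGroup X] [NormedSpace ℝ X] {a : EuclideanSpace ℝ (Fin n ⊕ Fin n) → ℕ → ℝ}
    (ha : ∀ k, ContDiff ℝ 1 (fun x => a x k)) :
    ContDiff ℝ 1 (fun x => ∫ y in (0:ℝ)..1, jsum n (a x) 𝓔 i y * w y) := by
  have e : ∀ x, (∫ y in (0:ℝ)..1, jsum n (a x) 𝓔 i y * w y)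
      = ∑ k ∈ Finset.range n, a x k * ∫ y in (0:ℝ)..1, 𝓔 k i y * w y := by
    intro x
    have e2 : ∀ y, jsum n (a x) 𝓔 i y * w y
      = ∑ k ∈ Finset.range n, a x k * (𝓔 k i y * w y) := by
      intro y
      simp only [jsum, Finset.sum_mul]
      exact Finset.sum_congr rfl fun k _ => by ring
    simp only [e2]
    have hc : ∀ k, Continuous (fun y => a x k * (𝓔 k i y * w y)) := by
      intro k
      have := (h1 k).cont i
      fun_prop
    rw [intervalIntegral.integral_finsetSum fun k _ => (hc k).intervalIntegrable _ _]
    exact Finset.sum_congr rfl fun l _ => intervalIntegral.integral_const_mul _ _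
  simp only [e]
  exact ContDiff.sum fun k _ => (ha k).mul contDiff_const

/-- existence for the spectral Galerkin ODE -/
theorem galODE (n : ℕ) (σ : ℝ) (a0 b0 : ℕ → ℝ) {S : ℝ} (hS : 0 ≤ S) :
    ∃ a b : ℝ → ℕ → ℝ, (∀ k < n, a 0 k = a0 k ∧ b 0 k = b0 k) ∧
      ∀ s ∈ Icc 0 S, ∀ k < n,
        HasDerivWithinAt (fun s => a s k)
          (-σ * ∫ x in (0:ℝ)..1, f1 (jsum n (a s) ec) (jsum n (b s) es) x * ec k 0 x) (Icc 0 S) s ∧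
        HasDerivWithinAt (fun s => b s k)
          (-σ * ∫ x in (0:ℝ)..1, f2 (jsum n (a s) ec) (jsum n (b s) es) x * es k 0 x) (Icc 0 S) s := by
  let A : EuclideanSpace ℝ (Fin n ⊕ Fin n) → ℕ → ℝ := fun x k => if h : k < n then x (Sum.inl ⟨k, h⟩) else 0
  let B : EuclideanSpace ℝ (Fin n ⊕ Fin n) → ℕ → ℝ := fun x k => if h : k < n then x (Sum.inr ⟨k, h⟩) else 0
  let U : EuclideanSpace ℝ (Fin n ⊕ Fin n) → ℕ → ℝ := fun x k => -σ * ∫ y in (0:ℝ)..1, f1 (jsum n (A x) ec) (jsum n (B x) es) y * ec k 0 y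
  let W : EuclideanSpace ℝ (Fin n ⊕ Fin n) → ℕ → ℝ := fun x k => -σ * ∫ y in (0:ℝ)..1, f2 (jsum n (A x) ec) (jsum n (B x) es) y * es k 0 y
  have hA : ∀ k, ContDiff ℝ 1 (fun x => A x k) := by
    intro k
    by_cases h : k < n
    · simp only [A, dif_pos h]; fun_prop
    · simp only [A, dif_neg h]; fun_prop
  have hB : ∀ k, ContDiff ℝ 1 (fun x => B x k) := by
    intro k
    by_cases h : k < n
    · simp only [B, dif_pos h]; fun_prop
    · simp only [B, dif_neg h]; fun_prop
  have JA : ∀ x, IsJet (jsum n (A x) ec) := fun x => famC.jetS n (A x)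
  have JB : ∀ x, IsJet (jsum n (B x) es) := fun x => famS.jetS n (B x)
  have hU : ∀ k, ContDiff ℝ 1 (fun x => U x k) := by
    intro k
    have hw := (ec_jet k).cont 0
    have e : ∀ x, U x k = -σ * ((∫ y in (0:ℝ)..1, jsum n (B x) es 1 y * ec k 0 y)
        + (1/2) * ((∫ y in (0:ℝ)..1, jsum n (A x) ec 1 y * jsum n (B x) es 0 y * ec k 0 y)
        + ∫ y in (0:ℝ)..1, jsum n (A x) ec 0 y * jsum n (B x) es 1 y * ec k 0 y)) := by
      intro x
      have c1 := (JA x).cont 0; have c2 := (JA x).cont 1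
      have c3 := (JB x).cont 0; have c4 := (JB x).cont 1
      rw [← intervalIntegral.integral_add ((by fun_prop : Continuous _).intervalIntegrable _ _)
        ((by fun_prop : Continuous _).intervalIntegrable _ _), ← intervalIntegral.integral_const_mul,
        ← intervalIntegral.integral_add ((by fun_prop : Continuous _).intervalIntegrable _ _)
        ((by fun_prop : Continuous _).intervalIntegrable _ _)]
      simp only [U, f1]
      congr 2
      ext y; ring
    simp only [e]
    have q1 := linPoly n _ hw es_jet 1 (X := EuclideanSpace ℝ (Fin n ⊕ Fin n)) (a := B) hB
    have q2 := quadPoly n _ hw ec_jet es_jet 1 0 (X := EuclideanSpace ℝ (Fin n ⊕ Fin n)) (a := A) (b := B) hA hB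
    have q3 := quadPoly n _ hw ec_jet es_jet 0 1 (X := EuclideanSpace ℝ (Fin n ⊕ Fin n)) (a := A) (b := B) hA hB
    exact contDiff_const.mul (q1.add (contDiff_const.mul (q2.add q3)))
  have hW : ∀ k, ContDiff ℝ 1 (fun x => W x k) := by
    intro k
    have hw := (es_jet k).cont 0
    have e : ∀ x, W x k = -σ * ((∫ y in (0:ℝ)..1, jsum n (A x) ec 1 y * es k 0 y)
        + ((3/2) * (∫ y in (0:ℝ)..1, jsum n (B x) es 0 y * jsum n (B x) es 1 y * es k 0 y)
        + (1/2) * ∫ y in (0:ℝ)..1, jsum n (A x) ec 0 y * jsum n (A x) ec 1 y * es k 0 y)) := by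
      intro x
      have c1 := (JA x).cont 0; have c2 := (JA x).cont 1
      have c3 := (JB x).cont 0; have c4 := (JB x).cont 1
      rw [← intervalIntegral.integral_const_mul, ← intervalIntegral.integral_const_mul,
        ← intervalIntegral.integral_add ((by fun_prop : Continuous _).intervalIntegrable _ _)
        ((by fun_prop : Continuous _).intervalIntegrable _ _),
        ← intervalIntegral.integral_add ((by fun_prop : Continuous _).intervalIntegrable _ _)
        ((by fun_prop : Continuous _).intervalIntegrable _ _)]
      simp only [W, f2]
      congr 2
      ext y; ring
    simp only [e]
    refine contDiff_const.mul ((linPoly n _ hw ec_jet 1 (X := EuclideanSpace ℝ (Fin n ⊕ Fin n)) (a := A) hA).add ((contDiff_const.mul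
      (quadPoly n _ hw es_jet es_jet 0 1 (X := EuclideanSpace ℝ (Fin n ⊕ Fin n)) (a := B) (b := B) hB hB)).add (contDiff_const.mul (quadPoly n _ hw ec_jet ec_jet 0 1 (X := EuclideanSpace ℝ (Fin n ⊕ Fin n)) (a := A) (b := A) hA hA))))
  let V : EuclideanSpace ℝ (Fin n ⊕ Fin n) → EuclideanSpace ℝ (Fin n ⊕ Fin n) := fun x => WithLp.toLp 2 (Sum.elim (fun k : Fin n => U x k) (fun k : Fin n => W x k))
  have hV : ContDiff ℝ 1 V := by
    rw [contDiff_euclidean]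
    rintro (k | k)
    · exact hU k
    · exact hW k
  have hin : ∀ x, inner ℝ x (V x) = 0 := by
    intro x
    have e1 : inner ℝ x (V x) = (∑ k ∈ Finset.range n, A x k * U x k) + ∑ k ∈ Finset.range n, B x k * W x k := by
      rw [PiLp.inner_apply, Fintype.sum_sum_type, Finset.sum_range, Finset.sum_range]
      congr 1
      · refine Finset.sum_congr rfl fun k _ => ?_
        simp [V, A, mul_comm]
      · refine Finset.sum_congr rfl fun k _ => ?_
        simp [V, B, mul_comm]
    have cf1 := f1_cont (JA x) (JB x)
    have cf2 := f2_cont (JA x) (JB x)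
    have c1 := (JA x).cont 0
    have c3 := (JB x).cont 0
    have e2 := famC.pair n (A x) cf1.continuousOn
    have e3 := famS.pair n (B x) cf2.continuousOn
    have e4 := f_cons (JA x) (JB x) (famS.vanS n (B x))
    rw [intervalIntegral.integral_add ((by fun_prop : Continuous _).intervalIntegrable _ _)
        ((by fun_prop : Continuous _).intervalIntegrable _ _), e2, e3] at e4
    have e5 : (∑ k ∈ Finset.range n, A x k * U x k) = -σ * ∑ k ∈ Finset.range n, A x k * ∫ y in (0:ℝ)..1, f1 (jsum n (A x) ec) (jsum n (B x) es) y * ec k 0 y := by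
      rw [Finset.mul_sum]; exact Finset.sum_congr rfl fun k _ => by simp only [U]; ring
    have e6 : (∑ k ∈ Finset.range n, B x k * W x k) = -σ * ∑ k ∈ Finset.range n, B x k * ∫ y in (0:ℝ)..1, f2 (jsum n (A x) ec) (jsum n (B x) es) y * es k 0 y := by
      rw [Finset.mul_sum]; exact Finset.sum_congr rfl fun k _ => by simp only [W]; ring
    rw [e1, e5, e6, ← mul_add, e4, mul_zero]
  obtain ⟨y, hy0, hy⟩ := globalODE V hV hin
    (WithLp.toLp 2 (Sum.elim (fun k : Fin n => a0 k) (fun k : Fin n => b0 k))) hS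
  refine ⟨fun s => A (y s), fun s => B (y s), ?_, ?_⟩
  · intro k hk
    simp [A, B, hk, hy0]
  · intro s hs k hk
    have h : ∀ i, HasDerivWithinAt (fun s => y s i) (V (y s) i) (Icc 0 S) s := fun i =>
      (EuclideanSpace.proj (𝕜 := ℝ) i).hasFDerivAt.comp_hasDerivWithinAt s (hy s hs)
    constructor
    · have := h (Sum.inl ⟨k, hk⟩)
      simp only [A, dif_pos hk]
      exact this
    · have := h (Sum.inr ⟨k, hk⟩)
      simp only [B, dif_pos hk]
      exact this

/-- Leibniz product of jets -/
def jmul (P Q : ℕ → ℝ → ℝ) : ℕ → ℝ → ℝ :=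
  fun k x => ∑ ij ∈ Finset.HasAntidiagonal.antidiagonal k, (k.choose ij.1 : ℝ) * (P ij.1 x * Q ij.2 x)

theorem IsJet.jmul {P Q : ℕ → ℝ → ℝ} (hP : IsJet P) (hQ : IsJet Q) : IsJet (jmul P Q) := by
  intro k x
  have h : HasDerivAt (_root_.jmul P Q k) (∑ ij ∈ Finset.HasAntidiagonal.antidiagonal k, (k.choose ij.1 : ℝ) *
      (P (ij.1+1) x * Q ij.2 x + P ij.1 x * Q (ij.2+1) x)) x :=
    HasDerivAt.fun_sum fun ij _ => ((hP ij.1 x).mul (hQ ij.2 x)).const_mul _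
  refine h.congr_deriv ?_
  have h2 := Finset.sum_antidiagonal_choose_succ_mul (fun i j => P i x * Q j x) k
  simp only [_root_.jmul]
  rw [h2, ← Finset.sum_add_distrib]
  refine Finset.sum_congr rfl fun ij hij => ?_
  have : k.choose ij.2 = k.choose ij.1 := by
    rw [← Finset.HasAntidiagonal.mem_antidiagonal.1 hij, Nat.choose_symm_add]
  rw [this]; ring

theorem Van.jmul {P Q : ℕ → ℝ → ℝ} {e e' : ℕ} (hP : Van e P) (hQ : Van e' Q) : Van (e+e') (jmul P Q) := by
  intro k hk
  have key : ∀ ij ∈ Finset.HasAntidiagonal.antidiagonal k, Odd (ij.1 + e) ∨ Odd (ij.2 + e') := by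
    intro ij hij
    have := Finset.HasAntidiagonal.mem_antidiagonal.1 hij
    by_contra hc
    push Not at hc
    rw [Nat.not_odd_iff_even, Nat.not_odd_iff_even] at hc
    have h2 := hc.1.add hc.2
    rw [show ij.1 + e + (ij.2 + e') = k + (e+e') by omega, ← Nat.not_odd_iff_even] at h2
    exact h2 hk
  constructor
  · refine Finset.sum_eq_zero fun ij hij => ?_
    rcases key ij hij with h | h
    · rw [(hP _ h).1]; ring
    · rw [(hQ _ h).1]; ring
  · refine Finset.sum_eq_zero fun ij hij => ?_
    rcases key ij hij with h | h
    · rw [(hP _ h).2]; ring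
    · rw [(hQ _ h).2]; ring

def FJ1 (P Q : ℕ → ℝ → ℝ) : ℕ → ℝ → ℝ := fun k x => Q k x + (1/2) * jmul P Q k x
def FJ2 (P Q : ℕ → ℝ → ℝ) : ℕ → ℝ → ℝ := fun k x => P k x + ((3/4) * jmul Q Q k x + (1/4) * jmul P P k x)

theorem jetF1 {P Q : ℕ → ℝ → ℝ} (hP : IsJet P) (hQ : IsJet Q) : IsJet (FJ1 P Q) :=
  fun k x => (hQ k x).add ((hP.jmul hQ k x).const_mul _)

theorem jetF2 {P Q : ℕ → ℝ → ℝ} (hP : IsJet P) (hQ : IsJet Q) : IsJet (FJ2 P Q) :=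
  fun k x => (hP k x).add (((hQ.jmul hQ k x).const_mul _).add ((hP.jmul hP k x).const_mul _))

theorem vanF1 {P Q : ℕ → ℝ → ℝ} (hP : Van 0 P) (hQ : Van 1 Q) : Van 1 (FJ1 P Q) := by
  intro k hk
  have h1 := hQ k hk
  have h2 := hP.jmul hQ k hk
  simp [FJ1, h1.1, h1.2, h2.1, h2.2]

theorem vanF2 {P Q : ℕ → ℝ → ℝ} (hP : Van 0 P) (hQ : Van 1 Q) : Van 0 (FJ2 P Q) := by
  intro k hk
  have h1 := hP k hk
  have h2 := hP.jmul hP k hk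
  have h3 := hQ.jmul hQ k (by
    rw [show k + (1+1) = k + 0 + 2 by ring]
    exact hk.add_even even_two)
  simp [FJ2, h1.1, h1.2, h2.1, h2.2, h3.1, h3.2]

theorem FJ1_one (P Q : ℕ → ℝ → ℝ) : FJ1 P Q 1 = f1 P Q := by
  ext x
  simp [FJ1, f1, jmul, Finset.Nat.antidiagonal_succ]
  ring

theorem FJ2_one (P Q : ℕ → ℝ → ℝ) : FJ2 P Q 1 = f2 P Q := by
  ext x
  simp [FJ2, f2, jmul, Finset.Nat.antidiagonal_succ]
  ring

theorem jmul0 (P Q : ℕ → ℝ → ℝ) (x : ℝ) : jmul P Q 0 x = P 0 x * Q 0 x := by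
  simp [jmul]
theorem jmul2 (P Q : ℕ → ℝ → ℝ) (x : ℝ) : jmul P Q 2 x = P 0 x * Q 2 x + 2 * (P 1 x * Q 1 x) + P 2 x * Q 0 x := by
  simp [jmul, Finset.Nat.antidiagonal_succ]
  ring
theorem jmul3 (P Q : ℕ → ℝ → ℝ) (x : ℝ) : jmul P Q 3 x = P 0 x * Q 3 x + 3 * (P 1 x * Q 2 x)
    + 3 * (P 2 x * Q 1 x) + P 3 x * Q 0 x := by
  simp [jmul, Finset.Nat.antidiagonal_succ, Nat.choose]
  ring
theorem jmul4 (P Q : ℕ → ℝ → ℝ) (x : ℝ) : jmul P Q 4 x = P 0 x * Q 4 x + 4 * (P 1 x * Q 3 x)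
    + 6 * (P 2 x * Q 2 x) + 4 * (P 3 x * Q 1 x) + P 4 x * Q 0 x := by
  simp [jmul, Finset.Nat.antidiagonal_succ, Nat.choose]
  ring
theorem jmul5 (P Q : ℕ → ℝ → ℝ) (x : ℝ) : jmul P Q 5 x = P 0 x * Q 5 x + 5 * (P 1 x * Q 4 x)
    + 10 * (P 2 x * Q 3 x) + 10 * (P 3 x * Q 2 x) + 5 * (P 4 x * Q 1 x) + P 5 x * Q 0 x := by
  simp [jmul, Finset.Nat.antidiagonal_succ, Nat.choose]
  ring

theorem abs_int_le {T B : ℝ → ℝ} (cT : ContinuousOn T (Icc 0 1)) (cB : ContinuousOn B (Icc 0 1))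
    (h : ∀ x ∈ Icc (0:ℝ) 1, |T x| ≤ B x) : |∫ x in (0:ℝ)..1, T x| ≤ ∫ x in (0:ℝ)..1, B x := by
  rw [abs_le]
  constructor
  · rw [← intervalIntegral.integral_neg]
    exact int01_mono (by fun_prop) cT fun x hx => (abs_le.1 (h x hx)).1
  · exact int01_mono cT cB fun x hx => (abs_le.1 (h x hx)).2

theorem intTot {D T R B : ℝ → ℝ} (hD : D01 D (fun x => T x - R x)) (cT : Continuous T)
    (cR : Continuous R) (cB : Continuous B) (h0 : D 0 = 0) (h1 : D 1 = 0)
    (h : ∀ x ∈ Icc (0:ℝ) 1, |R x| ≤ B x) : |∫ x in (0:ℝ)..1, T x| ≤ ∫ x in (0:ℝ)..1, B x := by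
  have a := hD.ftc (by fun_prop)
  rw [intervalIntegral.integral_sub (cT.intervalIntegrable _ _) (cR.intervalIntegrable _ _), h0, h1] at a
  rw [show (∫ x in (0:ℝ)..1, T x) = ∫ x in (0:ℝ)..1, R x by linarith]
  exact abs_int_le cR.continuousOn cB.continuousOn h

def Lead (P Q : ℕ → ℝ → ℝ) (j : ℕ) (x : ℝ) : ℝ := P j x * Q j x + (1/2) * (P 0 x * (P j x * Q j x))
  + (1/4) * (Q 0 x * (P j x * P j x)) + (3/4) * (Q 0 x * (Q j x * Q j x))

theorem leadD {P Q : ℕ → ℝ → ℝ} (hP : IsJet P) (hQ : IsJet Q) (j : ℕ) :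
    D01 (Lead P Q j) (fun x => Q (j+1) x * P j x + P (j+1) x * Q j x + (1/2) * (P 1 x * P j x * Q j x)
      + (1/2) * (P 0 x * (P (j+1) x * Q j x + P j x * Q (j+1) x)) + (1/4) * (Q 1 x * P j x * P j x)
      + (1/2) * (Q 0 x * P j x * P (j+1) x) + (3/4) * (Q 1 x * Q j x * Q j x)
      + (3/2) * (Q 0 x * Q j x * Q (j+1) x)) := by
  intro x hx
  have a := hP.d01 j x hx
  have b := hQ.d01 j x hx
  have a0 := hP.d01 0 x hx
  have b0 := hQ.d01 0 x hx
  have t := (((a.mul b).add ((a0.mul (a.mul b)).const_mul (1/2))).add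
    ((b0.mul (a.mul a)).const_mul (1/4))).add ((b0.mul (b.mul b)).const_mul (3/4))
  exact t.congr_deriv (by simp only [Pi.mul_apply, zero_add]; ring)

theorem lead_zero {P Q : ℕ → ℝ → ℝ} (vP : Van 0 P) (vQ : Van 1 Q) (j : ℕ) :
    Lead P Q j 0 = 0 ∧ Lead P Q j 1 = 0 := by
  have v := vQ 0 (by decide)
  have : P j 0 * Q j 0 = 0 ∧ P j 1 * Q j 1 = 0 := by
    rcases Nat.even_or_odd j with h | h
    · have := vQ j h.add_one; simp [this.1, this.2]
    · have := vP j h; simp [this.1, this.2]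
  simp [Lead, v.1, v.2, this.1, this.2]

theorem ab_le {a M : ℝ} (h : |a| ≤ M) (b c : ℝ) : |a * b * c| ≤ M * ((b^2 + c^2)/2) := by
  rw [mul_assoc, abs_mul]
  apply mul_le_mul h _ (abs_nonneg _) ((abs_nonneg _).trans h)
  rw [abs_le]
  constructor <;> nlinarith [sq_nonneg (b+c), sq_nonneg (b-c)]

/-- the energy flux of order `j` -/
def EF (P Q : ℕ → ℝ → ℝ) (j : ℕ) (x : ℝ) : ℝ := FJ1 P Q (j+1) x * P j x + FJ2 P Q (j+1) x * Q j x

theorem EF_cont {P Q : ℕ → ℝ → ℝ} (hP : IsJet P) (hQ : IsJet Q) (j : ℕ) : Continuous (EF P Q j) := by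
  have := (jetF1 hP hQ).cont (j+1); have := (jetF2 hP hQ).cont (j+1)
  have := hP.cont j; have := hQ.cont j
  unfold EF; fun_prop

theorem en2 {P Q : ℕ → ℝ → ℝ} (hP : IsJet P) (hQ : IsJet Q) (vP : Van 0 P) (vQ : Van 1 Q) {M : ℝ}
    (hM : ∀ x ∈ Icc (0:ℝ) 1, |P 1 x| ≤ M ∧ |Q 1 x| ≤ M) :
    |∫ x in (0:ℝ)..1, EF P Q 2 x| ≤ ∫ x in (0:ℝ)..1, 10 * M * (P 2 x ^2 + Q 2 x ^2) := by
  have c0 := hP.cont 0; have c1 := hP.cont 1; have c2 := hP.cont 2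
  have d0 := hQ.cont 0; have d1 := hQ.cont 1; have d2 := hQ.cont 2
  refine intTot (D := Lead P Q 2) (R := fun x => -((1/2) * (P 1 x * P 2 x * Q 2 x) + (1/4) * (Q 1 x * P 2 x * P 2 x)
      + (3/4) * (Q 1 x * Q 2 x * Q 2 x)) + (3/2) * (Q 1 x * P 2 x * P 2 x) + (3/2) * (P 1 x * P 2 x * Q 2 x)
      + (9/2) * (Q 1 x * Q 2 x * Q 2 x) + (3/2) * (P 1 x * P 2 x * Q 2 x)) ?_ (EF_cont hP hQ 2) (by fun_prop)
    (by fun_prop) (lead_zero vP vQ 2).1 (lead_zero vP vQ 2).2 ?_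
  · intro x hx
    refine (leadD hP hQ 2 x hx).congr_deriv ?_
    simp only [EF, FJ1, FJ2, jmul3, Nat.reduceAdd]; ring
  · intro x hx
    have a := (hM x hx).1
    have b := (hM x hx).2
    have h1 := abs_le.1 (ab_le a (P 2 x) (Q 2 x))
    have h2 := abs_le.1 (ab_le b (P 2 x) (P 2 x))
    have h3 := abs_le.1 (ab_le b (Q 2 x) (Q 2 x))
    have hM0 : 0 ≤ M := (abs_nonneg _).trans a
    have p1 : 0 ≤ M * P 2 x ^ 2 := by positivity
    have p2 : 0 ≤ M * Q 2 x ^ 2 := by positivity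
    rw [abs_le]
    constructor <;> nlinarith

theorem en3 {P Q : ℕ → ℝ → ℝ} (hP : IsJet P) (hQ : IsJet Q) (vP : Van 0 P) (vQ : Van 1 Q) {M Z : ℝ}
    (hM : ∀ x ∈ Icc (0:ℝ) 1, |P 1 x| ≤ M ∧ |Q 1 x| ≤ M)
    (hZ : ∀ x ∈ Icc (0:ℝ) 1, P 2 x ^2 ≤ Z ∧ Q 2 x ^ 2 ≤ Z) :
    |∫ x in (0:ℝ)..1, EF P Q 3 x| ≤ ∫ x in (0:ℝ)..1, (20 * (M+1) * (P 3 x ^2 + Q 3 x ^2)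
      + 10 * Z * (P 2 x ^ 2 + Q 2 x ^ 2)) := by
  have c0 := hP.cont 0; have c1 := hP.cont 1; have c2 := hP.cont 2; have c3 := hP.cont 3
  have d0 := hQ.cont 0; have d1 := hQ.cont 1; have d2 := hQ.cont 2; have d3 := hQ.cont 3
  refine intTot (D := Lead P Q 3) (R := fun x => -((1/2) * (P 1 x * P 3 x * Q 3 x) + (1/4) * (Q 1 x * P 3 x * P 3 x)
      + (3/4) * (Q 1 x * Q 3 x * Q 3 x)) + 2 * (P 1 x * P 3 x * Q 3 x) + 3 * (P 2 x * Q 2 x * P 3 x) + 2 * (Q 1 x * P 3 x * P 3 x)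
      + 6 * (Q 1 x * Q 3 x * Q 3 x) + (9/2) * (Q 2 x * Q 2 x * Q 3 x)
      + 2 * (P 1 x * P 3 x * Q 3 x) + (3/2) * (P 2 x * P 2 x * Q 3 x)) ?_ (EF_cont hP hQ 3) (by fun_prop)
    (by fun_prop) (lead_zero vP vQ 3).1 (lead_zero vP vQ 3).2 ?_
  · intro x hx
    refine (leadD hP hQ 3 x hx).congr_deriv ?_
    simp only [EF, FJ1, FJ2, jmul4, Nat.reduceAdd]; ring
  · intro x hx
    have a := (hM x hx).1
    have b := (hM x hx).2
    have h1 := abs_le.1 (ab_le a (P 3 x) (Q 3 x))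
    have h2 := abs_le.1 (ab_le b (P 3 x) (P 3 x))
    have h3 := abs_le.1 (ab_le b (Q 3 x) (Q 3 x))
    have y : ∀ s t r : ℝ, s^2 ≤ Z → |s * t * r| ≤ (Z * t^2 + r^2)/2 := by
      intro s t r hs
      have := mul_le_mul_of_nonneg_right hs (sq_nonneg t)
      rw [abs_le]
      constructor <;> nlinarith [sq_nonneg (s*t+r), sq_nonneg (s*t-r)]
    have h4 := abs_le.1 (y (P 2 x) (Q 2 x) (P 3 x) (hZ x hx).1)
    have h5 := abs_le.1 (y (Q 2 x) (Q 2 x) (Q 3 x) (hZ x hx).2)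
    have h6 := abs_le.1 (y (P 2 x) (P 2 x) (Q 3 x) (hZ x hx).1)
    have hM0 : 0 ≤ M := (abs_nonneg _).trans a
    have hZ0 : 0 ≤ Z := (sq_nonneg _).trans (hZ x hx).1
    have p1 : 0 ≤ M * P 3 x ^ 2 := by positivity
    have p2 : 0 ≤ M * Q 3 x ^ 2 := by positivity
    have p3 : 0 ≤ Z * P 2 x ^ 2 := by positivity
    have p4 : 0 ≤ Z * Q 2 x ^ 2 := by positivity
    have p5 := sq_nonneg (P 3 x)
    have p6 := sq_nonneg (Q 3 x)
    rw [abs_le]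
    constructor <;> nlinarith

theorem en4 {P Q : ℕ → ℝ → ℝ} (hP : IsJet P) (hQ : IsJet Q) (vP : Van 0 P) (vQ : Van 1 Q) {M : ℝ}
    (hM : ∀ x ∈ Icc (0:ℝ) 1, |P 1 x| ≤ M ∧ |Q 1 x| ≤ M)
    (hM2 : ∀ x ∈ Icc (0:ℝ) 1, |P 2 x| ≤ M ∧ |Q 2 x| ≤ M) :
    |∫ x in (0:ℝ)..1, EF P Q 4 x| ≤ ∫ x in (0:ℝ)..1, (50 * M * (P 4 x ^2 + Q 4 x ^2)
      + 50 * M * (P 3 x ^ 2 + Q 3 x ^ 2)) := by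
  have c0 := hP.cont 0; have c1 := hP.cont 1; have c2 := hP.cont 2; have c3 := hP.cont 3; have c4 := hP.cont 4
  have d0 := hQ.cont 0; have d1 := hQ.cont 1; have d2 := hQ.cont 2; have d3 := hQ.cont 3; have d4 := hQ.cont 4
  refine intTot (D := Lead P Q 4) (R := fun x => -((1/2) * (P 1 x * P 4 x * Q 4 x) + (1/4) * (Q 1 x * P 4 x * P 4 x)
      + (3/4) * (Q 1 x * Q 4 x * Q 4 x)) + (5/2) * (P 1 x * P 4 x * Q 4 x) + 5 * (P 2 x * Q 3 x * P 4 x)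
      + 5 * (Q 2 x * P 3 x * P 4 x) + (5/2) * (Q 1 x * P 4 x * P 4 x)
      + (15/2) * (Q 1 x * Q 4 x * Q 4 x) + 15 * (Q 2 x * Q 3 x * Q 4 x)
      + (5/2) * (P 1 x * P 4 x * Q 4 x) + 5 * (P 2 x * P 3 x * Q 4 x)) ?_ (EF_cont hP hQ 4) (by fun_prop)
    (by fun_prop) (lead_zero vP vQ 4).1 (lead_zero vP vQ 4).2 ?_
  · intro x hx
    refine (leadD hP hQ 4 x hx).congr_deriv ?_
    simp only [EF, FJ1, FJ2, jmul5, Nat.reduceAdd]; ring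
  · intro x hx
    have a := (hM x hx).1
    have b := (hM x hx).2
    have a2 := (hM2 x hx).1
    have b2 := (hM2 x hx).2
    have h1 := abs_le.1 (ab_le a (P 4 x) (Q 4 x))
    have h2 := abs_le.1 (ab_le b (P 4 x) (P 4 x))
    have h3 := abs_le.1 (ab_le b (Q 4 x) (Q 4 x))
    have h4 := abs_le.1 (ab_le a2 (Q 3 x) (P 4 x))
    have h5 := abs_le.1 (ab_le b2 (P 3 x) (P 4 x))
    have h6 := abs_le.1 (ab_le b2 (Q 3 x) (Q 4 x))
    have h7 := abs_le.1 (ab_le a2 (P 3 x) (Q 4 x))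
    have hM0 : 0 ≤ M := (abs_nonneg _).trans a
    have p1 : 0 ≤ M * P 3 x ^ 2 := by positivity
    have p2 : 0 ≤ M * Q 3 x ^ 2 := by positivity
    have p3 : 0 ≤ M * P 4 x ^ 2 := by positivity
    have p4 : 0 ≤ M * Q 4 x ^ 2 := by positivity
    rw [abs_le]
    constructor <;> nlinarith

/-- energy of order `j` -/
def Yj (p q : ℕ → ℝ → ℝ) (j : ℕ) : ℝ := ∫ x in (0:ℝ)..1, (p j x ^ 2 + q j x ^ 2)

theorem Yj_split {p q : ℕ → ℝ → ℝ} (hp : IsJet p) (hq : IsJet q) (j : ℕ) :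
    Yj p q j = (∫ x in (0:ℝ)..1, p j x ^ 2) + ∫ x in (0:ℝ)..1, q j x ^ 2 := by
  have := hp.cont j; have := hq.cont j
  unfold Yj
  rw [intervalIntegral.integral_add (ii01 (by fun_prop)) (ii01 (by fun_prop))]

/-- properties of a Galerkin path -/
structure GalP (n : ℕ) (σ S : ℝ) (p q pt qt : ℝ → ℕ → ℝ → ℝ) : Prop where
  pj : ∀ s, IsJet (p s)
  qj : ∀ s, IsJet (q s)
  ptj : ∀ s, IsJet (pt s)
  qtj : ∀ s, IsJet (qt s)
  pv : ∀ s, Van 0 (p s)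
  qv : ∀ s, Van 1 (q s)
  ptv : ∀ s, Van 0 (pt s)
  qtv : ∀ s, Van 1 (qt s)
  dp : ∀ s ∈ Icc 0 S, ∀ k x, HasDerivWithinAt (fun s => p s k x) (pt s k x) (Icc 0 S) s
  dq : ∀ s ∈ Icc 0 S, ∀ k x, HasDerivWithinAt (fun s => q s k x) (qt s k x) (Icc 0 S) s
  cp : ∀ k, Continuous (fun z : ℝ × ℝ => p z.2 k z.1)
  cq : ∀ k, Continuous (fun z : ℝ × ℝ => q z.2 k z.1)
  cpt : ∀ k, Continuous (fun z : ℝ × ℝ => pt z.2 k z.1)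
  cqt : ∀ k, Continuous (fun z : ℝ × ℝ => qt z.2 k z.1)
  eC : ∀ j, ContinuousOn (fun s => Yj (p s) (q s) j) (Icc 0 S)
  eD : ∀ j, ∀ s ∈ Ioo 0 S, HasDerivAt (fun s => Yj (p s) (q s) j)
    (-2 * σ * ∫ x in (0:ℝ)..1, EF (p s) (q s) j x) s
  mono : ∀ s, ∀ j, 1 ≤ j → Yj (p s) (q s) j ≤ Yj (p s) (q s) (j+1)
  r1 : ∀ s ∈ Icc 0 S, (n:ℝ)^2 * ∫ x in (0:ℝ)..1, (pt s 0 x + σ * f1 (p s) (q s) x)^2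
    ≤ ∫ x in (0:ℝ)..1, FJ1 (p s) (q s) 2 x ^ 2
  r2 : ∀ s ∈ Icc 0 S, (n:ℝ)^2 * ∫ x in (0:ℝ)..1, (qt s 0 x + σ * f2 (p s) (q s) x)^2
    ≤ ∫ x in (0:ℝ)..1, FJ2 (p s) (q s) 2 x ^ 2
  p3 : ∀ s ∈ Icc 0 S, ∫ x in (0:ℝ)..1, pt s 3 x ^ 2 ≤ ∫ x in (0:ℝ)..1, FJ1 (p s) (q s) 4 x ^ 2
  q3 : ∀ s ∈ Icc 0 S, ∫ x in (0:ℝ)..1, qt s 3 x ^ 2 ≤ ∫ x in (0:ℝ)..1, FJ2 (p s) (q s) 4 x ^ 2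

theorem jsum_smul (n : ℕ) (r : ℝ) (c : ℕ → ℝ) (𝓔 : ℕ → ℕ → ℝ → ℝ) (j : ℕ) (x : ℝ) :
    jsum n (fun k => r * c k) 𝓔 j x = r * jsum n c 𝓔 j x := by
  simp only [jsum, Finset.mul_sum]
  exact Finset.sum_congr rfl fun k _ => by ring

theorem jsum_cont {n : ℕ} {A : ℝ → ℕ → ℝ} (hA : ∀ k < n, Continuous (fun s => A s k))
    {𝓔 : ℕ → ℕ → ℝ → ℝ} (hE : ∀ k, IsJet (𝓔 k)) (j : ℕ) :
    Continuous (fun z : ℝ × ℝ => jsum n (A z.2) 𝓔 j z.1) := by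
  unfold jsum
  refine continuous_finsetSum _ fun k hk => ?_
  exact ((hA k (Finset.mem_range.1 hk)).comp continuous_snd).mul (((hE k).cont j).comp continuous_fst)

theorem enMono {𝓔 : ℕ → ℕ → ℝ → ℝ} {μ : ℕ → ℝ} {e : ℕ} (F : Fam 𝓔 μ e) (n : ℕ) (c : ℕ → ℝ) {j : ℕ}
    (hj : 1 ≤ j) : ∫ x in (0:ℝ)..1, (jsum n c 𝓔 j x)^2 ≤ ∫ x in (0:ℝ)..1, (jsum n c 𝓔 (j+1) x)^2 := by
  rw [F.energy, F.energy]
  refine Finset.sum_le_sum fun k _ => ?_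
  apply mul_le_mul_of_nonneg_right _ (sq_nonneg _)
  rcases F.big k with h | h
  · rw [h, zero_pow (by omega), zero_pow (by omega)]
  · exact pow_le_pow_right₀ h (by omega)

theorem enDer {𝓔 : ℕ → ℕ → ℝ → ℝ} {μ : ℕ → ℝ} {e : ℕ} (F : Fam 𝓔 μ e) {n : ℕ} {σ : ℝ} (c : ℕ → ℝ)
    {G : ℕ → ℝ → ℝ} {e' : ℕ} (hG : IsJet G) (vG : Van e' G) (he : Even (1 + e + e')) (j : ℕ) :
    ∑ k ∈ Finset.range n, (μ k)^(2*j) * (2 * c k * (-σ * ∫ x in (0:ℝ)..1, G 1 x * 𝓔 k 0 x))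
      = -2 * σ * ∫ x in (0:ℝ)..1, G (j+1) x * jsum n c 𝓔 j x := by
  have h1 := F.pair n (fun k => (μ k)^(2*j) * c k) (hG.cont 1).continuousOn
  have h2 := hG.ibpn (F.jetS n c) vG (F.vanS n c) j (a := 1) (b := j) (by
    rw [show 1 + j + j + e' + e = (1 + e + e') + 2 * j by ring]; exact he.add (even_two_mul _))
  rw [← two_mul, add_comm 1 j] at h2
  simp only [F.jsum_even n c j] at h2
  have h3 : (-1:ℝ)^j * (-1)^j = 1 := by rw [← mul_pow]; simp
  have h4 : (∫ x in (0:ℝ)..1, G 1 x * ((-1) ^ j * jsum n (fun k => μ k ^ (2 * j) * c k) 𝓔 0 x))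
     = (-1)^j * ∫ x in (0:ℝ)..1, G 1 x * jsum n (fun k => μ k ^ (2 * j) * c k) 𝓔 0 x := by
    rw [← intervalIntegral.integral_const_mul]; congr 1; ext x; ring
  rw [h4] at h2
  have h5 : (∫ x in (0:ℝ)..1, G 1 x * jsum n (fun k => μ k ^ (2 * j) * c k) 𝓔 0 x)
     = ∫ x in (0:ℝ)..1, G (j+1) x * jsum n c 𝓔 j x := by
    have := congrArg (fun z => (-1:ℝ)^j * z) h2
    simp only [← mul_assoc, h3, one_mul] at this
    exact this
  rw [← h5, h1, Finset.mul_sum]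
  exact Finset.sum_congr rfl fun k _ => by ring

theorem galP (n : ℕ) {σ : ℝ} (hσ : σ = 1 ∨ σ = -1) (a0 b0 : ℕ → ℝ) {S : ℝ} (hS : 0 ≤ S) :
    ∃ p q pt qt : ℝ → ℕ → ℝ → ℝ, GalP n σ S p q pt qt ∧ p 0 = jsum n a0 ec ∧ q 0 = jsum n b0 es := by
  obtain ⟨a, b, h0, hd⟩ := galODE n σ a0 b0 hS
  have hσ2 : σ * σ = 1 := by rcases hσ with h | h <;> rw [h] <;> norm_num
  let A : ℝ → ℕ → ℝ := fun s => a (projIcc 0 S hS s)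
  let B : ℝ → ℕ → ℝ := fun s => b (projIcc 0 S hS s)
  have hA : ∀ s ∈ Icc 0 S, A s = a s := fun s hs => by simp [A, projIcc_of_mem hS hs]
  have hB : ∀ s ∈ Icc 0 S, B s = b s := fun s hs => by simp [B, projIcc_of_mem hS hs]
  have cA : ∀ k < n, Continuous (fun s => A s k) := by
    intro k hk
    have : ContinuousOn (fun s => a s k) (Icc 0 S) := fun s hs => (hd s hs k hk).1.continuousWithinAt
    exact (continuousOn_iff_continuous_restrict.1 this).comp continuous_projIcc
  have cB : ∀ k < n, Continuous (fun s => B s k) := by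
    intro k hk
    have : ContinuousOn (fun s => b s k) (Icc 0 S) := fun s hs => (hd s hs k hk).2.continuousWithinAt
    exact (continuousOn_iff_continuous_restrict.1 this).comp continuous_projIcc
  let p : ℝ → ℕ → ℝ → ℝ := fun s => jsum n (A s) ec
  let q : ℝ → ℕ → ℝ → ℝ := fun s => jsum n (B s) es
  have pj : ∀ s, IsJet (p s) := fun s => famC.jetS n _
  have qj : ∀ s, IsJet (q s) := fun s => famS.jetS n _
  have pv : ∀ s, Van 0 (p s) := fun s => famC.vanS n _
  have qv : ∀ s, Van 1 (q s) := fun s => famS.vanS n _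
  let tA : ℝ → ℕ → ℝ := fun s k => -σ * ∫ x in (0:ℝ)..1, FJ1 (p s) (q s) 1 x * ec k 0 x
  let tB : ℝ → ℕ → ℝ := fun s k => -σ * ∫ x in (0:ℝ)..1, FJ2 (p s) (q s) 1 x * es k 0 x
  have dA : ∀ s ∈ Icc 0 S, ∀ k < n, HasDerivWithinAt (fun s => A s k) (tA s k) (Icc 0 S) s := by
    intro s hs k hk
    have := (hd s hs k hk).1
    rw [← hA s hs, ← hB s hs, ← FJ1_one] at this
    exact this.congr (fun r hr => by rw [hA r hr]) (by rw [hA s hs])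
  have dB : ∀ s ∈ Icc 0 S, ∀ k < n, HasDerivWithinAt (fun s => B s k) (tB s k) (Icc 0 S) s := by
    intro s hs k hk
    have := (hd s hs k hk).2
    rw [← hA s hs, ← hB s hs, ← FJ2_one] at this
    exact this.congr (fun r hr => by rw [hB r hr]) (by rw [hB s hs])
  have cp : ∀ k, Continuous (fun z : ℝ × ℝ => p z.2 k z.1) := fun k => jsum_cont cA famC.jet k
  have cq : ∀ k, Continuous (fun z : ℝ × ℝ => q z.2 k z.1) := fun k => jsum_cont cB famS.jet k
  have cp' : ∀ k, Continuous (fun z : ℝ × ℝ => p z.1 k z.2) := fun k => (cp k).comp continuous_swap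
  have cq' : ∀ k, Continuous (fun z : ℝ × ℝ => q z.1 k z.2) := fun k => (cq k).comp continuous_swap
  have ctA : ∀ k < n, Continuous (fun s => tA s k) := by
    intro k hk
    apply Continuous.mul continuous_const
    apply intervalIntegral.continuous_parametric_intervalIntegral_of_continuous'
    have := cp' 0; have := cp' 1; have := cq' 0; have := cq' 1; have := (famC.jet k).cont 0
    simp only [Function.uncurry_def, FJ1_one, f1]
    fun_prop
  have ctB : ∀ k < n, Continuous (fun s => tB s k) := by
    intro k hk
    apply Continuous.mul continuous_const
    apply intervalIntegral.continuous_parametric_intervalIntegral_of_continuous'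
    have := cp' 0; have := cp' 1; have := cq' 0; have := cq' 1; have := (famS.jet k).cont 0
    simp only [Function.uncurry_def, FJ2_one, f2]
    fun_prop
  have hY : ∀ j s, Yj (p s) (q s) j = (∑ k ∈ Finset.range n, ((k:ℝ) * Real.pi)^(2*j) * A s k ^2)
      + ∑ k ∈ Finset.range n, ((k+1:ℕ) * Real.pi)^(2*j) * B s k ^2 := by
    intro j s
    rw [Yj_split (pj s) (qj s), famC.energy, famS.energy]
  have e1 : ∀ s x, jsum n (tA s) ec 0 x = -σ * jsum n (fun k => ∫ x in (0:ℝ)..1, FJ1 (p s) (q s) 1 x * ec k 0 x) ec 0 x :=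
    fun s x => jsum_smul _ _ _ _ _ _
  have e2 : ∀ s x, jsum n (tB s) es 0 x = -σ * jsum n (fun k => ∫ x in (0:ℝ)..1, FJ2 (p s) (q s) 1 x * es k 0 x) es 0 x :=
    fun s x => jsum_smul _ _ _ _ _ _
  refine ⟨p, q, fun s => jsum n (tA s) ec, fun s => jsum n (tB s) es, ?_, ?_, ?_⟩
  · constructor
    · exact pj
    · exact qj
    · exact fun s => famC.jetS n _
    · exact fun s => famS.jetS n _
    · exact pv
    · exact qv
    · exact fun s => famC.vanS n _
    · exact fun s => famS.vanS n _
    · intro s hs k x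
      exact HasDerivWithinAt.fun_sum fun i hi => (dA s hs i (Finset.mem_range.1 hi)).mul_const _
    · intro s hs k x
      exact HasDerivWithinAt.fun_sum fun i hi => (dB s hs i (Finset.mem_range.1 hi)).mul_const _
    · exact cp
    · exact cq
    · exact fun k => jsum_cont ctA famC.jet k
    · exact fun k => jsum_cont ctB famS.jet k
    · intro j
      simp only [hY]
      apply Continuous.continuousOn
      apply Continuous.add
      · exact continuous_finsetSum _ fun k hk => ((cA k (Finset.mem_range.1 hk)).pow 2).const_mul _
      · exact continuous_finsetSum _ fun k hk => ((cB k (Finset.mem_range.1 hk)).pow 2).const_mul _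
    · intro j s hs
      simp only [hY]
      have hs' := Ioo_subset_Icc_self hs
      have hn := Icc_mem_nhds hs.1 hs.2
      have d1 : HasDerivAt (fun s => ∑ k ∈ Finset.range n, ((k:ℝ) * Real.pi)^(2*j) * A s k ^2)
          (∑ k ∈ Finset.range n, ((k:ℝ) * Real.pi)^(2*j) * (2 * A s k * tA s k)) s := by
        refine HasDerivAt.fun_sum fun k hk => ?_
        have := ((dA s hs' k (Finset.mem_range.1 hk)).hasDerivAt hn).fun_pow 2
        exact (this.congr_deriv (by push_cast; ring)).const_mul _
      have d2 : HasDerivAt (fun s => ∑ k ∈ Finset.range n, ((k+1:ℕ) * Real.pi)^(2*j) * B s k ^2)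
          (∑ k ∈ Finset.range n, ((k+1:ℕ) * Real.pi)^(2*j) * (2 * B s k * tB s k)) s := by
        refine HasDerivAt.fun_sum fun k hk => ?_
        have := ((dB s hs' k (Finset.mem_range.1 hk)).hasDerivAt hn).fun_pow 2
        exact (this.congr_deriv (by push_cast; ring)).const_mul _
      refine (d1.add d2).congr_deriv ?_
      have g1 := enDer famC (n := n) (σ := σ) (A s) (jetF1 (pj s) (qj s)) (vanF1 (pv s) (qv s)) (by decide) j
      have g2 := enDer famS (n := n) (σ := σ) (B s) (jetF2 (pj s) (qj s)) (vanF2 (pv s) (qv s)) (by decide) j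
      rw [g1, g2, ← mul_add, ← intervalIntegral.integral_add]
      · rfl
      · exact (((jetF1 (pj s) (qj s)).cont _).mul ((pj s).cont _)).intervalIntegrable _ _
      · exact (((jetF2 (pj s) (qj s)).cont _).mul ((qj s).cont _)).intervalIntegrable _ _
    · intro s j hj
      rw [Yj_split (pj s) (qj s), Yj_split (pj s) (qj s)]
      exact add_le_add (enMono famC n _ hj) (enMono famS n _ hj)
    · intro s hs
      have := famC.approx n ((jetF1 (pj s) (qj s)).d01 1) ((jetF1 (pj s) (qj s)).cont _).continuousOn (Or.inl rfl)
      refine le_trans (le_of_eq ?_) this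
      congr 2; ext x
      rw [← FJ1_one, e1]
      linear_combination ((FJ1 (p s) (q s) 1 x - jsum n (fun k => ∫ x in (0:ℝ)..1, FJ1 (p s) (q s) 1 x * ec k 0 x) ec 0 x)^2) * hσ2
    · intro s hs
      have := famS.approx n ((jetF2 (pj s) (qj s)).d01 1) ((jetF2 (pj s) (qj s)).cont _).continuousOn
        (Or.inr ((vanF2 (pv s) (qv s)) 1 (by decide)))
      refine le_trans (le_of_eq ?_) this
      congr 2; ext x
      rw [← FJ2_one, e2]
      linear_combination ((FJ2 (p s) (q s) 1 x - jsum n (fun k => ∫ x in (0:ℝ)..1, FJ2 (p s) (q s) 1 x * es k 0 x) es 0 x)^2) * hσ2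
    · intro s hs
      have J := jetF1 (pj s) (qj s)
      have := famC.bessel3 n (J.d01 1) (J.d01 2) (J.d01 3) (J.cont _).continuousOn
        (Or.inl ⟨rfl, vanF1 (pv s) (qv s) 2 (by decide)⟩)
      refine le_trans (le_of_eq ?_) this
      congr 1; ext x
      rw [show jsum n (tA s) ec 3 x = _ from jsum_smul _ _ _ _ _ _]
      linear_combination ((jsum n (fun k => ∫ x in (0:ℝ)..1, FJ1 (p s) (q s) 1 x * ec k 0 x) ec 3 x)^2) * hσ2
    · intro s hs
      have J := jetF2 (pj s) (qj s)
      have v1 := vanF2 (pv s) (qv s) 1 (by decide)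
      have v2 := vanF2 (pv s) (qv s) 3 (by decide)
      have := famS.bessel3 n (J.d01 1) (J.d01 2) (J.d01 3) (J.cont _).continuousOn
        (Or.inr ⟨rfl, v1.1, v1.2, v2.1, v2.2⟩)
      refine le_trans (le_of_eq ?_) this
      congr 1; ext x
      rw [show jsum n (tB s) es 3 x = _ from jsum_smul _ _ _ _ _ _]
      linear_combination ((jsum n (fun k => ∫ x in (0:ℝ)..1, FJ2 (p s) (q s) 1 x * es k 0 x) es 3 x)^2) * hσ2
  · ext j x
    simp only [p, jsum, hA 0 ⟨le_rfl, hS⟩]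
    exact Finset.sum_congr rfl fun k hk => by rw [(h0 k (Finset.mem_range.1 hk)).1]
  · ext j x
    simp only [q, jsum, hB 0 ⟨le_rfl, hS⟩]
    exact Finset.sum_congr rfl fun k hk => by rw [(h0 k (Finset.mem_range.1 hk)).2]

theorem Yj_nonneg (p q : ℕ → ℝ → ℝ) (j : ℕ) : 0 ≤ Yj p q j :=
  int01_nonneg fun x _ => by positivity

theorem supY {p q : ℕ → ℝ → ℝ} (hp : IsJet p) (hq : IsJet q) (k : ℕ) {x : ℝ} (hx : x ∈ Icc (0:ℝ) 1) :
    p k x ^ 2 ≤ 2 * Yj p q k + Yj p q (k+1) ∧ q k x ^ 2 ≤ 2 * Yj p q k + Yj p q (k+1) := by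
  have a := (hp.d01 k).sob (hp.cont _).continuousOn one_pos hx
  have b := (hq.d01 k).sob (hq.cont _).continuousOn one_pos hx
  have n1 : ∀ j, 0 ≤ ∫ x in (0:ℝ)..1, p j x ^ 2 := fun j => int01_nonneg fun x _ => by positivity
  have n2 : ∀ j, 0 ≤ ∫ x in (0:ℝ)..1, q j x ^ 2 := fun j => int01_nonneg fun x _ => by positivity
  have := n1 k; have := n2 k; have := n1 (k+1); have := n2 (k+1)
  rw [Yj_split hp hq, Yj_split hp hq]
  norm_num at a b
  constructor <;> linarith

theorem abs_le_of_sq {a K : ℝ} (hK : 0 ≤ K) (h : a ^ 2 ≤ K ^ 2) : |a| ≤ K := abs_le_of_sq_le_sq h hK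

theorem Yint {p q : ℕ → ℝ → ℝ} (hp : IsJet p) (hq : IsJet q) (j k : ℕ) (c d : ℝ) :
    ∫ x in (0:ℝ)..1, (c * (p j x ^ 2 + q j x ^ 2) + d * (p k x ^ 2 + q k x ^ 2)) = c * Yj p q j + d * Yj p q k := by
  have := hp.cont j; have := hq.cont j; have := hp.cont k; have := hq.cont k
  rw [intervalIntegral.integral_add (ii01 (by fun_prop)) (ii01 (by fun_prop)),
    intervalIntegral.integral_const_mul, intervalIntegral.integral_const_mul]
  rfl

theorem Yint1 {p q : ℕ → ℝ → ℝ} (hp : IsJet p) (hq : IsJet q) (j : ℕ) (c d : ℝ) :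
    ∫ x in (0:ℝ)..1, (c * (p j x ^ 2 + q j x ^ 2) + d) = c * Yj p q j + d := by
  have := hp.cont j; have := hq.cont j
  rw [intervalIntegral.integral_add (ii01 (by fun_prop)) (ii01 (by fun_prop)),
    intervalIntegral.integral_const_mul]
  simp [Yj]

theorem gY {n : ℕ} {σ S : ℝ} (hσ : σ = 1 ∨ σ = -1) {p q pt qt : ℝ → ℕ → ℝ → ℝ} (G : GalP n σ S p q pt qt)
    (j : ℕ) {C s : ℝ} (hC : 0 ≤ C) (hs : s ≤ S)
    (h : ∀ r ∈ Ioo 0 s, |∫ x in (0:ℝ)..1, EF (p r) (q r) j x| ≤ C * Yj (p r) (q r) j) :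
    ∀ r ∈ Icc 0 s, Yj (p r) (q r) j ≤ Yj (p 0) (q 0) j * Real.exp (2 * C * r) := by
  intro r hr
  have := gron (E := fun s => Yj (p s) (q s) j) (C := 2*C) (D := 0) (S := s) (by positivity) le_rfl
    ((G.eC j).mono (Icc_subset_Icc_right hs)) (fun t ht => G.eD j t ⟨ht.1, ht.2.trans_le hs⟩) (by
      intro t ht
      have a := abs_le.1 (h t ht)
      rcases hσ with e | e <;> rw [e] <;> linarith [a.1, a.2]) r hr
  simpa using this

theorem gY0 {n : ℕ} {σ S : ℝ} (hσ : σ = 1 ∨ σ = -1) {p q pt qt : ℝ → ℕ → ℝ → ℝ} (G : GalP n σ S p q pt qt)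
    : ∀ r ∈ Icc 0 S, Yj (p r) (q r) 0 ≤ Yj (p 0) (q 0) 0 := by
  intro r hr
  have := gY hσ G 0 (C := 0) le_rfl (le_refl S) (by
    intro t ht
    have : (∫ x in (0:ℝ)..1, EF (p t) (q t) 0 x) = 0 := by
      refine Eq.trans ?_ (f_cons (G.pj t) (G.qj t) (G.qv t))
      simp only [EF, zero_add, FJ1_one, FJ2_one]
    rw [this]; simp) r hr
  simpa using this

theorem gY2 {n : ℕ} {σ S : ℝ} (hσ : σ = 1 ∨ σ = -1) {p q pt qt : ℝ → ℕ → ℝ → ℝ} (G : GalP n σ S p q pt qt)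
    {M s : ℝ} (hM0 : 0 ≤ M) (hs : s ≤ S)
    (hM : ∀ r ∈ Ioo 0 s, ∀ x ∈ Icc (0:ℝ) 1, |p r 1 x| ≤ M ∧ |q r 1 x| ≤ M) :
    ∀ r ∈ Icc 0 s, Yj (p r) (q r) 2 ≤ Yj (p 0) (q 0) 2 * Real.exp (20 * M * r) := by
  intro r hr
  have := gY hσ G 2 (C := 10*M) (by positivity) hs (by
    intro t ht
    have := en2 (G.pj t) (G.qj t) (G.pv t) (G.qv t) (hM t ht)
    rw [intervalIntegral.integral_const_mul] at this
    exact this) r hr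
  rwa [show 2 * (10 * M) * r = 20 * M * r by ring] at this

theorem gY3 {n : ℕ} {σ S : ℝ} (hσ : σ = 1 ∨ σ = -1) {p q pt qt : ℝ → ℕ → ℝ → ℝ} (G : GalP n σ S p q pt qt)
    {M B : ℝ} (hM0 : 0 ≤ M) (hB0 : 0 ≤ B)
    (hM : ∀ r ∈ Icc 0 S, ∀ x ∈ Icc (0:ℝ) 1, |p r 1 x| ≤ M ∧ |q r 1 x| ≤ M)
    (hB : ∀ r ∈ Icc 0 S, Yj (p r) (q r) 2 ≤ B) :
    ∀ r ∈ Icc 0 S, Yj (p r) (q r) 3 ≤ Yj (p 0) (q 0) 3 * Real.exp (2 * (20 * (M+1) + 30 * B) * r) := by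
  intro r hr
  refine gY hσ G 3 (by positivity) le_rfl (fun t ht => ?_) r hr
  have ht' := Ioo_subset_Icc_self ht
  have := en3 (G.pj t) (G.qj t) (G.pv t) (G.qv t) (hM t ht') (fun x hx => supY (G.pj t) (G.qj t) 2 hx)
  rw [Yint (G.pj t) (G.qj t)] at this
  have m := G.mono t 2 (by norm_num)
  have b := hB t ht'
  have n2 := Yj_nonneg (p t) (q t) 2
  have n3 := Yj_nonneg (p t) (q t) 3
  norm_num at this m
  nlinarith [mul_nonneg n2 n3, mul_le_mul_of_nonneg_right b n3, mul_le_mul_of_nonneg_right m n2]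

theorem gY4 {n : ℕ} {σ S : ℝ} (hσ : σ = 1 ∨ σ = -1) {p q pt qt : ℝ → ℕ → ℝ → ℝ} (G : GalP n σ S p q pt qt)
    {M : ℝ} (hM0 : 0 ≤ M)
    (hM : ∀ r ∈ Icc 0 S, ∀ x ∈ Icc (0:ℝ) 1, |p r 1 x| ≤ M ∧ |q r 1 x| ≤ M)
    (hM2 : ∀ r ∈ Icc 0 S, ∀ x ∈ Icc (0:ℝ) 1, |p r 2 x| ≤ M ∧ |q r 2 x| ≤ M) :
    ∀ r ∈ Icc 0 S, Yj (p r) (q r) 4 ≤ Yj (p 0) (q 0) 4 * Real.exp (2 * (100 * M) * r) := by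
  intro r hr
  refine gY hσ G 4 (by positivity) le_rfl (fun t ht => ?_) r hr
  have ht' := Ioo_subset_Icc_self ht
  have := en4 (G.pj t) (G.qj t) (G.pv t) (G.qv t) (hM t ht') (hM2 t ht')
  rw [Yint (G.pj t) (G.qj t)] at this
  have m := G.mono t 3 (by norm_num)
  norm_num at m
  nlinarith

theorem flux2 {P Q : ℕ → ℝ → ℝ} (hP : IsJet P) (hQ : IsJet Q) {K : ℝ} 
    (hK : ∀ k ≤ 1, ∀ x ∈ Icc (0:ℝ) 1, |P k x| ≤ K ∧ |Q k x| ≤ K) :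
    ∫ x in (0:ℝ)..1, FJ1 P Q 2 x ^ 2 ≤ 20 * (1 + K^2) * Yj P Q 2 + 20 * K^4 ∧
    ∫ x in (0:ℝ)..1, FJ2 P Q 2 x ^ 2 ≤ 20 * (1 + K^2) * Yj P Q 2 + 20 * K^4 := by
  rw [← Yint1 hP hQ]
  have := hP.cont 2; have := hQ.cont 2
  have c1 := (jetF1 hP hQ).cont 2; have c2 := (jetF2 hP hQ).cont 2
  have sq : ∀ a : ℝ, |a| ≤ K → a^2 ≤ K^2 := fun a h => sq_le_sq' (abs_le.1 h).1 (abs_le.1 h).2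
  constructor
  · refine int01_mono (by fun_prop) (by fun_prop) fun x hx => ?_
    have a0 := sq _ (hK 0 (by norm_num) x hx).1; have a1 := sq _ (hK 1 (by norm_num) x hx).1
    have b0 := sq _ (hK 0 (by norm_num) x hx).2; have b1 := sq _ (hK 1 (by norm_num) x hx).2
    simp only [FJ1, jmul2]
    generalize P 0 x = p0 at *; generalize P 1 x = p1 at *; generalize P 2 x = p2 at *
    generalize Q 0 x = q0 at *; generalize Q 1 x = q1 at *; generalize Q 2 x = q2 at *
    have h1 := mul_le_mul_of_nonneg_right b0 (sq_nonneg p2)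
    have h2 := mul_le_mul_of_nonneg_right a0 (sq_nonneg q2)
    have h3 := mul_le_mul a1 b1 (sq_nonneg _) (sq_nonneg _)
    have y : ∀ a b c d : ℝ, (a+b+c+d)^2 ≤ 4*(a^2+b^2+c^2+d^2) := fun a b c d => by
      nlinarith [sq_nonneg (a-b), sq_nonneg (a-c), sq_nonneg (a-d), sq_nonneg (b-c), sq_nonneg (b-d), sq_nonneg (c-d)]
    have := y q2 ((1/2)*(p2*q0)) (p1*q1) ((1/2)*(p0*q2))
    have n1 : 0 ≤ K^2*p2^2 := by positivity
    have n2 : 0 ≤ K^2*q2^2 := by positivity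
    have n3 : 0 ≤ K^2*K^2 := by positivity
    nlinarith [sq_nonneg p2, sq_nonneg q2]
  · refine int01_mono (by fun_prop) (by fun_prop) fun x hx => ?_
    have a0 := sq _ (hK 0 (by norm_num) x hx).1; have a1 := sq _ (hK 1 (by norm_num) x hx).1
    have b0 := sq _ (hK 0 (by norm_num) x hx).2; have b1 := sq _ (hK 1 (by norm_num) x hx).2
    simp only [FJ2, jmul2]
    generalize P 0 x = p0 at *; generalize P 1 x = p1 at *; generalize P 2 x = p2 at *
    generalize Q 0 x = q0 at *; generalize Q 1 x = q1 at *; generalize Q 2 x = q2 at *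
    have h1 := mul_le_mul_of_nonneg_right b0 (sq_nonneg q2)
    have h2 := mul_le_mul_of_nonneg_right a0 (sq_nonneg p2)
    have h3 := mul_le_mul a1 a1 (sq_nonneg _) (sq_nonneg _)
    have h4 := mul_le_mul b1 b1 (sq_nonneg _) (sq_nonneg _)
    have y : ∀ a b c d e : ℝ, (a+b+c+d+e)^2 ≤ 5*(a^2+b^2+c^2+d^2+e^2) := fun a b c d e => by
      nlinarith [sq_nonneg (a-b), sq_nonneg (a-c), sq_nonneg (a-d), sq_nonneg (b-c), sq_nonneg (b-d), sq_nonneg (c-d), sq_nonneg (a-e), sq_nonneg (b-e), sq_nonneg (c-e), sq_nonneg (d-e)]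
    have := y p2 ((3/2)*(q0*q2)) ((3/2)*(q1*q1)) ((1/2)*(p0*p2)) ((1/2)*(p1*p1))
    have n1 : 0 ≤ K^2*p2^2 := by positivity
    have n2 : 0 ≤ K^2*q2^2 := by positivity
    have n3 : 0 ≤ K^2*K^2 := by positivity
    nlinarith [sq_nonneg p2, sq_nonneg q2]

theorem flux4 {P Q : ℕ → ℝ → ℝ} (hP : IsJet P) (hQ : IsJet Q) {K : ℝ} 
    (hK : ∀ k ≤ 3, ∀ x ∈ Icc (0:ℝ) 1, |P k x| ≤ K ∧ |Q k x| ≤ K) :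
    ∫ x in (0:ℝ)..1, FJ1 P Q 4 x ^ 2 ≤ 200 * (1 + K)^2 * Yj P Q 4 + 2000 * K^4 ∧
    ∫ x in (0:ℝ)..1, FJ2 P Q 4 x ^ 2 ≤ 200 * (1 + K)^2 * Yj P Q 4 + 2000 * K^4 := by
  rw [← Yint1 hP hQ]
  have := hP.cont 4; have := hQ.cont 4
  have c1 := (jetF1 hP hQ).cont 4; have c2 := (jetF2 hP hQ).cont 4
  have pr : ∀ a b : ℝ, |a| ≤ K → |b| ≤ K → |a*b| ≤ K^2 := fun a b h h' => by
    rw [abs_mul, sq]; exact mul_le_mul h h' (abs_nonneg _) ((abs_nonneg _).trans h)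
  have pl : ∀ a b : ℝ, |a| ≤ K → |a*b| ≤ K*|b| := fun a b h => by
    rw [abs_mul]; exact mul_le_mul_of_nonneg_right h (abs_nonneg _)
  have fin : ∀ z a b : ℝ, |z| ≤ 3*(1+K)*(|a|+|b|) + 20*K^2 → 0 ≤ K → z^2 ≤ 200 * (1+K)^2*(a^2+b^2) + 2000*K^4 := by
    intro z a b h hK0
    have e : z^2 ≤ (3*(1+K)*(|a|+|b|) + 20*K^2)^2 := by
      rw [← sq_abs z]; exact pow_le_pow_left₀ (abs_nonneg _) h 2
    have n1 := abs_nonneg a; have n2 := abs_nonneg b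
    rw [← sq_abs a, ← sq_abs b]
    nlinarith [sq_nonneg (3*(1+K)*(|a|+|b|) - 20*K^2), mul_nonneg (sq_nonneg (1+K)) (sq_nonneg (|a|-|b|)), sq_nonneg ((1+K)*|a|), sq_nonneg ((1+K)*|b|), sq_nonneg (K^2)]
  constructor
  · refine int01_mono (by fun_prop) (by fun_prop) fun x hx => ?_
    have h := fun k hk => (hK k hk x hx)
    have K0 : 0 ≤ K := (abs_nonneg _).trans (h 0 (by norm_num)).1
    refine fin _ _ _ ?_ K0
    have h0 := h 0 (by norm_num); have h1 := h 1 (by norm_num); have h2 := h 2 (by norm_num); have h3 := h 3 (by norm_num)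
    simp only [FJ1, jmul4]
    have u1 := abs_le.1 (pl _ (P 4 x) h0.2); have u2 := abs_le.1 (pl _ (Q 4 x) h0.1)
    have u3 := abs_le.1 (pr _ _ h3.1 h1.2); have u4 := abs_le.1 (pr _ _ h2.1 h2.2); have u5 := abs_le.1 (pr _ _ h1.1 h3.2)
    have m1 := le_abs_self (Q 4 x); have m2 := neg_abs_le (Q 4 x)
    have n1 := abs_nonneg (P 4 x); have n2 := abs_nonneg (Q 4 x)
    have n3 := mul_nonneg K0 n1; have n4 := mul_nonneg K0 n2
    rw [abs_le]; constructor <;> nlinarith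
  · refine int01_mono (by fun_prop) (by fun_prop) fun x hx => ?_
    have h := fun k hk => (hK k hk x hx)
    have K0 : 0 ≤ K := (abs_nonneg _).trans (h 0 (by norm_num)).1
    refine fin _ _ _ ?_ K0
    have h0 := h 0 (by norm_num); have h1 := h 1 (by norm_num); have h2 := h 2 (by norm_num); have h3 := h 3 (by norm_num)
    simp only [FJ2, jmul4]
    have u1 := abs_le.1 (pl _ (P 4 x) h0.1); have u2 := abs_le.1 (pl _ (Q 4 x) h0.2)
    have u3 := abs_le.1 (pr _ _ h3.1 h1.1); have u4 := abs_le.1 (pr _ _ h2.1 h2.1)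
    have u5 := abs_le.1 (pr _ _ h3.2 h1.2); have u6 := abs_le.1 (pr _ _ h2.2 h2.2)
    have m1 := le_abs_self (P 4 x); have m2 := neg_abs_le (P 4 x)
    have n1 := abs_nonneg (P 4 x); have n2 := abs_nonneg (Q 4 x)
    have n3 := mul_nonneg K0 n1; have n4 := mul_nonneg K0 n2
    rw [abs_le]; constructor <;> nlinarith

/-- recover a derivative bound from an approximate Lipschitz bound and an energy bound -/
theorem derRec {p : ℕ → ℝ → ℝ} (hp : IsJet p) {M B ε l : ℝ} (hB : 0 ≤ B)
    (hl : l = 1 / (4 * (B+1))) (hε : ε ≤ l^2/4)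
    (hL : ∀ x ∈ Icc (0:ℝ) 1, ∀ y ∈ Icc (0:ℝ) 1, |p 0 x - p 0 y| ≤ M * |x - y| + 2 * ε)
    (h2 : ∫ x in (0:ℝ)..1, p 2 x ^ 2 ≤ B) : ∀ x ∈ Icc (0:ℝ) 1, |p 1 x| ≤ M + 1 := by
  intro x hx
  have l0 : 0 < l := by rw [hl]; positivity
  have lB : l * (B + 1) = 1/4 := by rw [hl]; field_simp
  have l1 : l ≤ 1/4 := by nlinarith
  have l2 : l^2 ≤ 1/4 := by nlinarith
  have l2p : 0 < l^2 := by positivity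
  obtain ⟨a, ha0, ha1, hax, hxa⟩ : ∃ a, 0 ≤ a ∧ a + l^2 ≤ 1 ∧ a ≤ x ∧ x ≤ a + l^2 := by
    by_cases h : x + l^2 ≤ 1
    · exact ⟨x, hx.1, h, le_rfl, by linarith⟩
    · exact ⟨1 - l^2, by linarith, by linarith, by linarith, by linarith [hx.2]⟩
  obtain ⟨ξ, hξ, hξe⟩ := exists_hasDerivAt_eq_slope (p 0) (p 1) (show a < a + l^2 by linarith)
    (hp.cont 0).continuousOn (fun y _ => hp 0 y)
  have e1 : |p 1 ξ| ≤ M + 1/2 := by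
    rw [hξe, show a + l^2 - a = l^2 by ring, abs_div, abs_of_pos l2p, div_le_iff₀ l2p]
    have := hL (a + l^2) ⟨by linarith, ha1⟩ a ⟨ha0, by linarith⟩
    rw [show a + l^2 - a = l^2 by ring, abs_of_pos l2p] at this
    nlinarith
  have c2 := hp.cont 2
  have key : ∀ c d, a ≤ c → c ≤ d → d ≤ a + l^2 → |p 1 d - p 1 c| ≤ l * B + l/4 := by
    intro c d hc hcd hd
    rw [← (hp.d01 1).ftc2 c2.continuousOn (ha0.trans hc) hcd (hd.trans ha1)]
    have hI : ∀ u v, IntervalIntegrable (fun y => l * p 2 y ^2 + 1/(4*l)) MeasureTheory.volume u v :=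
      fun u v => (Continuous.intervalIntegrable (by fun_prop) _ _)
    have s1 : |∫ x in c..d, p (1+1) x| ≤ ∫ y in c..d, (l * p 2 y ^2 + 1/(4*l)) := by
      refine (intervalIntegral.abs_integral_le_integral_abs hcd).trans ?_
      refine intervalIntegral.integral_mono_on hcd (c2.abs.intervalIntegrable _ _) (hI _ _) fun y _ => ?_
      have : 0 ≤ l * (|p 2 y| - 1/(2*l))^2 := by positivity
      have e : l * (|p 2 y| - 1/(2*l))^2 = l * p 2 y ^2 + 1/(4*l) - |p 2 y| := by
        rw [sub_sq, sq_abs]; field_simp; ring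
      show |p 2 y| ≤ _
      linarith
    have s2 : ∫ y in c..d, (l * p 2 y ^2 + 1/(4*l)) = l * (∫ y in c..d, p 2 y ^2) + (d - c) * (1/(4*l)) := by
      rw [intervalIntegral.integral_add (Continuous.intervalIntegrable (by fun_prop) _ _) (Continuous.intervalIntegrable (by fun_prop) _ _),
        intervalIntegral.integral_const_mul, intervalIntegral.integral_const, smul_eq_mul]
    have s3 : (∫ y in c..d, p 2 y ^2) ≤ B := by
      refine le_trans ?_ h2
      apply intervalIntegral.integral_mono_interval (ha0.trans hc) hcd (hd.trans ha1)
      · exact Filter.Eventually.of_forall fun y => sq_nonneg _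
      · exact Continuous.intervalIntegrable (by fun_prop) _ _
    have s4 : (d - c) * (1/(4*l)) ≤ l/4 := by
      calc (d-c) * (1/(4*l)) ≤ l^2 * (1/(4*l)) := by
            apply mul_le_mul_of_nonneg_right (by linarith) (by positivity)
        _ = l/4 := by field_simp
    nlinarith
  have e2 : |p 1 x - p 1 ξ| ≤ l * B + l/4 := by
    rcases le_total x ξ with h | h
    · rw [abs_sub_comm]; exact key x ξ hax h hξ.2.le
    · exact key ξ x hξ.1.le h hxa
  have := abs_sub_abs_le_abs_sub (p 1 x) (p 1 ξ)
  nlinarith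

/-- a classical solution with sign `σ` -/
structure Sol (σ S : ℝ) (η u ηt ut ηx ux : ℝ → ℝ → ℝ) : Prop where
  c1 : ContinuousOn (fun z : ℝ × ℝ => η z.1 z.2) (Icc 0 1 ×ˢ Icc 0 S)
  c2 : ContinuousOn (fun z : ℝ × ℝ => u z.1 z.2) (Icc 0 1 ×ˢ Icc 0 S)
  c3 : ContinuousOn (fun z : ℝ × ℝ => ηt z.1 z.2) (Icc 0 1 ×ˢ Icc 0 S)
  c4 : ContinuousOn (fun z : ℝ × ℝ => ut z.1 z.2) (Icc 0 1 ×ˢ Icc 0 S)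
  d1 : ∀ y ∈ Icc (0:ℝ) 1, ∀ s ∈ Icc 0 S, HasDerivWithinAt (η y) (ηt y s) (Icc 0 S) s
  d2 : ∀ y ∈ Icc (0:ℝ) 1, ∀ s ∈ Icc 0 S, HasDerivWithinAt (u y) (ut y s) (Icc 0 S) s
  x1 : ∀ s ∈ Icc 0 S, D01 (fun y => η y s) (fun y => ηx y s)
  x2 : ∀ s ∈ Icc 0 S, D01 (fun y => u y s) (fun y => ux y s)
  xc1 : ∀ s ∈ Icc 0 S, ContinuousOn (fun y => ηx y s) (Icc 0 1)
  xc2 : ∀ s ∈ Icc 0 S, ContinuousOn (fun y => ux y s) (Icc 0 1)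
  e1 : ∀ y ∈ Icc (0:ℝ) 1, ∀ s ∈ Icc 0 S, ηt y s = -σ * (ux y s + (1/2) * (ηx y s * u y s + η y s * ux y s))
  e2 : ∀ y ∈ Icc (0:ℝ) 1, ∀ s ∈ Icc 0 S, ut y s = -σ * (ηx y s + (3/2) * (u y s * ux y s) + (1/2) * (η y s * ηx y s))
  b : ∀ s ∈ Icc 0 S, u 0 s = 0 ∧ u 1 s = 0

/-- squared `L²` distance -/
def Ed (η u : ℝ → ℝ → ℝ) (p q : ℝ → ℕ → ℝ → ℝ) (s : ℝ) : ℝ :=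
  ∫ y in (0:ℝ)..1, ((η y s - p s 0 y)^2 + (u y s - q s 0 y)^2)

theorem compE {n : ℕ} {σ S : ℝ} (hσ : σ = 1 ∨ σ = -1) {p q pt qt : ℝ → ℕ → ℝ → ℝ} (G : GalP n σ S p q pt qt)
    {η u ηt ut ηx ux : ℝ → ℝ → ℝ} (U : Sol σ S η u ηt ut ηx ux) {M ρ s : ℝ} (hM0 : 0 ≤ M) (hρ : 0 ≤ ρ)
    (hs : s ≤ S)
    (hM : ∀ r ∈ Ioo 0 s, ∀ x ∈ Icc (0:ℝ) 1, |p r 1 x| ≤ M ∧ |q r 1 x| ≤ M)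
    (hr : ∀ r ∈ Ioo 0 s, (∫ x in (0:ℝ)..1, (pt r 0 x + σ * f1 (p r) (q r) x)^2)
      + (∫ x in (0:ℝ)..1, (qt r 0 x + σ * f2 (p r) (q r) x)^2) ≤ ρ) :
    ∀ r ∈ Icc 0 s, Ed η u p q r ≤ (Ed η u p q 0 + ρ * r) * Real.exp ((2*M+1) * r) := by
  have k1 := U.c1; have k2 := U.c2; have k3 := U.c3; have k4 := U.c4
  have j1 := (G.cp 0).continuousOn (s := Icc 0 1 ×ˢ Icc 0 S)
  have j2 := (G.cq 0).continuousOn (s := Icc 0 1 ×ˢ Icc 0 S)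
  have j3 := (G.cpt 0).continuousOn (s := Icc 0 1 ×ˢ Icc 0 S)
  have j4 := (G.cqt 0).continuousOn (s := Icc 0 1 ×ˢ Icc 0 S)
  have D := dui (f := fun y s => (η y s - p s 0 y)^2 + (u y s - q s 0 y)^2)
    (f' := fun y s => 2 * (η y s - p s 0 y) * (ηt y s - pt s 0 y) + 2 * (u y s - q s 0 y) * (ut y s - qt s 0 y))
    (S := S) (((k1.sub j1).pow 2).add ((k2.sub j2).pow 2))
    (((continuousOn_const.mul (k1.sub j1)).mul (k3.sub j3)).add ((continuousOn_const.mul (k2.sub j2)).mul (k4.sub j4))) (by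
      intro y hy r hr
      have a := ((U.d1 y hy r hr).sub (G.dp r hr 0 y)).fun_pow 2
      have b := ((U.d2 y hy r hr).sub (G.dq r hr 0 y)).fun_pow 2
      refine (a.add b).congr_deriv ?_
      simp)
  intro r hr'
  refine gron (E := Ed η u p q) (C := 2*M+1) (D := ρ) (S := s) (by positivity) hρ
    (D.1.mono (Icc_subset_Icc_right hs)) (fun t ht => D.2 t ⟨ht.1, ht.2.trans_le hs⟩) ?_ r hr'
  intro t ht
  have ht' : t ∈ Icc 0 S := ⟨ht.1.le, ht.2.le.trans hs⟩
  have x1 := U.x1 t ht'; have x2 := U.x2 t ht'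
  have xc1 := U.xc1 t ht'; have xc2 := U.xc2 t ht'
  have xx1 := x1.cont; have xx2 := x2.cont
  have y1 := (G.pj t).d01 0; have y2 := (G.qj t).d01 0
  have q0 := (G.pj t).cont 0; have q1 := (G.pj t).cont 1
  have q2 := (G.qj t).cont 0; have q3 := (G.qj t).cont 1
  have q4 := (G.ptj t).cont 0; have q5 := (G.qtj t).cont 0
  have fc1 := f1_cont (G.pj t) (G.qj t); have fc2 := f2_cont (G.pj t) (G.qj t)
  have E1 := fun y hy => U.e1 y hy t ht'
  have E2 := fun y hy => U.e2 y hy t ht'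
  let gx : ℝ → ℝ := fun y => ((ux y t + (1/2) * (ηx y t * u y t + η y t * ux y t)) - f1 (p t) (q t) y) * (η y t - p t 0 y)
    + ((ηx y t + (3/2) * (u y t * ux y t) + (1/2) * (η y t * ηx y t)) - f2 (p t) (q t) y) * (u y t - q t 0 y)
    - ((1/2) * (p t 1 y * ((η y t - p t 0 y) * (u y t - q t 0 y))) + (1/4) * (q t 1 y * (η y t - p t 0 y)^2)
      + (3/4) * (q t 1 y * (u y t - q t 0 y)^2))
  have a := x1.sub y1
  have b := x2.sub y2
  have dg := ((((((a.mul b).add ((y1.mul (a.mul b)).const_mul (1/2))).add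
    ((y2.mul (a.mul a)).const_mul (1/4))).add ((y2.mul (b.mul b)).const_mul (3/4))).add
    ((b.mul (a.mul a)).const_mul (1/2))).add ((b.mul (b.mul b)).const_mul (1/2)))
  have dg' := fun y hy => (dg y hy).congr_deriv (g' := gx y) (by
    simp only [gx, f1, f2, zero_add]; ring)
  have cgx : ContinuousOn gx (Icc 0 1) := by simp only [gx]; fun_prop
  have ig := D01.ftc dg' cgx
  have bu := U.b t ht'
  have bq := G.qv t 0 (by decide)
  simp only [bu.1, bu.2, bq.1, bq.2, sub_zero, mul_zero, zero_mul, add_zero] at ig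
  have hh := hr t ht
  rw [← intervalIntegral.integral_add (ii01 (by fun_prop)) (ii01 (by fun_prop))] at hh
  have kt3 : ContinuousOn (fun y => ηt y t) (Icc 0 1) := k3.comp (f := fun y => (y, t)) (by fun_prop) (fun y hy => ⟨hy, ht'⟩)
  have kt4 : ContinuousOn (fun y => ut y t) (Icc 0 1) := k4.comp (f := fun y => (y, t)) (by fun_prop) (fun y hy => ⟨hy, ht'⟩)
  have key : ∫ y in (0:ℝ)..1, (2 * (η y t - p t 0 y) * (ηt y t - pt t 0 y) + 2 * (u y t - q t 0 y) * (ut y t - qt t 0 y))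
     ≤ ∫ y in (0:ℝ)..1, ((-2 * σ * gx y + (2*M+1) * ((η y t - p t 0 y)^2 + (u y t - q t 0 y)^2))
        + ((pt t 0 y + σ * f1 (p t) (q t) y)^2 + (qt t 0 y + σ * f2 (p t) (q t) y)^2)) := by
    refine int01_mono (by fun_prop) (by fun_prop) fun y hy => ?_
    rw [E1 y hy, E2 y hy]
    simp only [gx]
    have m1 := abs_le.1 (hM t ht y hy).1
    have m2 := abs_le.1 (hM t ht y hy).2
    generalize hr1 : pt t 0 y + σ * f1 (p t) (q t) y = r1
    generalize hr2 : qt t 0 y + σ * f2 (p t) (q t) y = r2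
    rw [show pt t 0 y = r1 - σ * f1 (p t) (q t) y by rw [← hr1]; ring,
      show qt t 0 y = r2 - σ * f2 (p t) (q t) y by rw [← hr2]; ring]
    generalize f1 (p t) (q t) y = F1; generalize f2 (p t) (q t) y = F2
    generalize η y t - p t 0 y = a; generalize u y t - q t 0 y = b
    have ys1 : -(2 * a * r1) ≤ a^2 + r1^2 := by nlinarith [sq_nonneg (a + r1)]
    have ys2 : -(2 * b * r2) ≤ b^2 + r2^2 := by nlinarith [sq_nonneg (b + r2)]
    have t1 := abs_le.1 (ab_le (hM t ht y hy).1 a b)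
    have t2 := abs_le.1 (ab_le (hM t ht y hy).2 a a)
    have t3 := abs_le.1 (ab_le (hM t ht y hy).2 b b)
    have n1 := mul_nonneg hM0 (sq_nonneg a)
    have n2 := mul_nonneg hM0 (sq_nonneg b)
    rcases hσ with e | e <;> subst e <;> nlinarith
  unfold Ed
  refine key.trans ?_
  rw [intervalIntegral.integral_add (ii01 (by fun_prop)) (ii01 (by fun_prop)),
    intervalIntegral.integral_add (ii01 (by fun_prop)) (ii01 (by fun_prop)),
    intervalIntegral.integral_const_mul, intervalIntegral.integral_const_mul, ig]
  linarith

/-- pointwise closeness -/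
theorem supE {f f' g g' : ℝ → ℝ} (hf : D01 f f') (hf' : ContinuousOn f' (Icc 0 1))
    (hg : D01 g g') (hg' : ContinuousOn g' (Icc 0 1)) {M E κ : ℝ} (hκ : 0 < κ)
    (hE : ∫ y in (0:ℝ)..1, (f y - g y)^2 ≤ E) (h1 : ∀ y ∈ Icc (0:ℝ) 1, |f' y| ≤ M)
    (h2 : ∀ y ∈ Icc (0:ℝ) 1, |g' y| ≤ M) : ∀ y ∈ Icc (0:ℝ) 1, (f y - g y)^2 ≤ (1 + 1/κ) * E + κ * (4 * M^2) := by
  intro y hy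
  have a := (hf.sub hg).sob (by fun_prop) hκ hy
  have b : ∫ y in (0:ℝ)..1, (f' y - g' y)^2 ≤ ∫ y in (0:ℝ)..1, (4 * M^2) := by
    refine int01_mono (by fun_prop) (by fun_prop) fun z hz => ?_
    have u1 := abs_le.1 (h1 z hz); have u2 := abs_le.1 (h2 z hz)
    nlinarith
  simp only [intervalIntegral.integral_const, sub_zero, one_smul] at b
  have c1 : (1 + 1/κ) * (∫ y in (0:ℝ)..1, (f y - g y)^2) ≤ (1 + 1/κ) * E :=
    mul_le_mul_of_nonneg_left hE (by positivity)
  have c2 := mul_le_mul_of_nonneg_left b hκ.le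
  linarith

/-- a Lipschitz bound controls the derivative -/
theorem D01.bound {f f' : ℝ → ℝ} (hf : D01 f f') {M : ℝ}
    (h : ∀ x ∈ Icc (0:ℝ) 1, ∀ y ∈ Icc (0:ℝ) 1, |f x - f y| ≤ M * |x - y|) : ∀ x ∈ Icc (0:ℝ) 1, |f' x| ≤ M := by
  intro x hx
  have t := hasDerivWithinAt_iff_tendsto_slope.1 (hf x hx)
  have : (nhdsWithin x (Icc (0:ℝ) 1 \ {x})).NeBot := by
    have := (uniqueDiffOn_Icc (zero_lt_one' ℝ)) x hx
    rw [uniqueDiffWithinAt_iff_accPt] at this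
    rw [accPt_principal_iff_nhdsWithin] at this
    exact this
  refine le_of_tendsto t.abs ?_
  filter_upwards [self_mem_nhdsWithin] with y hy
  rw [slope_def_field, abs_div, div_le_iff₀ (abs_pos.2 (sub_ne_zero.2 hy.2))]
  exact h y hy.1 x hx

theorem bessel0 {𝓔 : ℕ → ℕ → ℝ → ℝ} {μ : ℕ → ℝ} {e : ℕ} (F : Fam 𝓔 μ e) (n : ℕ)
    {g : ℝ → ℝ} (hg : ContinuousOn g (Icc 0 1)) :
    ∫ x in (0:ℝ)..1, (jsum n (fun k => ∫ x in (0:ℝ)..1, g x * 𝓔 k 0 x) 𝓔 0 x)^2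
      ≤ ∫ x in (0:ℝ)..1, g x ^ 2 := by
  have a := F.dist n (fun k => ∫ x in (0:ℝ)..1, g x * 𝓔 k 0 x) hg
  have b : 0 ≤ ∫ x in (0:ℝ)..1, (g x - jsum n (fun k => ∫ x in (0:ℝ)..1, g x * 𝓔 k 0 x) 𝓔 0 x)^2 :=
    int01_nonneg fun x _ => sq_nonneg _
  rw [F.energy]
  simp only [mul_zero, pow_zero, one_mul]
  simp only [sub_self, ne_eq, OfNat.ofNat_ne_zero, not_false_eq_true, zero_pow, Finset.sum_const_zero, add_zero] at a
  linarith

theorem supSmall {M Q ε : ℝ} (hε : 0 < ε) : ∃ κ > 0, ∃ n0 : ℕ, ∀ n : ℕ, n0 ≤ n → 1 ≤ n → ∀ E : ℝ,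
    (n:ℝ)^2 * E ≤ Q → (1 + 1/κ) * E + κ * (4 * M^2) ≤ ε^2 := by
  let κ : ℝ := ε^2 / (8 * M^2 + 8)
  have hκ : 0 < κ := by positivity
  have k1 : κ * (4 * M^2) ≤ ε^2/2 := by
    simp only [κ]; rw [div_mul_eq_mul_div, div_le_div_iff₀ (by positivity) (by norm_num)]
    nlinarith [sq_nonneg (ε*M), sq_nonneg ε]
  have hp : 0 < 1 + 1/κ := by positivity
  obtain ⟨n0, hn0⟩ := exists_nat_ge (2 * ((1 + 1/κ) * |Q|) / ε^2)
  refine ⟨κ, hκ, n0, fun n hn h1 E hE => ?_⟩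
  have hn' : (n0:ℝ) ≤ n := by exact_mod_cast hn
  have h1' : (1:ℝ) ≤ n := by exact_mod_cast h1
  have e1 : 2 * ((1 + 1/κ) * |Q|) ≤ (n:ℝ)^2 * ε^2 := by
    have : 2 * ((1 + 1/κ) * |Q|) / ε^2 ≤ (n:ℝ)^2 := by nlinarith
    rwa [div_le_iff₀ (by positivity)] at this
  have e2 : (n:ℝ)^2 * ((1 + 1/κ) * E) ≤ (n:ℝ)^2 * (ε^2/2) := by
    have := mul_le_mul_of_nonneg_left (hE.trans (le_abs_self Q)) hp.le
    nlinarith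
  have := le_of_mul_le_mul_left e2 (by positivity)
  linarith

theorem IsJet.lip {p : ℕ → ℝ → ℝ} (hp : IsJet p) (k : ℕ) {M : ℝ} (h : ∀ x ∈ Icc (0:ℝ) 1, |p (k+1) x| ≤ M) :
    ∀ x ∈ Icc (0:ℝ) 1, ∀ y ∈ Icc (0:ℝ) 1, |p k x - p k y| ≤ M * |x - y| := by
  intro x hx y hy
  have := (convex_Icc (0:ℝ) 1).norm_image_sub_le_of_norm_hasDerivWithin_le (f := p k) (f' := p (k+1)) (C := M)
    (fun z hz => hp.d01 k z hz) (fun z hz => h z hz) hy hx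
  simpa using this

theorem convE {B Z A S : ℝ} (hB : 0 ≤ B) (hZ : 0 ≤ Z) (hA : 0 ≤ A) (hS : 0 ≤ S) : ∃ Q, ∀ (n : ℕ) (σ : ℝ)
    (p q pt qt : ℝ → ℕ → ℝ → ℝ) (η u ηt ut ηx ux : ℝ → ℝ → ℝ) (s : ℝ), 1 ≤ n → (σ = 1 ∨ σ = -1) →
    GalP n σ S p q pt qt → Sol σ S η u ηt ut ηx ux → Yj (p 0) (q 0) 0 ≤ Z →
    (n:ℝ)^2 * Ed η u p q 0 ≤ A → s ≤ S → (∀ r ∈ Ioo 0 s, Yj (p r) (q r) 2 ≤ B) →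
    ∀ r ∈ Icc 0 s, (n:ℝ)^2 * Ed η u p q r ≤ Q := by
  set M := Real.sqrt (3 * B) with hM
  set K := Real.sqrt (2 * Z + 3 * B) with hK
  set R := 2 * (20 * (1 + K^2) * B + 20 * K^4) with hR
  have M2 : M^2 = 3 * B := Real.sq_sqrt (by positivity)
  have K2 : K^2 = 2 * Z + 3 * B := Real.sq_sqrt (by positivity)
  have M0 : 0 ≤ M := Real.sqrt_nonneg _
  have K0 : 0 ≤ K := Real.sqrt_nonneg _
  have R0 : 0 ≤ R := by rw [hR]; positivity
  refine ⟨(A + R * S) * Real.exp ((2*M+1) * S), ?_⟩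
  intro n σ p q pt qt η u ηt ut ηx ux s hn hσ G U h0 hE hs hY r hr
  have hn' : (0:ℝ) < (n:ℝ)^2 := by have : 0 < n := hn; positivity
  have hm1 : ∀ t, Yj (p t) (q t) 1 ≤ Yj (p t) (q t) 2 := fun t => G.mono t 1 le_rfl
  have b1 : ∀ t ∈ Ioo 0 s, ∀ x ∈ Icc (0:ℝ) 1, p t 1 x ^2 ≤ 3 * B ∧ q t 1 x ^ 2 ≤ 3 * B := by
    intro t ht x hx
    have := supY (G.pj t) (G.qj t) 1 hx
    have := hm1 t; have := hY t ht
    norm_num at *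
    constructor <;> linarith
  have b0 : ∀ t ∈ Ioo 0 s, ∀ x ∈ Icc (0:ℝ) 1, p t 0 x ^2 ≤ 2 * Z + 3 * B ∧ q t 0 x ^ 2 ≤ 2 * Z + 3 * B := by
    intro t ht x hx
    have := supY (G.pj t) (G.qj t) 0 hx
    have := hm1 t; have := hY t ht
    have := gY0 hσ G t ⟨ht.1.le, ht.2.le.trans hs⟩
    norm_num at *
    constructor <;> linarith
  have c := compE hσ G U (M := M) (ρ := R / (n:ℝ)^2) (s := s) M0 (by positivity) hs
    (fun t ht x hx => by
      have := b1 t ht x hx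
      rw [← M2] at this
      exact ⟨abs_le_of_sq M0 this.1, abs_le_of_sq M0 this.2⟩)
    (fun t ht => by
      have ht' : t ∈ Icc 0 S := ⟨ht.1.le, ht.2.le.trans hs⟩
      have f := flux2 (G.pj t) (G.qj t) (K := K) (fun k hk x hx => by
        have h1 := b1 t ht x hx
        have h0 := b0 t ht x hx
        rw [← K2] at h0
        interval_cases k
        · exact ⟨abs_le_of_sq K0 h0.1, abs_le_of_sq K0 h0.2⟩
        · exact ⟨abs_le_of_sq K0 (by linarith [h1.1]), abs_le_of_sq K0 (by linarith [h1.2])⟩)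
      have r1 := G.r1 t ht'
      have r2 := G.r2 t ht'
      have y := mul_le_mul_of_nonneg_left (hY t ht) (show 0 ≤ 20 * (1 + K^2) by positivity)
      rw [le_div_iff₀ hn', add_mul, mul_comm, add_comm, mul_comm]
      rw [hR]
      linarith [f.1, f.2]) r hr
  have hr0 := hr.1
  have hrS : r ≤ S := hr.2.trans hs
  calc (n:ℝ)^2 * Ed η u p q r ≤ (n:ℝ)^2 * ((Ed η u p q 0 + R / (n:ℝ)^2 * r) * Real.exp ((2*M+1) * r)) :=
        mul_le_mul_of_nonneg_left c hn'.le
    _ = ((n:ℝ)^2 * Ed η u p q 0 + R * r) * Real.exp ((2*M+1) * r) := by field_simp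
    _ ≤ (A + R * S) * Real.exp ((2*M+1) * S) := by
        have e1 : Real.exp ((2*M+1) * r) ≤ Real.exp ((2*M+1) * S) :=
          Real.exp_le_exp.2 (mul_le_mul_of_nonneg_left hrS (by positivity))
        have e2 : (n:ℝ)^2 * Ed η u p q 0 + R * r ≤ A + R * S :=
          add_le_add hE (mul_le_mul_of_nonneg_left hrS R0)
        exact mul_le_mul e2 e1 (Real.exp_pos _).le (by positivity)

/-- start the Galerkin path at the projected initial data -/
theorem galInit (n : ℕ) {σ S : ℝ} (hσ : σ = 1 ∨ σ = -1) (hS : 0 ≤ S)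
    {η u ηt ut ηx ux : ℝ → ℝ → ℝ} (U : Sol σ S η u ηt ut ηx ux) {g2 k2 : ℝ → ℝ}
    (hg : D01 (fun y => ηx y 0) g2) (cg : ContinuousOn g2 (Icc 0 1))
    (hk : D01 (fun y => ux y 0) k2) (ck : ContinuousOn k2 (Icc 0 1))
    (hb : ηx 0 0 = 0 ∧ ηx 1 0 = 0) :
    ∃ p q pt qt : ℝ → ℕ → ℝ → ℝ, GalP n σ S p q pt qt ∧
      Yj (p 0) (q 0) 0 ≤ (∫ y in (0:ℝ)..1, η y 0 ^ 2) + (∫ y in (0:ℝ)..1, u y 0 ^ 2) ∧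
      Yj (p 0) (q 0) 2 ≤ (∫ y in (0:ℝ)..1, g2 y ^ 2) + (∫ y in (0:ℝ)..1, k2 y ^ 2) ∧
      (n:ℝ)^2 * Ed η u p q 0 ≤ (∫ y in (0:ℝ)..1, ηx y 0 ^ 2) + (∫ y in (0:ℝ)..1, ux y 0 ^ 2) ∧
      p 0 = jsum n (fun k => ∫ x in (0:ℝ)..1, η x 0 * ec k 0 x) ec ∧
      q 0 = jsum n (fun k => ∫ x in (0:ℝ)..1, u x 0 * es k 0 x) es := by
  obtain ⟨p, q, pt, qt, G, hp, hq⟩ := galP n hσ (fun k => ∫ x in (0:ℝ)..1, η x 0 * ec k 0 x)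
    (fun k => ∫ x in (0:ℝ)..1, u x 0 * es k 0 x) hS
  have z : (0:ℝ) ∈ Icc 0 S := ⟨le_rfl, hS⟩
  have x1 := U.x1 0 z; have x2 := U.x2 0 z
  have c1 := x1.cont; have c2 := x2.cont
  have q1 := (G.pj 0).cont 0; have q2 := (G.qj 0).cont 0
  refine ⟨p, q, pt, qt, G, ?_, ?_, ?_, hp, hq⟩
  · rw [Yj_split (G.pj 0) (G.qj 0), hp, hq]
    exact add_le_add (bessel0 famC n c1) (bessel0 famS n c2)
  · rw [Yj_split (G.pj 0) (G.qj 0), hp, hq]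
    exact add_le_add (famC.bessel2 n x1 hg cg (Or.inl ⟨rfl, hb.1, hb.2⟩))
      (famS.bessel2 n x2 hk ck (Or.inr ⟨rfl, (U.b 0 z).1, (U.b 0 z).2⟩))
  · unfold Ed
    rw [intervalIntegral.integral_add (ii01 (by fun_prop)) (ii01 (by fun_prop)), mul_add, hp, hq]
    exact add_le_add (famC.approx n x1 (U.xc1 0 z) (Or.inl rfl))
      (famS.approx n x2 (U.xc2 0 z) (Or.inr (U.b 0 z)))

theorem Ed_split {n : ℕ} {σ S : ℝ} {p q pt qt : ℝ → ℕ → ℝ → ℝ} (G : GalP n σ S p q pt qt)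
    {η u ηt ut ηx ux : ℝ → ℝ → ℝ} (U : Sol σ S η u ηt ut ηx ux) {s : ℝ} (hs : s ∈ Icc 0 S) :
    ∫ y in (0:ℝ)..1, (η y s - p s 0 y)^2 ≤ Ed η u p q s ∧ ∫ y in (0:ℝ)..1, (u y s - q s 0 y)^2 ≤ Ed η u p q s := by
  have c1 := (U.x1 s hs).cont; have c2 := (U.x2 s hs).cont
  have q1 := (G.pj s).cont 0; have q2 := (G.qj s).cont 0
  constructor
  · exact int01_mono (by fun_prop) (by fun_prop) fun x _ => by nlinarith [sq_nonneg (u x s - q s 0 x)]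
  · exact int01_mono (by fun_prop) (by fun_prop) fun x _ => by nlinarith [sq_nonneg (η x s - p s 0 x)]

/-- approximate Lipschitz transfer -/
theorem lipTrans {f g : ℝ → ℝ} {M ε : ℝ} (hg : ∀ x ∈ Icc (0:ℝ) 1, ∀ y ∈ Icc (0:ℝ) 1, |g x - g y| ≤ M * |x - y|)
    (h : ∀ x ∈ Icc (0:ℝ) 1, |f x - g x| ≤ ε) :
    ∀ x ∈ Icc (0:ℝ) 1, ∀ y ∈ Icc (0:ℝ) 1, |f x - f y| ≤ M * |x - y| + 2 * ε := by
  intro x hx y hy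
  have a := abs_le.1 (hg x hx y hy); have b := abs_le.1 (h x hx); have c := abs_le.1 (h y hy)
  rw [abs_le]; constructor <;> linarith

theorem stage1 {σ S : ℝ} (hσ : σ = 1 ∨ σ = -1) (hS : 0 ≤ S)
    {η u ηt ut ηx ux : ℝ → ℝ → ℝ} (U : Sol σ S η u ηt ut ηx ux) {g2 k2 : ℝ → ℝ}
    (hg : D01 (fun y => ηx y 0) g2) (cg : ContinuousOn g2 (Icc 0 1))
    (hk : D01 (fun y => ux y 0) k2) (ck : ContinuousOn k2 (Icc 0 1))
    (hb : ηx 0 0 = 0 ∧ ηx 1 0 = 0) :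
    ∃ δ > 0, ∃ M, ∀ s ∈ Icc 0 S, s ≤ δ → ∀ y ∈ Icc (0:ℝ) 1, |ηx y s| ≤ M ∧ |ux y s| ≤ M := by
  have pos : ∀ f : ℝ → ℝ, 0 ≤ ∫ y in (0:ℝ)..1, f y ^ 2 := fun f => int01_nonneg fun x _ => sq_nonneg _
  set Z0 := (∫ y in (0:ℝ)..1, g2 y ^ 2) + (∫ y in (0:ℝ)..1, k2 y ^ 2)
  have Z0p : 0 ≤ Z0 := add_nonneg (pos _) (pos _)
  set B := 4 * (Z0 + 1) with hB
  set M := Real.sqrt (3 * B) with hM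
  have B0 : 0 ≤ B := by positivity
  have M2 : M^2 = 3 * B := Real.sq_sqrt (by positivity)
  have M0 : 0 ≤ M := Real.sqrt_nonneg _
  obtain ⟨Q, hQ⟩ := convE (B := B) (Z := (∫ y in (0:ℝ)..1, η y 0 ^ 2) + (∫ y in (0:ℝ)..1, u y 0 ^ 2))
    (A := (∫ y in (0:ℝ)..1, ηx y 0 ^ 2) + (∫ y in (0:ℝ)..1, ux y 0 ^ 2)) B0 (add_nonneg (pos _) (pos _))
    (add_nonneg (pos (fun y => ηx y 0)) (pos (fun y => ux y 0))) hS
  have hl2 : 0 < Real.log 2 := Real.log_pos (by norm_num)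
  refine ⟨Real.log 2 / (20 * (M+1)), by positivity, M, ?_⟩
  intro s hs hsd
  have hexp : ∀ r, 0 ≤ r → r ≤ s → Real.exp (20 * M * r) ≤ 2 := by
    intro r hr hrs
    rw [le_div_iff₀ (by positivity)] at hsd
    calc Real.exp (20 * M * r) ≤ Real.exp (Real.log 2) := by
          apply Real.exp_le_exp.2
          nlinarith [mul_le_mul_of_nonneg_left hrs M0]
      _ = 2 := Real.exp_log (by norm_num)
  -- the key family
  have main : ∀ n : ℕ, 1 ≤ n → ∃ p q pt qt : ℝ → ℕ → ℝ → ℝ, GalP n σ S p q pt qt ∧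
      (n:ℝ)^2 * Ed η u p q s ≤ Q ∧ ∀ x ∈ Icc (0:ℝ) 1, |p s 1 x| ≤ M ∧ |q s 1 x| ≤ M := by
    intro n hn
    obtain ⟨p, q, pt, qt, G, y0, y2, e0, -, -⟩ := galInit n hσ hS U hg cg hk ck hb
    have bd : ∀ r, Yj (p r) (q r) 2 ≤ B → ∀ x ∈ Icc (0:ℝ) 1, |p r 1 x| ≤ M ∧ |q r 1 x| ≤ M := by
      intro r hr x hx
      have a := supY (G.pj r) (G.qj r) 1 hx
      have b := G.mono r 1 le_rfl
      norm_num at a b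
      exact ⟨abs_le_of_sq M0 (by linarith [a.1]), abs_le_of_sq M0 (by linarith [a.2])⟩
    have bt := boot (Y := fun r => Yj (p r) (q r) 2) (S := s) (B := B) ((G.eC 2).mono (Icc_subset_Icc_right hs.2)) (by
      intro r hr hlt
      have := gY2 hσ G M0 (hr.2.trans hs.2) (fun t ht => bd t (hlt t ht.1.le ht.2)) r ⟨hr.1, le_rfl⟩
      have e := hexp r hr.1 hr.2
      have n2 := Yj_nonneg (p 0) (q 0) 2
      have := mul_le_mul_of_nonneg_left e n2
      linarith)
    refine ⟨p, q, pt, qt, G, ?_, bd s (bt s ⟨hs.1, le_rfl⟩)⟩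
    exact hQ n σ p q pt qt η u ηt ut ηx ux s hn hσ G U y0 e0 hs.2
      (fun r hr => bt r (Ioo_subset_Icc_self hr)) s ⟨hs.1, le_rfl⟩
  obtain ⟨m1, hm1⟩ := isCompact_Icc.exists_bound_of_continuousOn (U.xc1 s hs)
  obtain ⟨m2, hm2⟩ := isCompact_Icc.exists_bound_of_continuousOn (U.xc2 s hs)
  set M1 := max M (max m1 m2)
  have lip : (∀ x ∈ Icc (0:ℝ) 1, ∀ y ∈ Icc (0:ℝ) 1, |η x s - η y s| ≤ M * |x - y|) ∧
      ∀ x ∈ Icc (0:ℝ) 1, ∀ y ∈ Icc (0:ℝ) 1, |u x s - u y s| ≤ M * |x - y| := by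
    have : ∀ ε > 0, (∀ x ∈ Icc (0:ℝ) 1, ∀ y ∈ Icc (0:ℝ) 1, |η x s - η y s| ≤ M * |x - y| + 2 * ε) ∧
      ∀ x ∈ Icc (0:ℝ) 1, ∀ y ∈ Icc (0:ℝ) 1, |u x s - u y s| ≤ M * |x - y| + 2 * ε := by
      intro ε hε
      obtain ⟨κ, hκ, n0, hn0⟩ := supSmall (M := M1) (Q := Q) hε
      obtain ⟨p, q, pt, qt, G, hE, hb⟩ := main (n0+1) (by omega)
      have hsm := hn0 (n0+1) (by omega) (by omega) _ hE
      have es := Ed_split G U hs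
      have s1 := supE (U.x1 s hs) (U.xc1 s hs) ((G.pj s).d01 0) ((G.pj s).cont _).continuousOn (M := M1) hκ es.1
        (fun y hy => (hm1 y hy).trans ((le_max_left _ _).trans (le_max_right _ _)))
        (fun y hy => (hb y hy).1.trans (le_max_left _ _))
      have s2 := supE (U.x2 s hs) (U.xc2 s hs) ((G.qj s).d01 0) ((G.qj s).cont _).continuousOn (M := M1) hκ es.2
        (fun y hy => (hm2 y hy).trans ((le_max_right _ _).trans (le_max_right _ _)))
        (fun y hy => (hb y hy).2.trans (le_max_left _ _))
      exact ⟨lipTrans ((G.pj s).lip 0 fun x hx => (hb x hx).1) fun x hx => abs_le_of_sq hε.le ((s1 x hx).trans hsm),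
        lipTrans ((G.qj s).lip 0 fun x hx => (hb x hx).2) fun x hx => abs_le_of_sq hε.le ((s2 x hx).trans hsm)⟩
    constructor
    · intro x hx y hy
      refine le_of_forall_pos_le_add fun ε hε => ?_
      have := (this (ε/2) (by positivity)).1 x hx y hy
      linarith
    · intro x hx y hy
      refine le_of_forall_pos_le_add fun ε hε => ?_
      have := (this (ε/2) (by positivity)).2 x hx y hy
      linarith
  exact fun y hy => ⟨(U.x1 s hs).bound lip.1 y hy, (U.x2 s hs).bound lip.2 y hy⟩

theorem Sol.shift {T : ℝ} {η u ηt ut ηx ux : ℝ → ℝ → ℝ} (U : Sol 1 T η u ηt ut ηx ux) {σ S t0 : ℝ}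
    (hm : ∀ s ∈ Icc 0 S, t0 + σ * s ∈ Icc 0 T) :
    Sol σ S (fun y s => η y (t0 + σ * s)) (fun y s => u y (t0 + σ * s)) (fun y s => σ * ηt y (t0 + σ * s))
      (fun y s => σ * ut y (t0 + σ * s)) (fun y s => ηx y (t0 + σ * s)) (fun y s => ux y (t0 + σ * s)) := by
  have hc : Continuous (fun z : ℝ × ℝ => (z.1, t0 + σ * z.2)) := by fun_prop
  have hmap : MapsTo (fun z : ℝ × ℝ => (z.1, t0 + σ * z.2)) (Icc 0 1 ×ˢ Icc 0 S) (Icc 0 1 ×ˢ Icc 0 T) :=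
    fun z hz => ⟨hz.1, hm _ hz.2⟩
  have hd : ∀ s, HasDerivWithinAt (fun s : ℝ => t0 + σ * s) σ (Icc 0 S) s := fun s => by
    simpa using (((hasDerivAt_id s).const_mul σ).const_add t0).hasDerivWithinAt (s := Icc 0 S)
  have hmap' : MapsTo (fun s : ℝ => t0 + σ * s) (Icc 0 S) (Icc 0 T) := hm
  refine ⟨U.c1.comp hc.continuousOn hmap, U.c2.comp hc.continuousOn hmap,
    continuousOn_const.mul (U.c3.comp hc.continuousOn hmap), continuousOn_const.mul (U.c4.comp hc.continuousOn hmap),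
    ?_, ?_, fun s hs => U.x1 _ (hm s hs), fun s hs => U.x2 _ (hm s hs), fun s hs => U.xc1 _ (hm s hs),
    fun s hs => U.xc2 _ (hm s hs), ?_, ?_, fun s hs => U.b _ (hm s hs)⟩
  · intro y hy s hs
    have := (U.d1 y hy _ (hm s hs)).comp s (hd s) hmap'
    rw [mul_comm] at this; exact this
  · intro y hy s hs
    have := (U.d2 y hy _ (hm s hs)).comp s (hd s) hmap'
    rw [mul_comm] at this; exact this
  · intro y hy s hs
    have := U.e1 y hy _ (hm s hs)
    simp only [this]; ring
  · intro y hy s hs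
    have := U.e2 y hy _ (hm s hs)
    simp only [this]; ring

theorem unifM {T : ℝ} {η u ηt ut ηx ux : ℝ → ℝ → ℝ} (U : Sol 1 T η u ηt ut ηx ux)
    (hg : ∀ s ∈ Icc 0 T, ∃ g2, D01 (fun y => ηx y s) g2 ∧ ContinuousOn g2 (Icc 0 1))
    (hk : ∀ s ∈ Icc 0 T, ∃ g2, D01 (fun y => ux y s) g2 ∧ ContinuousOn g2 (Icc 0 1))
    (hb : ∀ s ∈ Icc 0 T, ηx 0 s = 0 ∧ ηx 1 s = 0) :
    ∃ M, ∀ s ∈ Icc 0 T, ∀ y ∈ Icc (0:ℝ) 1, |ηx y s| ≤ M ∧ |ux y s| ≤ M := by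
  refine (isCompact_Icc (a := (0:ℝ)) (b := T)).induction_on
    (p := fun K => ∃ M, ∀ s ∈ K, ∀ y ∈ Icc (0:ℝ) 1, |ηx y s| ≤ M ∧ |ux y s| ≤ M) ⟨0, by simp⟩ ?_ ?_ ?_
  · rintro s t hst ⟨M, hM⟩
    exact ⟨M, fun r hr => hM r (hst hr)⟩
  · rintro s t ⟨M, hM⟩ ⟨M', hM'⟩
    refine ⟨max M M', fun r hr y hy => ?_⟩
    rcases hr with hr | hr
    · exact ⟨(hM r hr y hy).1.trans (le_max_left _ _), (hM r hr y hy).2.trans (le_max_left _ _)⟩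
    · exact ⟨(hM' r hr y hy).1.trans (le_max_right _ _), (hM' r hr y hy).2.trans (le_max_right _ _)⟩
  · intro t0 ht0
    obtain ⟨g2, hg1, cg⟩ := hg t0 ht0
    obtain ⟨k2, hk1, ck⟩ := hk t0 ht0
    have hm1 : ∀ s ∈ Icc 0 (T - t0), t0 + 1 * s ∈ Icc 0 T := fun s hs =>
      ⟨by linarith [hs.1, ht0.1], by linarith [hs.2]⟩
    have hm2 : ∀ s ∈ Icc 0 t0, t0 + (-1) * s ∈ Icc 0 T := fun s hs =>
      ⟨by linarith [hs.2, ht0.1], by linarith [hs.1, ht0.2]⟩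
    obtain ⟨δ, hδ, M, hM⟩ := stage1 (Or.inl rfl) (by linarith [ht0.2]) (U.shift hm1) (g2 := g2) (k2 := k2)
      (by simpa using hg1) cg (by simpa using hk1) ck (by simpa using hb t0 ht0)
    obtain ⟨δ', hδ', M', hM'⟩ := stage1 (Or.inr rfl) (by linarith [ht0.1]) (U.shift hm2) (g2 := g2) (k2 := k2)
      (by simpa using hg1) cg (by simpa using hk1) ck (by simpa using hb t0 ht0)
    refine ⟨Icc (t0 - min δ δ') (t0 + min δ δ') ∩ Icc 0 T, ?_, max M M', ?_⟩
    · exact Filter.inter_mem (mem_nhdsWithin_of_mem_nhds (Icc_mem_nhds (by simp [hδ, hδ']) (by simp [hδ, hδ']))) self_mem_nhdsWithin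
    · rintro s ⟨hs, hs'⟩ y hy
      rcases le_total t0 s with h | h
      · have := hM (s - t0) ⟨by linarith, by linarith [hs'.2]⟩ (by linarith [hs.2, min_le_left δ δ']) y hy
        simp only [one_mul, add_sub_cancel] at this
        exact ⟨this.1.trans (le_max_left _ _), this.2.trans (le_max_left _ _)⟩
      · have := hM' (t0 - s) ⟨by linarith, by linarith [hs'.1]⟩ (by linarith [hs.1, min_le_right δ δ']) y hy
        have e : t0 + -1 * (t0 - s) = s := by ring
        simp only [e] at this
        exact ⟨this.1.trans (le_max_right _ _), this.2.trans (le_max_right _ _)⟩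

/-- the smooth approximants handed to the finite element part -/
structure Appr (T K ε : ℝ) (η u : ℝ → ℝ → ℝ) (p q pt qt : ℝ → ℕ → ℝ → ℝ) : Prop where
  pj : ∀ s, IsJet (p s)
  qj : ∀ s, IsJet (q s)
  ptj : ∀ s, IsJet (pt s)
  qtj : ∀ s, IsJet (qt s)
  qv : ∀ s, Van 1 (q s)
  qtv : ∀ s, Van 1 (qt s)
  dp : ∀ s ∈ Icc 0 T, ∀ k x, HasDerivWithinAt (fun s => p s k x) (pt s k x) (Icc 0 T) s
  dq : ∀ s ∈ Icc 0 T, ∀ k x, HasDerivWithinAt (fun s => q s k x) (qt s k x) (Icc 0 T) s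
  bd : ∀ s ∈ Icc 0 T, ∀ k ≤ 3, ∀ x ∈ Icc (0:ℝ) 1, |p s k x| ≤ K ∧ |q s k x| ≤ K
  y4 : ∀ s ∈ Icc 0 T, ∫ x in (0:ℝ)..1, (p s 4 x ^ 2 + q s 4 x ^ 2) ≤ K
  p3 : ∀ s ∈ Icc 0 T, ∫ x in (0:ℝ)..1, pt s 3 x ^ 2 ≤ K
  q3 : ∀ s ∈ Icc 0 T, ∫ x in (0:ℝ)..1, qt s 3 x ^ 2 ≤ K
  r1 : ∀ s ∈ Icc 0 T, ∫ x in (0:ℝ)..1, (pt s 0 x + f1 (p s) (q s) x)^2 ≤ ε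
  r2 : ∀ s ∈ Icc 0 T, ∫ x in (0:ℝ)..1, (qt s 0 x + f2 (p s) (q s) x)^2 ≤ ε
  cl : ∀ s ∈ Icc 0 T, ∀ x ∈ Icc (0:ℝ) 1, |η x s - p s 0 x| ≤ ε ∧ |u x s - q s 0 x| ≤ ε

set_option maxHeartbeats 2000000 in
theorem appr {T : ℝ} (hT : 0 ≤ T) {η u ηt ut ηx ux : ℝ → ℝ → ℝ} (U : Sol 1 T η u ηt ut ηx ux)
    {g2 g3 g4 k2 k3 k4 : ℝ → ℝ} {M : ℝ}
    (hM : ∀ s ∈ Icc 0 T, ∀ y ∈ Icc (0:ℝ) 1, |ηx y s| ≤ M ∧ |ux y s| ≤ M)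
    (hg2 : D01 (fun y => ηx y 0) g2) (hg3 : D01 g2 g3) (hg4 : D01 g3 g4) (cg : ContinuousOn g4 (Icc 0 1))
    (hk2 : D01 (fun y => ux y 0) k2) (hk3 : D01 k2 k3) (hk4 : D01 k3 k4) (ck : ContinuousOn k4 (Icc 0 1))
    (hb : ηx 0 0 = 0 ∧ ηx 1 0 = 0) (hb3 : g3 0 = 0 ∧ g3 1 = 0) (hb2 : k2 0 = 0 ∧ k2 1 = 0) :
    ∃ K, 1 ≤ K ∧ ∀ ε > 0, ∃ p q pt qt, Appr T K ε η u p q pt qt := by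
  have pos : ∀ f : ℝ → ℝ, 0 ≤ ∫ y in (0:ℝ)..1, f y ^ 2 := fun f => int01_nonneg fun x _ => sq_nonneg _
  have M0 : 0 ≤ M := (abs_nonneg _).trans (hM 0 ⟨le_rfl, hT⟩ 0 ⟨le_rfl, zero_le_one⟩).1
  obtain ⟨Za, Za0, hZa⟩ : ∃ Z, 0 ≤ Z ∧ (∫ y in (0:ℝ)..1, η y 0 ^ 2) + (∫ y in (0:ℝ)..1, u y 0 ^ 2) = Z := ⟨_, add_nonneg (pos _) (pos _), rfl⟩
  obtain ⟨Z2, Z20, hZ2⟩ : ∃ Z, 0 ≤ Z ∧ (∫ y in (0:ℝ)..1, g2 y ^ 2) + (∫ y in (0:ℝ)..1, k2 y ^ 2) = Z := ⟨_, add_nonneg (pos _) (pos _), rfl⟩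
  obtain ⟨Z4, Z40, hZ4⟩ : ∃ Z, 0 ≤ Z ∧ (∫ y in (0:ℝ)..1, g4 y ^ 2) + (∫ y in (0:ℝ)..1, k4 y ^ 2) = Z := ⟨_, add_nonneg (pos _) (pos _), rfl⟩
  obtain ⟨A, A0, hA⟩ : ∃ Z, 0 ≤ Z ∧ (∫ y in (0:ℝ)..1, ηx y 0 ^ 2) + (∫ y in (0:ℝ)..1, ux y 0 ^ 2) = Z :=
    ⟨_, add_nonneg (pos (fun y => ηx y 0)) (pos (fun y => ux y 0)), rfl⟩
  obtain ⟨B, hB⟩ : ∃ B, B = (Z2 + 1) * Real.exp (20 * (M+1) * T) := ⟨_, rfl⟩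
  have B0 : 0 ≤ B := by rw [hB]; positivity
  obtain ⟨B3, hB3⟩ : ∃ B3, B3 = Z4 * Real.exp (2 * (20 * ((M+1)+1) + 30 * B) * T) := ⟨_, rfl⟩
  have B30 : 0 ≤ B3 := by rw [hB3]; positivity
  obtain ⟨M2, hM2⟩ : ∃ m, m = max (M+1) (Real.sqrt (2 * B + B3)) := ⟨_, rfl⟩
  have M20 : 0 ≤ M2 := by rw [hM2]; exact le_max_of_le_left (by linarith)
  obtain ⟨B4, hB4⟩ : ∃ B4, B4 = Z4 * Real.exp (2 * (100 * M2) * T) := ⟨_, rfl⟩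
  have B40 : 0 ≤ B4 := by rw [hB4]; positivity
  obtain ⟨K0, hK0⟩ : ∃ k, k = 1 + (2 * Za + B) + (2 * B + B) + (2 * B + B3) + (2 * B3 + B4) := ⟨_, rfl⟩
  have K01 : 1 ≤ K0 := by rw [hK0]; linarith
  obtain ⟨K1, hK1⟩ : ∃ k, k = K0 + B4 + (200 * (1 + K0)^2 * B4 + 2000 * K0^4) := ⟨_, rfl⟩
  have fx0 : 0 ≤ 200 * (1 + K0)^2 * B4 + 2000 * K0^4 := by positivity
  obtain ⟨R, hR⟩ : ∃ k, k = 20 * (1 + K0^2) * B + 20 * K0^4 := ⟨_, rfl⟩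
  obtain ⟨Q, hQ⟩ := convE (B := B) (Z := Za) (A := A) B0 Za0 A0 hT
  obtain ⟨M1, hM1⟩ : ∃ m, m = max (M + 1) (Real.sqrt (3 * B)) := ⟨_, rfl⟩
  obtain ⟨l, hl⟩ : ∃ l, l = 1 / (4 * (B+1)) := ⟨_, rfl⟩
  have l0 : 0 < l := by rw [hl]; positivity
  refine ⟨K1, by rw [hK1]; linarith, fun ε hε => ?_⟩
  obtain ⟨ε', hε'⟩ : ∃ e, e = min ε (l^2/4) := ⟨_, rfl⟩
  have ε'0 : 0 < ε' := by rw [hε']; exact lt_min hε (by positivity)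
  obtain ⟨κ, hκ, n0, hn0⟩ := supSmall (M := M1) (Q := Q) ε'0
  obtain ⟨n1, hn1⟩ := exists_nat_ge (|R| / ε)
  obtain ⟨n, hn⟩ : ∃ n, n = n0 + n1 + 1 := ⟨_, rfl⟩
  obtain ⟨p, q, pt, qt, G, y0, y2, e0, hp0, hq0⟩ := galInit n (Or.inl rfl) hT U hg2 hg3.cont hk2 hk3.cont hb
  rw [hZa] at y0; rw [hZ2] at y2; rw [hA] at e0
  have z : (0:ℝ) ∈ Icc 0 T := ⟨le_rfl, hT⟩
  have hσ : (1:ℝ) = 1 ∨ (1:ℝ) = -1 := Or.inl rfl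
  have y4 : Yj (p 0) (q 0) 4 ≤ Z4 := by
    rw [Yj_split (G.pj 0) (G.qj 0), hp0, hq0, ← hZ4]
    exact add_le_add (famC.bessel4 n (U.x1 0 z) hg2 hg3 hg4 cg (Or.inl ⟨rfl, hb⟩) (Or.inl ⟨rfl, hb3⟩))
      (famS.bessel4 n (U.x2 0 z) hk2 hk3 hk4 ck (Or.inr ⟨rfl, U.b 0 z⟩) (Or.inr ⟨rfl, hb2⟩))
  have y3 : Yj (p 0) (q 0) 3 ≤ Z4 := (G.mono 0 3 (by norm_num)).trans y4
  have expm : ∀ c r : ℝ, 0 ≤ c → r ∈ Icc 0 T → Real.exp (c * r) ≤ Real.exp (c * T) := fun c r hc hr =>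
    Real.exp_le_exp.2 (mul_le_mul_of_nonneg_left hr.2 hc)
  have b1 : ∀ r, Yj (p r) (q r) 2 ≤ B → ∀ x ∈ Icc (0:ℝ) 1, |p r 1 x| ≤ M1 ∧ |q r 1 x| ≤ M1 := by
    intro r hr x hx
    have a := supY (G.pj r) (G.qj r) 1 hx
    have b := G.mono r 1 le_rfl
    norm_num at a b
    have s2 : Real.sqrt (3 * B) ^ 2 = 3 * B := Real.sq_sqrt (by positivity)
    have : Real.sqrt (3 * B) ≤ M1 := by rw [hM1]; exact le_max_right _ _
    exact ⟨(abs_le_of_sq (Real.sqrt_nonneg _) (by linarith [a.1])).trans this,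
      (abs_le_of_sq (Real.sqrt_nonneg _) (by linarith [a.2])).trans this⟩
  have clos : ∀ r ∈ Icc 0 T, (n:ℝ)^2 * Ed η u p q r ≤ Q → Yj (p r) (q r) 2 ≤ B →
      ∀ x ∈ Icc (0:ℝ) 1, |η x r - p r 0 x| ≤ ε' ∧ |u x r - q r 0 x| ≤ ε' := by
    intro r hr hE hY x hx
    have hsm := hn0 n (by omega) (by omega) _ hE
    have es := Ed_split G U hr
    have hMM : M ≤ M1 := by rw [hM1]; exact le_max_of_le_left (by linarith)
    have s1 := supE (U.x1 r hr) (U.xc1 r hr) ((G.pj r).d01 0) ((G.pj r).cont _).continuousOn (M := M1) hκ es.1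
      (fun y hy => (hM r hr y hy).1.trans hMM) (fun y hy => (b1 r hY y hy).1)
    have s2 := supE (U.x2 r hr) (U.xc2 r hr) ((G.qj r).d01 0) ((G.qj r).cont _).continuousOn (M := M1) hκ es.2
      (fun y hy => (hM r hr y hy).2.trans hMM) (fun y hy => (b1 r hY y hy).2)
    exact ⟨abs_le_of_sq ε'0.le ((s1 x hx).trans hsm), abs_le_of_sq ε'0.le ((s2 x hx).trans hsm)⟩
  have rec' : ∀ r ∈ Icc 0 T, (n:ℝ)^2 * Ed η u p q r ≤ Q → Yj (p r) (q r) 2 ≤ B →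
      ∀ x ∈ Icc (0:ℝ) 1, |p r 1 x| ≤ M + 1 ∧ |q r 1 x| ≤ M + 1 := by
    intro r hr hE hY x hx
    have c := clos r hr hE hY
    have yb := hY; rw [Yj_split (G.pj r) (G.qj r)] at yb
    have i1 := pos (p r 2); have i2 := pos (q r 2)
    have el : ε' ≤ l^2/4 := by rw [hε']; exact min_le_right _ _
    have lipη : ∀ x ∈ Icc (0:ℝ) 1, ∀ y ∈ Icc (0:ℝ) 1, |η x r - η y r| ≤ M * |x - y| := by
      intro x hx y hy
      have := (convex_Icc (0:ℝ) 1).norm_image_sub_le_of_norm_hasDerivWithin_le (f := fun y => η y r) (f' := fun y => ηx y r) (C := M)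
        (fun z hz => U.x1 r hr z hz) (fun z hz => (hM r hr z hz).1) hy hx
      simpa using this
    have lipu : ∀ x ∈ Icc (0:ℝ) 1, ∀ y ∈ Icc (0:ℝ) 1, |u x r - u y r| ≤ M * |x - y| := by
      intro x hx y hy
      have := (convex_Icc (0:ℝ) 1).norm_image_sub_le_of_norm_hasDerivWithin_le (f := fun y => u y r) (f' := fun y => ux y r) (C := M)
        (fun z hz => U.x2 r hr z hz) (fun z hz => (hM r hr z hz).2) hy hx
      simpa using this
    exact ⟨derRec (G.pj r) B0 hl el (lipTrans lipη fun x hx => by rw [abs_sub_comm]; exact (c x hx).1) (by linarith) x hx,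
      derRec (G.qj r) B0 hl el (lipTrans lipu fun x hx => by rw [abs_sub_comm]; exact (c x hx).2) (by linarith) x hx⟩
  have conv : ∀ s ∈ Icc 0 T, (∀ r ∈ Ioo 0 s, Yj (p r) (q r) 2 ≤ B) → ∀ r ∈ Icc 0 s, (n:ℝ)^2 * Ed η u p q r ≤ Q :=
    fun s hs h => hQ n 1 p q pt qt η u ηt ut ηx ux s (by omega) hσ G U y0 e0 hs.2 h
  have Y2 := boot (Y := fun r => Yj (p r) (q r) 2) (S := T) (B := B) (G.eC 2) (by
    intro s hs hlt
    have hc := conv s hs (fun r hr => hlt r hr.1.le hr.2)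
    have := gY2 hσ G (M := M+1) (by linarith) hs.2 (fun t ht => rec' t ⟨ht.1.le, ht.2.le.trans hs.2⟩
      (hc t ⟨ht.1.le, ht.2.le⟩) (hlt t ht.1.le ht.2)) s ⟨hs.1, le_rfl⟩
    have e := expm (20 * (M+1)) s (by positivity) hs
    have e' := Real.exp_pos (20 * (M+1) * T)
    have := mul_le_mul y2 e (Real.exp_pos _).le Z20
    rw [hB]
    linarith)
  have cv := conv T ⟨hT, le_rfl⟩ (fun r hr => Y2 r (Ioo_subset_Icc_self hr))
  have m1 : ∀ r ∈ Icc 0 T, ∀ x ∈ Icc (0:ℝ) 1, |p r 1 x| ≤ M + 1 ∧ |q r 1 x| ≤ M + 1 := fun r hr =>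
    rec' r hr (cv r hr) (Y2 r hr)
  have Y3 : ∀ r ∈ Icc 0 T, Yj (p r) (q r) 3 ≤ B3 := by
    intro r hr
    have := gY3 hσ G (by linarith) B0 m1 Y2 r hr
    refine this.trans ?_
    rw [hB3]
    exact mul_le_mul y3 (expm _ r (by positivity) hr) (Real.exp_pos _).le Z40
  have m2 : ∀ r ∈ Icc 0 T, ∀ x ∈ Icc (0:ℝ) 1, |p r 2 x| ≤ M2 ∧ |q r 2 x| ≤ M2 := by
    intro r hr x hx
    have a := supY (G.pj r) (G.qj r) 2 hx
    norm_num at a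
    have b := Y2 r hr; have c := Y3 r hr
    have s2 : Real.sqrt (2 * B + B3) ^ 2 = 2 * B + B3 := Real.sq_sqrt (by positivity)
    have : Real.sqrt (2 * B + B3) ≤ M2 := by rw [hM2]; exact le_max_right _ _
    exact ⟨(abs_le_of_sq (Real.sqrt_nonneg _) (by linarith [a.1])).trans this,
      (abs_le_of_sq (Real.sqrt_nonneg _) (by linarith [a.2])).trans this⟩
  have Y4 : ∀ r ∈ Icc 0 T, Yj (p r) (q r) 4 ≤ B4 := by
    intro r hr
    have hmm : M + 1 ≤ M2 := by rw [hM2]; exact le_max_left _ _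
    have := gY4 hσ G M20 (fun r hr x hx => ⟨(m1 r hr x hx).1.trans hmm, (m1 r hr x hx).2.trans hmm⟩) m2 r hr
    refine this.trans ?_
    rw [hB4]
    exact mul_le_mul y4 (expm _ r (by positivity) hr) (Real.exp_pos _).le Z40
  have bd : ∀ s ∈ Icc 0 T, ∀ k ≤ 3, ∀ x ∈ Icc (0:ℝ) 1, |p s k x| ≤ K0 ∧ |q s k x| ≤ K0 := by
    intro s hs k hk x hx
    have a := supY (G.pj s) (G.qj s) k hx
    have h0 := gY0 hσ G s hs
    have h1 := G.mono s 1 le_rfl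
    have h2 := Y2 s hs; have h3 := Y3 s hs; have h4 := Y4 s hs
    norm_num at h1
    have KK : K0 ≤ K0^2 := by rw [sq]; exact le_mul_of_one_le_left (by linarith only [K01]) K01
    have : 2 * Yj (p s) (q s) k + Yj (p s) (q s) (k+1) ≤ K0 := by
      rw [hK0]
      interval_cases k <;> norm_num <;> linarith only [h0, h1, h2, h3, h4, y0, Za0, B0, B30, B40]
    exact ⟨abs_le_of_sq (by linarith) (a.1.trans (this.trans KK)), abs_le_of_sq (by linarith) (a.2.trans (this.trans KK))⟩
  have F2 : ∀ s ∈ Icc 0 T, ∫ x in (0:ℝ)..1, FJ1 (p s) (q s) 2 x ^ 2 ≤ R ∧ ∫ x in (0:ℝ)..1, FJ2 (p s) (q s) 2 x ^ 2 ≤ R := by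
    intro s hs
    have f := flux2 (G.pj s) (G.qj s) (fun k hk => bd s hs k (by omega))
    have := mul_le_mul_of_nonneg_left (Y2 s hs) (show 0 ≤ 20 * (1 + K0^2) by positivity)
    rw [hR]
    exact ⟨by linarith [f.1], by linarith [f.2]⟩
  have F4 : ∀ s ∈ Icc 0 T, ∫ x in (0:ℝ)..1, FJ1 (p s) (q s) 4 x ^ 2 ≤ K1 ∧ ∫ x in (0:ℝ)..1, FJ2 (p s) (q s) 4 x ^ 2 ≤ K1 := by
    intro s hs
    have f := flux4 (G.pj s) (G.qj s) (bd s hs)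
    have := mul_le_mul_of_nonneg_left (Y4 s hs) (show 0 ≤ 200 * (1 + K0)^2 by positivity)
    rw [hK1]
    exact ⟨by linarith [f.1], by linarith [f.2]⟩
  have rR : ∀ I : ℝ, (n:ℝ)^2 * I ≤ R → I ≤ ε := by
    intro I hI
    have hn1' : (n1:ℝ) + 1 ≤ n := by exact_mod_cast (by omega : n1 + 1 ≤ n)
    have : |R| ≤ n1 * ε := by rwa [div_le_iff₀ hε] at hn1
    have h1 := le_abs_self R
    have nn : (0:ℝ) ≤ n1 := Nat.cast_nonneg _
    have h2 : (n1:ℝ) * ε ≤ (n:ℝ)^2 * ε := mul_le_mul_of_nonneg_right (by nlinarith only [hn1', nn]) hε.le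
    exact le_of_mul_le_mul_left (hI.trans (h1.trans (this.trans h2))) (pow_pos (by linarith only [hn1', nn]) 2)
  have KK1 : K0 ≤ K1 := by rw [hK1]; linarith
  refine ⟨p, q, pt, qt, G.pj, G.qj, G.ptj, G.qtj, G.qv, G.qtv, G.dp, G.dq,
    fun s hs k hk x hx => ⟨(bd s hs k hk x hx).1.trans KK1, (bd s hs k hk x hx).2.trans KK1⟩,
    fun s hs => (Y4 s hs).trans (by rw [hK1]; linarith),
    fun s hs => (G.p3 s hs).trans (F4 s hs).1, fun s hs => (G.q3 s hs).trans (F4 s hs).2, ?_, ?_, ?_⟩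
  · intro s hs
    have := (G.r1 s hs).trans (F2 s hs).1
    simp only [one_mul] at this
    exact rR _ this
  · intro s hs
    have := (G.r2 s hs).trans (F2 s hs).2
    simp only [one_mul] at this
    exact rR _ this
  · intro s hs x hx
    have := clos s hs (cv s hs) (Y2 s hs) x hx
    have e : ε' ≤ ε := by rw [hε']; exact min_le_left _ _
    exact ⟨this.1.trans e, this.2.trans e⟩

theorem D01_iter {f : ℝ → ℝ} (hf : ContDiffOn ℝ 4 f (Icc (0:ℝ) 1)) {j : ℕ} (hj : j < 4) :
    D01 (iteratedDerivWithin j f (Icc (0:ℝ) 1)) (iteratedDerivWithin (j+1) f (Icc (0:ℝ) 1)) := by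
  intro x hx
  rw [iteratedDerivWithin_succ]
  exact (hf.differentiableOn_iteratedDerivWithin (by exact_mod_cast hj) (uniqueDiffOn_Icc zero_lt_one) x hx).hasDerivWithinAt

theorem cont_iter {f : ℝ → ℝ} (hf : ContDiffOn ℝ 4 f (Icc (0:ℝ) 1)) {j : ℕ} (hj : j ≤ 4) :
    ContinuousOn (iteratedDerivWithin j f (Icc (0:ℝ) 1)) (Icc (0:ℝ) 1) :=
  hf.continuousOn_iteratedDerivWithin (by exact_mod_cast hj) (uniqueDiffOn_Icc zero_lt_one)

theorem iter_one (f : ℝ → ℝ) : iteratedDerivWithin 1 f (Icc (0:ℝ) 1) = derivWithin f (Icc (0:ℝ) 1) := by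
  funext x; simp [iteratedDerivWithin_one]

theorem fromHyp (T β : ℝ) (hT : 0 < T) (hβ : 0 < β)
    (ηs us : ℕ → ℝ → ℝ → ℝ)
    (hηsm : SmoothChain T 4 1 ηs) (husm : SmoothChain T 4 1 us)
    (hsol : SSW T (ηs 0) (us 0) (ηs 1) (us 1))
    (hlow : ∀ y ∈ Icc (0:ℝ) 1, ∀ t ∈ Icc (0:ℝ) T, β ≤ 1 + (ηs 0 y t) / 2)
    (hc10 : derivWithin (fun y => ηs 0 y 0) (Icc (0:ℝ) 1) 0 = 0)
    (hc11 : derivWithin (fun y => ηs 0 y 0) (Icc (0:ℝ) 1) 1 = 0)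
    (hc30 : iteratedDerivWithin 3 (fun y => ηs 0 y 0) (Icc (0:ℝ) 1) 0 = 0)
    (hc31 : iteratedDerivWithin 3 (fun y => ηs 0 y 0) (Icc (0:ℝ) 1) 1 = 0)
    (hc20 : iteratedDerivWithin 2 (fun y => us 0 y 0) (Icc (0:ℝ) 1) 0 = 0)
    (hc21 : iteratedDerivWithin 2 (fun y => us 0 y 0) (Icc (0:ℝ) 1) 1 = 0) :
    ∃ K, 1 ≤ K ∧ ∀ ε > 0, ∃ p q pt qt, Appr T K ε (ηs 0) (us 0) p q pt qt := by
  obtain ⟨dη, sη, cη⟩ := hηsm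
  obtain ⟨du, su, cu⟩ := husm
  have ud := uniqueDiffOn_Icc (zero_lt_one (α := ℝ))
  have x1 : ∀ s ∈ Icc 0 T, D01 (fun y => ηs 0 y s) (fun y => derivWithin (fun z => ηs 0 z s) (Icc (0:ℝ) 1) y) := by
    intro s hs
    have := D01_iter (sη 0 (by norm_num) s hs) (j := 0) (by norm_num)
    rw [iteratedDerivWithin_zero, zero_add, iter_one] at this
    exact this
  have x2 : ∀ s ∈ Icc 0 T, D01 (fun y => us 0 y s) (fun y => derivWithin (fun z => us 0 z s) (Icc (0:ℝ) 1) y) := by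
    intro s hs
    have := D01_iter (su 0 (by norm_num) s hs) (j := 0) (by norm_num)
    rw [iteratedDerivWithin_zero, zero_add, iter_one] at this
    exact this
  have y1 : ∀ s ∈ Icc 0 T, D01 (fun y => derivWithin (fun z => ηs 0 z s) (Icc (0:ℝ) 1) y)
      (iteratedDerivWithin 2 (fun z => ηs 0 z s) (Icc (0:ℝ) 1)) := by
    intro s hs
    have := D01_iter (sη 0 (by norm_num) s hs) (j := 1) (by norm_num)
    rw [iter_one] at this
    exact this
  have y2 : ∀ s ∈ Icc 0 T, D01 (fun y => derivWithin (fun z => us 0 z s) (Icc (0:ℝ) 1) y)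
      (iteratedDerivWithin 2 (fun z => us 0 z s) (Icc (0:ℝ) 1)) := by
    intro s hs
    have := D01_iter (su 0 (by norm_num) s hs) (j := 1) (by norm_num)
    rw [iter_one] at this
    exact this
  have U : Sol 1 T (ηs 0) (us 0) (ηs 1) (us 1) (fun y s => derivWithin (fun z => ηs 0 z s) (Icc (0:ℝ) 1) y)
      (fun y s => derivWithin (fun z => us 0 z s) (Icc (0:ℝ) 1) y) := by
    refine ⟨cη 0 (by norm_num), cu 0 (by norm_num), cη 1 le_rfl, cu 1 le_rfl, dη 0 (by norm_num), du 0 (by norm_num),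
      x1, x2, fun s hs => (y1 s hs).cont, fun s hs => (y2 s hs).cont, ?_, ?_, hsol.2⟩
    · intro y hy s hs
      have := (hsol.1 y hy s hs).1
      have e := ((x1 s hs y hy).mul (x2 s hs y hy)).derivWithin (ud y hy)
      have e' : derivWithin (fun z => ηs 0 z s * us 0 z s) (Icc (0:ℝ) 1) y = _ := e
      rw [e'] at this
      linarith
    · intro y hy s hs
      have := (hsol.1 y hy s hs).2
      linarith
  have hb : ∀ s ∈ Icc 0 T, derivWithin (fun z => ηs 0 z s) (Icc (0:ℝ) 1) 0 = 0 ∧ derivWithin (fun z => ηs 0 z s) (Icc (0:ℝ) 1) 1 = 0 := by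
    intro s hs
    have key : ∀ y ∈ Icc (0:ℝ) 1, (∀ t ∈ Icc 0 T, us 0 y t = 0) → derivWithin (fun z => ηs 0 z s) (Icc (0:ℝ) 1) y = 0 := by
      intro y hy hz
      have d := du 0 (by norm_num) y hy s hs
      have d' : HasDerivWithinAt (fun s => us 0 y s) 0 (Icc 0 T) s :=
        (hasDerivWithinAt_const s (Icc 0 T) (0:ℝ)).congr (fun t ht => hz t ht) (hz s hs)
      have e : us 1 y s = 0 := (uniqueDiffOn_Icc hT s hs).eq_deriv _ d d'
      have := (hsol.1 y hy s hs).2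
      rw [e, hz s hs] at this
      have l := hlow y hy s hs
      have : (1 + ηs 0 y s / 2) * derivWithin (fun z => ηs 0 z s) (Icc (0:ℝ) 1) y = 0 := by linarith
      rcases mul_eq_zero.1 this with h | h
      · linarith
      · exact h
    exact ⟨key 0 ⟨le_rfl, zero_le_one⟩ fun t ht => (hsol.2 t ht).1, key 1 ⟨zero_le_one, le_rfl⟩ fun t ht => (hsol.2 t ht).2⟩
  obtain ⟨M, hM⟩ := unifM U (fun s hs => ⟨_, y1 s hs, cont_iter (sη 0 (by norm_num) s hs) (by norm_num)⟩)
    (fun s hs => ⟨_, y2 s hs, cont_iter (su 0 (by norm_num) s hs) (by norm_num)⟩) hb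
  have z : (0:ℝ) ∈ Icc 0 T := ⟨le_rfl, hT.le⟩
  have a := sη 0 (by norm_num) 0 z
  have b := su 0 (by norm_num) 0 z
  exact appr hT.le U hM (y1 0 z) (D01_iter a (by norm_num)) (D01_iter a (by norm_num)) (cont_iter a (by norm_num))
    (y2 0 z) (D01_iter b (by norm_num)) (D01_iter b (by norm_num)) (cont_iter b (by norm_num))
    ⟨hc10, hc11⟩ ⟨hc30, hc31⟩ ⟨hc20, hc21⟩

theorem cint_mono {f g : ℝ → ℝ} {m k : ℝ} (hk : 0 ≤ k) (hf : Continuous f) (hg : Continuous g)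
    (h : ∀ x ∈ Icc (m-k) (m+k), f x ≤ g x) : ∫ x in (m-k)..(m+k), f x ≤ ∫ x in (m-k)..(m+k), g x :=
  intervalIntegral.integral_mono_on (by linarith) (hf.intervalIntegrable _ _) (hg.intervalIntegrable _ _) h

theorem cint_abs {f : ℝ → ℝ} {m k B : ℝ} (hk : 0 ≤ k)
    (h : ∀ x ∈ Icc (m-k) (m+k), |f x| ≤ B) : |∫ x in (m-k)..(m+k), f x| ≤ 2 * k * B := by
  have := intervalIntegral.norm_integral_le_of_norm_le_const (a := m-k) (b := m+k) (C := B) (f := f) (by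
    intro x hx
    rw [uIoc_of_le (by linarith)] at hx
    exact h x ⟨hx.1.le, hx.2⟩)
  rw [Real.norm_eq_abs, abs_of_nonneg (by linarith : 0 ≤ m + k - (m - k))] at this
  linarith

theorem hD_sub (m x : ℝ) : HasDerivAt (fun x : ℝ => x - m) 1 x := (hasDerivAt_id x).sub_const m

theorem hD_pow (m x : ℝ) (n : ℕ) : HasDerivAt (fun x : ℝ => (x - m)^(n+1)) ((n+1) * (x-m)^n) x := by
  exact ((hD_sub m x).pow (n+1)).congr_deriv (by simp)

theorem hD_lin (a b m x : ℝ) : HasDerivAt (fun x : ℝ => a + b * (x - m)) b x := by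
  simpa using ((hD_sub m x).const_mul b).const_add a

theorem Lint2 (a b c d m k : ℝ) : ∫ x in (m-k)..(m+k), (a + b * (x - m)) * (c + d * (x - m))
    = 2 * k * (a * c) + 2/3 * k^3 * (b * d) := by
  rw [intervalIntegral.integral_eq_sub_of_hasDerivAt
    (f := fun x => a * c * (x - m) + (a*d+b*c)/2 * (x-m)^(1+1) + b*d/3 * (x-m)^(2+1))]
  · ring
  · intro x _
    exact HasDerivAt.congr_deriv ((((hD_sub m x).const_mul (a*c)).add ((hD_pow m x 1).const_mul ((a*d+b*c)/2))).add
      ((hD_pow m x 2).const_mul (b*d/3))) (by push_cast; ring)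
  · exact (by fun_prop : Continuous _).intervalIntegrable _ _

/-- the polynomial with vanishing mean -/
theorem polyZero (A0 A1 p2 p3 m k : ℝ) : ∫ x in (m-k)..(m+k),
    (A0 * (p2 * ((x-m)^2/2 - k^2/6) + p3 * (((x-m)^3 + k^2 * (x-m))/6)) + A1 * (x-m) * (p2 * ((x-m)^2/2 - k^2/6))) = 0 := by
  rw [intervalIntegral.integral_eq_sub_of_hasDerivAt
    (f := fun x => A0 * p2 /6 * (x-m)^(2+1) - A0 * p2 * k^2/6 * (x - m) + A0 * p3/24 * (x-m)^(3+1) + A0 * p3 * k^2/12 * (x-m)^(1+1)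
      + A1 * p2 / 8 * (x-m)^(3+1) - A1 * p2 * k^2/12 * (x-m)^(1+1))]
  · ring
  · intro x _
    exact HasDerivAt.congr_deriv (((((((hD_pow m x 2).const_mul (A0 * p2 /6)).sub ((hD_sub m x).const_mul (A0 * p2 * k^2/6))).add
      ((hD_pow m x 3).const_mul (A0 * p3/24))).add ((hD_pow m x 1).const_mul (A0 * p3 * k^2/12))).add
      ((hD_pow m x 3).const_mul (A1 * p2 / 8))).sub ((hD_pow m x 1).const_mul (A1 * p2 * k^2/12))) (by push_cast; ring)
  · exact (by fun_prop : Continuous _).intervalIntegrable _ _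

theorem csInt {g g' : ℝ → ℝ} (hg : ∀ x, HasDerivAt g (g' x) x) (hc : Continuous g') {a b : ℝ} (hab : a ≤ b) :
    (g b - g a)^2 ≤ (b - a) * ∫ x in a..b, g' x ^ 2 := by
  have e : ∫ x in a..b, g' x = g b - g a :=
    intervalIntegral.integral_eq_sub_of_hasDerivAt (fun x _ => hg x) (hc.intervalIntegrable _ _)
  rcases hab.eq_or_lt with h | h
  · subst h; simp
  have hd : 0 < b - a := by linarith
  have n : 0 ≤ ∫ x in a..b, ((b-a) * g' x - (g b - g a))^2 :=
    intervalIntegral.integral_nonneg hab fun x _ => sq_nonneg _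
  have ex : ∫ x in a..b, ((b-a) * g' x - (g b - g a))^2
      = (b-a)^2 * (∫ x in a..b, g' x^2) - 2 * (b-a) * (g b - g a) * (g b - g a) + (b-a) * (g b - g a)^2 := by
    have : (fun x => ((b-a) * g' x - (g b - g a))^2)
      = fun x => ((b-a)^2 * g' x^2 - (2 * (b-a) * (g b - g a)) * g' x) + (g b - g a)^2 := by funext x; ring
    rw [this, intervalIntegral.integral_add ((by fun_prop : Continuous _).intervalIntegrable _ _) (by simp),
      intervalIntegral.integral_sub ((by fun_prop : Continuous _).intervalIntegrable _ _) ((by fun_prop : Continuous _).intervalIntegrable _ _),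
      intervalIntegral.integral_const_mul, intervalIntegral.integral_const_mul, e]
    simp
  rw [ex] at n
  have : 0 ≤ (b-a) * ((b - a) * (∫ x in a..b, g' x ^ 2) - (g b - g a)^2) := by linarith
  have := nonneg_of_mul_nonneg_right this hd
  linarith

theorem cellJ {g g' : ℝ → ℝ} (hg : ∀ x, HasDerivAt g (g' x) x) (hc : Continuous g') {m k : ℝ} (hk : 0 ≤ k) :
    ∀ x ∈ Icc (m-k) (m+k), |g x - g m| ≤ Real.sqrt (k * ∫ x in (m-k)..(m+k), g' x ^ 2) := by
  intro x hx
  apply Real.abs_le_sqrt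
  have hi : ∀ a b, IntervalIntegrable (fun x => g' x ^ 2) MeasureTheory.volume a b := fun a b =>
    (by fun_prop : Continuous (fun x => g' x ^ 2)).intervalIntegrable _ _
  have nn : ∀ a b, a ≤ b → 0 ≤ ∫ x in a..b, g' x ^ 2 := fun a b h =>
    intervalIntegral.integral_nonneg h fun x _ => sq_nonneg _
  rcases le_total m x with h | h
  · have a := csInt hg hc h
    have b : (∫ t in m..x, g' t ^ 2) ≤ ∫ t in (m-k)..(m+k), g' t ^ 2 :=
      intervalIntegral.integral_mono_interval (by linarith) h hx.2 (Filter.Eventually.of_forall fun x => sq_nonneg _) (hi _ _)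
    exact a.trans (mul_le_mul (by linarith [hx.2]) b (nn _ _ h) hk)
  · have a := csInt hg hc h
    have b : (∫ t in x..m, g' t ^ 2) ≤ ∫ t in (m-k)..(m+k), g' t ^ 2 :=
      intervalIntegral.integral_mono_interval hx.1 h (by linarith) (Filter.Eventually.of_forall fun x => sq_nonneg _) (hi _ _)
    rw [← neg_sq, neg_sub]
    exact a.trans (mul_le_mul (by linarith [hx.1]) b (nn _ _ h) hk)

/-- mean value on a half cell -/
theorem cellMV {g g' : ℝ → ℝ} (hg : ∀ x, HasDerivAt g (g' x) x) {m k J : ℝ} (hk : 0 ≤ k) (hJ : 0 ≤ J) (h0 : g m = 0)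
    (h : ∀ x ∈ Icc (m-k) (m+k), |g' x| ≤ J) : ∀ x ∈ Icc (m-k) (m+k), |g x| ≤ k * J := by
  intro x hx
  have := (convex_Icc (m-k) (m+k)).norm_image_sub_le_of_norm_hasDerivWithin_le (f := g) (f' := g') (C := J)
        (fun z _ => (hg z).hasDerivWithinAt) (fun z hz => h z hz) (⟨by linarith, by linarith⟩ : m ∈ Icc (m-k) (m+k)) hx
  rw [h0, sub_zero, Real.norm_eq_abs, Real.norm_eq_abs] at this
  have e : |x - m| ≤ k := abs_le.2 ⟨by linarith [hx.1], by linarith [hx.2]⟩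
  exact this.trans (by rw [mul_comm]; exact mul_le_mul_of_nonneg_right e hJ)

theorem interpBd {g0 g1 g2 : ℝ → ℝ} (h0 : ∀ x, HasDerivAt g0 (g1 x) x) (h1 : ∀ x, HasDerivAt g1 (g2 x) x)
    {m k J d0 d1 : ℝ} (hk : 0 < k) (hJ : 0 ≤ J) (z0 : g0 m = 0) (z1 : g1 m = 0)
    (h : ∀ x ∈ Icc (m-k) (m+k), |g2 x| ≤ J)
    (e1 : d0 + d1 * k = g0 (m+k) - k^2/3 * g2 (m+k)) (e2 : d0 - d1 * k = g0 (m-k) - k^2/3 * g2 (m-k)) :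
    ∀ x ∈ Icc (m-k) (m+k), |g0 x - (d0 + d1 * (x - m))| ≤ 3 * k^2 * J := by
  intro x hx
  have b1 := cellMV h1 hk.le hJ z1 h
  have b0 := cellMV h0 hk.le (by positivity) z0 b1
  have mp : m + k ∈ Icc (m-k) (m+k) := ⟨by linarith, le_rfl⟩
  have mm : m - k ∈ Icc (m-k) (m+k) := ⟨le_rfl, by linarith⟩
  have p0 := abs_le.1 (b0 _ mp); have p2 := abs_le.1 (h _ mp)
  have q0 := abs_le.1 (b0 _ mm); have q2 := abs_le.1 (h _ mm)
  have x0 := abs_le.1 (b0 _ hx)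
  have kk : 0 ≤ k^2/3 := by positivity
  have u1 := mul_le_mul_of_nonneg_left p2.1 kk; have u2 := mul_le_mul_of_nonneg_left p2.2 kk
  have v1 := mul_le_mul_of_nonneg_left q2.1 kk; have v2 := mul_le_mul_of_nonneg_left q2.2 kk
  have kJ : 0 ≤ k^2 * J := by positivity
  have A1 : d0 + d1 * k ≤ 2 * (k^2*J) := by nlinarith
  have A2 : -(2 * (k^2*J)) ≤ d0 + d1 * k := by nlinarith
  have A3 : d0 - d1 * k ≤ 2 * (k^2*J) := by nlinarith
  have A4 : -(2 * (k^2*J)) ≤ d0 - d1 * k := by nlinarith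
  have s1 : 0 ≤ k + (x - m) := by linarith [hx.1]
  have s2 : 0 ≤ k - (x - m) := by linarith [hx.2]
  have r1 : d0 + d1 * (x - m) ≤ 2 * (k^2*J) := by
    have : 2 * k * (d0 + d1 * (x-m)) ≤ 2 * k * (2 * (k^2*J)) := by
      nlinarith [mul_le_mul_of_nonneg_left A1 s1, mul_le_mul_of_nonneg_left A3 s2]
    exact le_of_mul_le_mul_left this (by positivity)
  have r2 : -(2 * (k^2*J)) ≤ d0 + d1 * (x - m) := by
    have : 2 * k * (-(2 * (k^2*J))) ≤ 2 * k * (d0 + d1 * (x-m)) := by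
      nlinarith [mul_le_mul_of_nonneg_left A2 s1, mul_le_mul_of_nonneg_left A4 s2]
    exact le_of_mul_le_mul_left this (by positivity)
  rw [abs_le]; constructor <;> nlinarith

/-- coefficients of the quasi-interpolant on a cell -/
structure Coef (P : ℕ → ℝ → ℝ) (m k c d : ℝ) : Prop where
  e1 : c + d * k = P 0 (m+k) - k^2/3 * P 2 (m+k)
  e2 : c - d * k = P 0 (m-k) - k^2/3 * P 2 (m-k)

theorem dec3 {P : ℕ → ℝ → ℝ} (hP : IsJet P) {m k c d J : ℝ} (hk : 0 < k) (H : Coef P m k c d) (hJ : 0 ≤ J)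
    (h : ∀ x ∈ Icc (m-k) (m+k), |P 2 x - P 2 m| ≤ J) :
    ∀ x ∈ Icc (m-k) (m+k), |P 0 x - (c + d * (x - m)) - P 2 m * ((x-m)^2/2 - k^2/6)| ≤ 3 * k^2 * J := by
  intro x hx
  have := interpBd (g0 := fun x => P 0 x - P 0 m - P 1 m * (x-m) - P 2 m / 2 * (x-m)^(1+1))
    (g1 := fun x => P 1 x - P 1 m - P 2 m * (x-m)) (g2 := fun x => P 2 x - P 2 m)
    (d0 := c - P 0 m - P 2 m * (k^2/6)) (d1 := d - P 1 m) (m := m) (k := k) (J := J)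
    (fun x => by
      exact HasDerivAt.congr_deriv ((((hP 0 x).sub_const (P 0 m)).sub ((hD_sub m x).const_mul (P 1 m))).sub ((hD_pow m x 1).const_mul (P 2 m/2))) (by push_cast; ring))
    (fun x => by
      exact HasDerivAt.congr_deriv (((hP 1 x).sub_const (P 1 m)).sub ((hD_sub m x).const_mul (P 2 m))) (by push_cast; ring)) hk hJ (by simp) (by simp) h (by linear_combination H.e1) (by linear_combination H.e2) x hx
  convert this using 2
  ring

theorem dec4 {P : ℕ → ℝ → ℝ} (hP : IsJet P) {m k c d J : ℝ} (hk : 0 < k) (H : Coef P m k c d) (hJ : 0 ≤ J)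
    (h : ∀ x ∈ Icc (m-k) (m+k), |P 3 x - P 3 m| ≤ J) :
    ∀ x ∈ Icc (m-k) (m+k), |P 0 x - (c + d * (x - m)) - P 2 m * ((x-m)^2/2 - k^2/6)
      - P 3 m * (((x-m)^3 + k^2 * (x-m))/6)| ≤ 3 * k^3 * J := by
  intro x hx
  have b2 := cellMV (g := fun x => P 2 x - P 2 m - P 3 m * (x-m)) (g' := fun x => P 3 x - P 3 m) (m := m) (k := k) (J := J)
    (fun x => by
      exact HasDerivAt.congr_deriv (((hP 2 x).sub_const (P 2 m)).sub ((hD_sub m x).const_mul (P 3 m))) (by push_cast; ring)) hk.le hJ (by simp) h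
  have := interpBd (g0 := fun x => P 0 x - P 0 m - P 1 m * (x-m) - P 2 m / 2 * (x-m)^(1+1) - P 3 m / 6 * (x-m)^(2+1))
    (g1 := fun x => P 1 x - P 1 m - P 2 m * (x-m) - P 3 m/2 * (x-m)^(1+1)) (g2 := fun x => P 2 x - P 2 m - P 3 m * (x-m))
    (d0 := c - P 0 m - P 2 m * (k^2/6)) (d1 := d - P 1 m + P 3 m * k^2/6) (m := m) (k := k) (J := k * J)
    (fun x => by
      exact HasDerivAt.congr_deriv (((((hP 0 x).sub_const (P 0 m)).sub ((hD_sub m x).const_mul (P 1 m))).sub ((hD_pow m x 1).const_mul (P 2 m/2))).sub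
        ((hD_pow m x 2).const_mul (P 3 m/6))) (by push_cast; ring))
    (fun x => by
      exact HasDerivAt.congr_deriv ((((hP 1 x).sub_const (P 1 m)).sub ((hD_sub m x).const_mul (P 2 m))).sub ((hD_pow m x 1).const_mul (P 3 m/2))) (by push_cast; ring)) hk (by positivity) (by simp) (by simp) b2 (by linear_combination H.e1) (by linear_combination H.e2) x hx
  have e : 3 * k^2 * (k * J) = 3 * k^3 * J := by ring
  rw [e] at this
  convert this using 2
  ring

theorem q_bd {x m k : ℝ} (hx : x ∈ Icc (m-k) (m+k)) : |(x-m)^2/2 - k^2/6| ≤ k^2/3 := by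
  have h1 : 0 ≤ (x-m)^2 := sq_nonneg _
  have h2 : (x-m)^2 ≤ k^2 := by nlinarith [hx.1, hx.2]
  rw [abs_le]; constructor <;> nlinarith

theorem c_bd {x m k : ℝ} (hk : 0 ≤ k) (hx : x ∈ Icc (m-k) (m+k)) : |((x-m)^3 + k^2 * (x-m))/6| ≤ k^3/3 := by
  have h2 : (x-m)^2 ≤ k^2 := by nlinarith [hx.1, hx.2]
  have h3 : |x - m| ≤ k := abs_le.2 ⟨by linarith [hx.1], by linarith [hx.2]⟩
  have e : ((x-m)^3 + k^2 * (x-m))/6 = (x - m) * (((x-m)^2 + k^2)/6) := by ring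
  have h4 : 0 ≤ ((x-m)^2 + k^2)/6 := by positivity
  rw [e, abs_mul, abs_of_nonneg h4]
  calc |x-m| * (((x-m)^2 + k^2)/6) ≤ k * (k^2/3) := mul_le_mul h3 (by linarith) h4 hk
    _ = k^3/3 := by ring

theorem cellB {P : ℕ → ℝ → ℝ} (hP : IsJet P) {m k c d : ℝ} (hk : 0 < k) (H : Coef P m k c d) (a b : ℝ) :
    ∫ x in (m-k)..(m+k), (P 0 x - (c + d * (x - m))) * (a + b * (x - m))
      ≤ 1/2 * (2 * k * a^2 + 2/3 * k^3 * b^2) + 9 * k^6 * ∫ x in (m-k)..(m+k), P 3 x ^ 2 := by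
  set I := ∫ x in (m-k)..(m+k), P 3 x ^ 2 with hI
  have I0 : 0 ≤ I := intervalIntegral.integral_nonneg (by linarith) fun x _ => sq_nonneg _
  have hd := dec3 hP hk H (Real.sqrt_nonneg _) (cellJ (hP 2) (hP.cont 3) hk.le)
  rw [← hI] at hd
  set J := Real.sqrt (k * I) with hJd
  have J2 : J^2 = k * I := Real.sq_sqrt (by positivity)
  have c0 := hP.cont 0
  have key := cint_mono (m := m) (k := k) hk.le
    (f := fun x => (P 0 x - (c + d * (x - m))) * (a + b * (x - m)) -
      (a * (P 2 m * ((x-m)^2/2 - k^2/6) + 0 * (((x-m)^3 + k^2 * (x-m))/6)) + b * (x-m) * (P 2 m * ((x-m)^2/2 - k^2/6))))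
    (g := fun x => 1/2 * ((a + b * (x - m)) * (a + b * (x - m))) + 1/2 * (3 * k^2 * J)^2)
    (by fun_prop) (by fun_prop) (by
      intro x hx
      have h := sq_le_sq' (abs_le.1 (hd x hx)).1 (abs_le.1 (hd x hx)).2
      nlinarith [sq_nonneg (P 0 x - (c + d * (x - m)) - P 2 m * ((x-m)^2/2 - k^2/6) - (a + b * (x - m)))])
  rw [intervalIntegral.integral_sub ((by fun_prop : Continuous _).intervalIntegrable _ _) ((by fun_prop : Continuous _).intervalIntegrable _ _),
    polyZero, sub_zero] at key
  refine key.trans ?_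
  rw [intervalIntegral.integral_add ((by fun_prop : Continuous _).intervalIntegrable _ _) (by simp),
    intervalIntegral.integral_const_mul, Lint2, intervalIntegral.integral_const, smul_eq_mul]
  have : (3 * k^2 * J)^2 = 9 * k^4 * (k * I) := by rw [← J2]; ring
  rw [this]
  apply le_of_eq; ring

theorem cellA {P : ℕ → ℝ → ℝ} (hP : IsJet P) {m k c d K : ℝ} (hk : 0 < k) (hk1 : k ≤ 1) (hK : 0 ≤ K) (H : Coef P m k c d)
    (b2 : ∀ x ∈ Icc (m-k) (m+k), |P 2 x| ≤ K) (b3 : ∀ x ∈ Icc (m-k) (m+k), |P 3 x| ≤ K) :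
    ∀ x ∈ Icc (m-k) (m+k), |P 0 x - (c + d * (x - m))| ≤ 4 * K * k^2 := by
  intro x hx
  have h1 := cellMV (g := fun x => P 2 x - P 2 m) (g' := P 3) (m := m) (k := k) (J := K)
    (fun x => (hP 2 x).sub_const _) hk.le hK (by simp) b3
  have h2 := dec3 hP hk H (by positivity) h1 x hx
  have h3 : |P 2 m * ((x-m)^2/2 - k^2/6)| ≤ K * (k^2/3) := by
    rw [abs_mul]
    exact mul_le_mul (b2 m ⟨by linarith, by linarith⟩) (q_bd hx) (abs_nonneg _) hK
  have h4 : 3 * k^2 * (k * K) ≤ 3 * k^2 * K := by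
    have : k * K ≤ K := by nlinarith
    exact mul_le_mul_of_nonneg_left this (by positivity)
  have h5 := abs_add_le (P 0 x - (c + d * (x - m)) - P 2 m * ((x-m)^2/2 - k^2/6)) (P 2 m * ((x-m)^2/2 - k^2/6))
  rw [sub_add_cancel] at h5
  have h6 : 0 ≤ K * k^2 := by positivity
  nlinarith

theorem cellSlope {P : ℕ → ℝ → ℝ} (hP : IsJet P) {m k c d K : ℝ} (hk : 0 < k) (hk1 : k ≤ 1) (hK : 0 ≤ K) (H : Coef P m k c d)
    (b1 : ∀ x ∈ Icc (m-k) (m+k), |P 1 x| ≤ K) (b2 : ∀ x ∈ Icc (m-k) (m+k), |P 2 x| ≤ K) : |d| ≤ 2 * K := by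
  have h1 := cellMV (g := fun x => P 0 x - P 0 m) (g' := P 1) (m := m) (k := k) (J := K)
    (fun x => (hP 0 x).sub_const _) hk.le hK (by simp) b1
  have mp : m + k ∈ Icc (m-k) (m+k) := ⟨by linarith, le_rfl⟩
  have mm : m - k ∈ Icc (m-k) (m+k) := ⟨le_rfl, by linarith⟩
  have p := abs_le.1 (h1 _ mp); have q := abs_le.1 (h1 _ mm)
  have p2 := abs_le.1 (b2 _ mp); have q2 := abs_le.1 (b2 _ mm)
  have e : 2 * k * d = P 0 (m+k) - P 0 (m-k) - k^2/3 * (P 2 (m+k) - P 2 (m-k)) := by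
    linear_combination H.e1 - H.e2
  have kk : k^2 * K ≤ k * K := by nlinarith [mul_nonneg hk.le hK]
  have s1 : k^2/3 * (P 2 (m+k) - P 2 (m-k)) ≤ k^2/3 * (2 * K) := mul_le_mul_of_nonneg_left (by linarith) (by positivity)
  have s2 : k^2/3 * (-(2 * K)) ≤ k^2/3 * (P 2 (m+k) - P 2 (m-k)) := mul_le_mul_of_nonneg_left (by linarith) (by positivity)
  have kK : 0 ≤ k * K := by positivity
  rw [abs_le]
  constructor
  · have : 2 * k * (-(2 * K)) ≤ 2 * k * d := by rw [e]; linarith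
    exact le_of_mul_le_mul_left this (by positivity)
  · have : 2 * k * d ≤ 2 * k * (2 * K) := by rw [e]; linarith
    exact le_of_mul_le_mul_left this (by positivity)

theorem cellD {P : ℕ → ℝ → ℝ} (hP : IsJet P) {m k c d K M : ℝ} (hk : 0 < k) (hK : 0 ≤ K) (hM : 0 ≤ M) (H : Coef P m k c d)
    (b2 : ∀ x ∈ Icc (m-k) (m+k), |P 2 x| ≤ K) (b3 : ∀ x ∈ Icc (m-k) (m+k), |P 3 x| ≤ K)
    {A A1 A2 : ℝ → ℝ} (hA : ∀ x, HasDerivAt A (A1 x) x) (hA1 : ∀ x, HasDerivAt A1 (A2 x) x)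
    (a0 : ∀ x ∈ Icc (m-k) (m+k), |A x| ≤ M) (a1 : ∀ x ∈ Icc (m-k) (m+k), |A1 x| ≤ M)
    (a2 : ∀ x ∈ Icc (m-k) (m+k), |A2 x| ≤ M) :
    |∫ x in (m-k)..(m+k), A x * (P 0 x - (c + d * (x - m)))|
      ≤ 2 * k * (3 * M * k^3 * Real.sqrt (k * ∫ x in (m-k)..(m+k), P 4 x ^ 2) + M * K * k^4) := by
  have hd := dec4 hP hk H (Real.sqrt_nonneg _) (cellJ (hP 3) (hP.cont 4) hk.le)
  set J := Real.sqrt (k * ∫ x in (m-k)..(m+k), P 4 x ^ 2) with hJd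
  have J0 : 0 ≤ J := Real.sqrt_nonneg _
  have cA : Continuous A := continuous_iff_continuousAt.2 fun x => (hA x).continuousAt
  have c0 := hP.cont 0
  have t1 := cellMV (g := fun x => A1 x - A1 m) (g' := A2) (m := m) (k := k) (J := M)
    (fun x => (hA1 x).sub_const _) hk.le hM (by simp) a2
  have t2 := cellMV (g := fun x => A x - A m - A1 m * (x - m)) (g' := fun x => A1 x - A1 m) (m := m) (k := k) (J := k * M)
    (fun x => HasDerivAt.congr_deriv (((hA x).sub_const (A m)).sub ((hD_sub m x).const_mul (A1 m))) (by ring)) hk.le (by positivity) (by simp) t1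
  have t3 := cellMV (g := fun x => A x - A m) (g' := A1) (m := m) (k := k) (J := M)
    (fun x => (hA x).sub_const _) hk.le hM (by simp) a1
  have mc : m ∈ Icc (m-k) (m+k) := ⟨by linarith, by linarith⟩
  have e : ∫ x in (m-k)..(m+k), A x * (P 0 x - (c + d * (x - m))) =
      ∫ x in (m-k)..(m+k), (A x * (P 0 x - (c + d * (x - m))) -
        (A m * (P 2 m * ((x-m)^2/2 - k^2/6) + P 3 m * (((x-m)^3 + k^2 * (x-m))/6)) + A1 m * (x-m) * (P 2 m * ((x-m)^2/2 - k^2/6)))) := by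
    rw [intervalIntegral.integral_sub ((by fun_prop : Continuous _).intervalIntegrable _ _) ((by fun_prop : Continuous _).intervalIntegrable _ _),
    polyZero, sub_zero]
  rw [e]
  refine cint_abs hk.le ?_
  intro x hx
  set q := (x-m)^2/2 - k^2/6 with hq
  set cc := ((x-m)^3 + k^2 * (x-m))/6 with hcc
  set ρ := P 0 x - (c + d * (x - m)) - P 2 m * q - P 3 m * cc with hρ
  have e2 : A x * (P 0 x - (c + d * (x - m))) - (A m * (P 2 m * q + P 3 m * cc) + A1 m * (x-m) * (P 2 m * q))
      = A x * ρ + (A x - A m - A1 m * (x - m)) * (P 2 m * q) + (A x - A m) * (P 3 m * cc) := by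
    rw [hρ]; ring
  rw [e2]
  have B1 : |A x * ρ| ≤ M * (3 * k^3 * J) := by
    rw [abs_mul]; exact mul_le_mul (a0 x hx) (hd x hx) (abs_nonneg _) hM
  have B2 : |(A x - A m - A1 m * (x - m)) * (P 2 m * q)| ≤ (k * (k * M)) * (K * (k^2/3)) := by
    rw [abs_mul, abs_mul]
    exact mul_le_mul (t2 x hx) (mul_le_mul (b2 m mc) (q_bd hx) (abs_nonneg _) hK) (by positivity) (by positivity)
  have B3 : |(A x - A m) * (P 3 m * cc)| ≤ (k * M) * (K * (k^3/3)) := by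
    rw [abs_mul, abs_mul]
    exact mul_le_mul (t3 x hx) (mul_le_mul (b3 m mc) (c_bd hk.le hx) (abs_nonneg _) hK) (by positivity) (by positivity)
  have h := abs_add_three (A x * ρ) ((A x - A m - A1 m * (x - m)) * (P 2 m * q)) ((A x - A m) * (P 3 m * cc))
  have : 0 ≤ M * K * k^4 := by positivity
  nlinarith

theorem fluxGen {P Q : ℕ → ℝ → ℝ} (hP : IsJet P) (hQ : IsJet Q) {m k c1 d1 c2 d2 K : ℝ} (hk : 0 < k) (hk1 : k ≤ 1) (hK : 1 ≤ K)
    (HP : Coef P m k c1 d1) (HQ : Coef Q m k c2 d2)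
    (bP : ∀ i ≤ 3, ∀ x ∈ Icc (m-k) (m+k), |P i x| ≤ K) (bQ : ∀ i ≤ 3, ∀ x ∈ Icc (m-k) (m+k), |Q i x| ≤ K)
    {A A1 A2 B B1 B2 R : ℝ → ℝ} (hA : ∀ x, HasDerivAt A (A1 x) x) (hA1 : ∀ x, HasDerivAt A1 (A2 x) x)
    (hB : ∀ x, HasDerivAt B (B1 x) x) (hB1 : ∀ x, HasDerivAt B1 (B2 x) x)
    (a0 : ∀ x ∈ Icc (m-k) (m+k), |A x| ≤ 2*K) (a1 : ∀ x ∈ Icc (m-k) (m+k), |A1 x| ≤ 2*K)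
    (a2 : ∀ x ∈ Icc (m-k) (m+k), |A2 x| ≤ 2*K)
    (b0 : ∀ x ∈ Icc (m-k) (m+k), |B x| ≤ 2*K) (b1 : ∀ x ∈ Icc (m-k) (m+k), |B1 x| ≤ 2*K)
    (b2 : ∀ x ∈ Icc (m-k) (m+k), |B2 x| ≤ 2*K) (cR : Continuous R)
    (r : ∀ x ∈ Icc (m-k) (m+k), |R x| ≤ 16 * K^2 * k^4) (β : ℝ) :
    β * ∫ x in (m-k)..(m+k), (A x * (P 0 x - (c1 + d1 * (x - m))) + B x * (Q 0 x - (c2 + d2 * (x - m))) + R x)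
      ≤ 32 * K^2 * (k^3 * β^2) + 20 * K^2 * k^7 + 6 * K^2 * (k^6 * ((∫ x in (m-k)..(m+k), P 4 x ^ 2) + ∫ x in (m-k)..(m+k), Q 4 x ^ 2)) := by
  have K0 : 0 ≤ K := by linarith
  have h1 := cellD hP hk K0 (by positivity) HP (bP 2 (by norm_num)) (bP 3 le_rfl) hA hA1 a0 a1 a2
  have h2 := cellD hQ hk K0 (by positivity) HQ (bQ 2 (by norm_num)) (bQ 3 le_rfl) hB hB1 b0 b1 b2
  have h3 := cint_abs hk.le r
  have cA : Continuous A := continuous_iff_continuousAt.2 fun x => (hA x).continuousAt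
  have cB : Continuous B := continuous_iff_continuousAt.2 fun x => (hB x).continuousAt
  have cp := hP.cont 0
  have cq := hQ.cont 0
  rw [intervalIntegral.integral_add ((by fun_prop : Continuous _).intervalIntegrable _ _) (cR.intervalIntegrable _ _),
    intervalIntegral.integral_add ((by fun_prop : Continuous _).intervalIntegrable _ _) ((by fun_prop : Continuous _).intervalIntegrable _ _)]
  have IP0 : 0 ≤ ∫ x in (m-k)..(m+k), P 4 x ^ 2 := intervalIntegral.integral_nonneg (by linarith) fun x _ => sq_nonneg _
  have IQ0 : 0 ≤ ∫ x in (m-k)..(m+k), Q 4 x ^ 2 := intervalIntegral.integral_nonneg (by linarith) fun x _ => sq_nonneg _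
  set IP := ∫ x in (m-k)..(m+k), P 4 x ^ 2
  set IQ := ∫ x in (m-k)..(m+k), Q 4 x ^ 2
  set X := ∫ x in (m-k)..(m+k), A x * (P 0 x - (c1 + d1 * (x - m)))
  set Y := ∫ x in (m-k)..(m+k), B x * (Q 0 x - (c2 + d2 * (x - m)))
  set Z := ∫ x in (m-k)..(m+k), R x
  have jp : Real.sqrt (k * IP) ^ 2 = k * IP := Real.sq_sqrt (by positivity)
  have jq : Real.sqrt (k * IQ) ^ 2 = k * IQ := Real.sq_sqrt (by positivity)
  set JP := Real.sqrt (k * IP)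
  set JQ := Real.sqrt (k * IQ)
  have h4 := abs_add_three X Y Z
  have h5 : |X + Y + Z| ≤ 12 * K * k^4 * (JP + JQ) + 40 * K^2 * k^5 := by nlinarith only [h1, h2, h3, h4]
  have h6 : β * (X + Y + Z) ≤ |β| * (12 * K * k^4 * (JP + JQ) + 40 * K^2 * k^5) := by
    refine (le_abs_self _).trans ?_
    rw [abs_mul]
    exact mul_le_mul_of_nonneg_left h5 (abs_nonneg _)
  have bb : |β|^2 = β^2 := sq_abs _
  set b := |β|
  have k3 : 0 ≤ k^3 := by positivity
  have g1 : k^4 * JP * b ≤ 1/2 * (k^3 * β^2 + k^6 * IP) := by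
    have := mul_nonneg k3 (sq_nonneg (b - k * JP))
    have e : k^6 * IP = k^5 * JP^2 := by rw [jp]; ring
    rw [e, ← bb]
    nlinarith only [this]
  have g2 : k^4 * JQ * b ≤ 1/2 * (k^3 * β^2 + k^6 * IQ) := by
    have := mul_nonneg k3 (sq_nonneg (b - k * JQ))
    have e : k^6 * IQ = k^5 * JQ^2 := by rw [jq]; ring
    rw [e, ← bb]
    nlinarith only [this]
  have g3 : k^5 * b ≤ 1/2 * (k^3 * β^2 + k^7) := by
    have := mul_nonneg k3 (sq_nonneg (b - k^2))
    rw [← bb]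
    nlinarith only [this]
  have KK : K ≤ K^2 := by nlinarith
  have s1 : 12 * K * (k^4 * JP * b + k^4 * JQ * b) ≤ 12 * K^2 * (1/2 * (k^3 * β^2 + k^6 * IP) + 1/2 * (k^3 * β^2 + k^6 * IQ)) := by
    have : 0 ≤ 1/2 * (k^3 * β^2 + k^6 * IP) + 1/2 * (k^3 * β^2 + k^6 * IQ) := by positivity
    calc _ ≤ 12 * K * (1/2 * (k^3 * β^2 + k^6 * IP) + 1/2 * (k^3 * β^2 + k^6 * IQ)) :=
          mul_le_mul_of_nonneg_left (by linarith) (by positivity)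
      _ ≤ _ := mul_le_mul_of_nonneg_right (by linarith) this
  have s2 : 40 * K^2 * (k^5 * b) ≤ 40 * K^2 * (1/2 * (k^3 * β^2 + k^7)) := mul_le_mul_of_nonneg_left g3 (by positivity)
  nlinarith only [h6, s1, s2]

/-- boundary flux -/
def Bv (P Q w v θ ξ : ℝ) : ℝ :=
  ((Q + 1/2 * (P * Q)) - (v + 1/2 * (w * v))) * θ + ((P + 3/4 * (Q * Q) + 1/4 * (P * P)) - (w + 3/4 * (v * v) + 1/4 * (w * w))) * ξ
   - (θ * ξ + 1/2 * (θ * θ * ξ) + 1/2 * (ξ * ξ * ξ) + 1/2 * (w * (θ * ξ)) + 1/4 * (v * (θ * θ)) + 3/4 * (v * (ξ * ξ)))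

theorem Bv_deriv {P Q w v a b : ℝ → ℝ} {P' Q' w' v' a' b' x : ℝ} (hP : HasDerivAt P P' x) (hQ : HasDerivAt Q Q' x)
    (hw : HasDerivAt w w' x) (hv : HasDerivAt v v' x) (ha : HasDerivAt a a' x) (hb : HasDerivAt b b' x) :
    HasDerivAt (fun x => Bv (P x) (Q x) (w x) (v x) (a x) (b x))
      ((Q' + 1/2 * (P' * Q x + P x * Q')) * a x + (P' + 3/2 * (Q x * Q') + 1/2 * (P x * P')) * b x
       - (v' + b' + 1/2 * ((w' + a') * (v x + b x) + (w x + a x) * (v' + b'))) * a x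
       - (w' + a' + 3/2 * ((v x + b x) * (v' + b')) + 1/2 * ((w x + a x) * (w' + a'))) * b x
       + ((Q x + 1/2 * (P x * Q x)) - (v x + 1/2 * (w x * v x))) * a'
       + ((P x + 3/4 * (Q x * Q x) + 1/4 * (P x * P x)) - (w x + 3/4 * (v x * v x) + 1/4 * (w x * w x))) * b'
       + (1/2 * w' * (a x * b x) + 1/4 * v' * (a x)^2 + 3/4 * v' * (b x)^2)) x := by
  have := ((((hQ.add ((hP.mul hQ).const_mul (1/2))).sub (hv.add ((hw.mul hv).const_mul (1/2)))).mul ha).add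
    ((((hP.add ((hQ.mul hQ).const_mul (3/4))).add ((hP.mul hP).const_mul (1/4))).sub
      ((hw.add ((hv.mul hv).const_mul (3/4))).add ((hw.mul hw).const_mul (1/4)))).mul hb)).sub
    ((((((ha.mul hb).add (((ha.mul ha).mul hb).const_mul (1/2))).add (((hb.mul hb).mul hb).const_mul (1/2))).add
      ((hw.mul (ha.mul hb)).const_mul (1/2))).add ((hv.mul (ha.mul ha)).const_mul (1/4))).add ((hv.mul (hb.mul hb)).const_mul (3/4)))
  refine HasDerivAt.congr_deriv this ?_
  simp only [Pi.add_apply, Pi.mul_apply, Pi.sub_apply]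
  ring

/-- the Galerkin integrand on a cell, everything affine -/
def GI (ηt ut η u bη bu θ ξ : ℝ) : ℝ :=
  (ηt + bu + 1/2 * (bη * u + η * bu)) * θ + (ut + bη + 3/2 * (u * bu) + 1/2 * (η * bη)) * ξ

/-- values of B at a node -/
def cellE (k a a' b b' : ℝ) : ℝ := 2 * k * (a^2 + a'^2) + 2/3 * k^3 * (b^2 + b'^2)

theorem pw_bd {d1 d2 K a b r1 r2 : ℝ} (hK : 1 ≤ K) (h1 : |d1| ≤ 2 * K) (h2 : |d2| ≤ 2 * K) :
    - r1 * a - r2 * b - (1/2 * d1 * (a * b) + 1/4 * d2 * a^2 + 3/4 * d2 * b^2) ≤ 1/2 * r1^2 + 1/2 * r2^2 + 3 * K * (a^2 + b^2) := by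
  have x1 := abs_le.1 h1; have x2 := abs_le.1 h2
  have y1 : -(1/2 * d1 * (a*b)) ≤ 1/2 * K * (a^2+b^2) := by
    nlinarith [mul_nonneg (by linarith [x1.1] : 0 ≤ 2 * K + d1) (sq_nonneg (a+b)), mul_nonneg (by linarith [x1.2] : 0 ≤ 2 * K - d1) (sq_nonneg (a-b)),sq_nonneg a, sq_nonneg b]
  have y2 : -(1/4 * d2 * a^2) ≤ 1/2 * K * a^2 := by nlinarith [sq_nonneg a]
  have y3 : -(3/4 * d2 * b^2) ≤ 3/2 * K * b^2 := by nlinarith [sq_nonneg b]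
  have z1 : a^2 + b^2 ≤ K * (a^2 + b^2) := by nlinarith [sq_nonneg a, sq_nonneg b]
  nlinarith [sq_nonneg (r1 + a), sq_nonneg (r2 + b), sq_nonneg a, sq_nonneg b]

set_option maxHeartbeats 4000000 in
theorem cellThm {P Q Pt Qt : ℕ → ℝ → ℝ} (hP : IsJet P) (hQ : IsJet Q) (hPt : IsJet Pt) (hQt : IsJet Qt)
    {m k c1 d1 c2 d2 e1 g1 e2 g2 K : ℝ} (hk : 0 < k) (hk1 : k ≤ 1) (hK : 1 ≤ K)
    (HP : Coef P m k c1 d1) (HQ : Coef Q m k c2 d2) (HPt : Coef Pt m k e1 g1) (HQt : Coef Qt m k e2 g2)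
    (bP : ∀ i ≤ 3, ∀ x ∈ Icc (m-k) (m+k), |P i x| ≤ K) (bQ : ∀ i ≤ 3, ∀ x ∈ Icc (m-k) (m+k), |Q i x| ≤ K)
    (α β α' β' αt βt αt' βt' : ℝ) {I4 I3 Ir1 Ir2 Bm Bp : ℝ}
    (hI4 : (∫ x in (m-k)..(m+k), P 4 x ^ 2) + (∫ x in (m-k)..(m+k), Q 4 x ^ 2) = I4)
    (hI3 : (∫ x in (m-k)..(m+k), Pt 3 x ^ 2) + (∫ x in (m-k)..(m+k), Qt 3 x ^ 2) = I3)
    (hr1 : (∫ x in (m-k)..(m+k), (Pt 0 x + f1 P Q x)^2) = Ir1)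
    (hr2 : (∫ x in (m-k)..(m+k), (Qt 0 x + f2 P Q x)^2) = Ir2)
    (hBp : Bv (P 0 (m+k)) (Q 0 (m+k)) (c1 + d1 * k) (c2 + d2 * k) (α + β * k) (α' + β' * k) = Bp)
    (hBm : Bv (P 0 (m-k)) (Q 0 (m-k)) (c1 - d1 * k) (c2 - d2 * k) (α - β * k) (α' - β' * k) = Bm) :
    2 * k * (α * αt + α' * αt') + 2/3 * k^3 * (β * βt + β' * βt')
      ≤ (∫ x in (m-k)..(m+k), GI ((e1 + αt) + (g1 + βt) * (x-m)) ((e2 + αt') + (g2 + βt') * (x-m))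
          ((c1 + α) + (d1 + β) * (x-m)) ((c2 + α') + (d2 + β') * (x-m)) (d1 + β) (d2 + β') (α + β * (x-m)) (α' + β' * (x-m)))
        + (Bp - Bm) + 60 * K^2 * cellE k α α' β β' + 40 * K^2 * (k^7 + k^6 * I4) + 9 * k^6 * I3 + (Ir1 + Ir2) := by
  have K0 : 0 ≤ K := by linarith
  have D1 := cellA hP hk hk1 K0 HP (bP 2 (by norm_num)) (bP 3 le_rfl)
  have D2 := cellA hQ hk hk1 K0 HQ (bQ 2 (by norm_num)) (bQ 3 le_rfl)
  have sl1 := cellSlope hP hk hk1 K0 HP (bP 1 (by norm_num)) (bP 2 (by norm_num))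
  have sl2 := cellSlope hQ hk hk1 K0 HQ (bQ 1 (by norm_num)) (bQ 2 (by norm_num))
  have cp := hP.cont 0
  have cq := hQ.cont 0
  have cp1 := hP.cont 1
  have cq1 := hQ.cont 1
  have cpt := hPt.cont 0
  have cqt := hQt.cont 0
  have cf1 := f1_cont hP hQ
  have cf2 := f2_cont hP hQ
  have prod : ∀ y z : ℝ, |y| ≤ 4 * K * k^2 → |z| ≤ 4 * K * k^2 → |y * z| ≤ 16 * K^2 * k^4 := by
    intro y z hy hz
    rw [abs_mul]
    calc |y| * |z| ≤ (4 * K * k^2) * (4 * K * k^2) := mul_le_mul hy hz (abs_nonneg _) (by positivity)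
      _ = _ := by ring
  have pK : 0 ≤ 16 * K^2 * k^4 := by positivity
  -- flux terms
  have F1 := fluxGen hP hQ hk hk1 hK HP HQ bP bQ (A := fun x => 1/2 * Q 0 x) (A1 := fun x => 1/2 * Q 1 x) (A2 := fun x => 1/2 * Q 2 x)
    (B := fun x => 1 + 1/2 * P 0 x) (B1 := fun x => 1/2 * P 1 x) (B2 := fun x => 1/2 * P 2 x)
    (R := fun x => -(1/2 * ((P 0 x - (c1 + d1 * (x-m))) * (Q 0 x - (c2 + d2 * (x-m))))))
    (fun x => (hQ 0 x).const_mul _) (fun x => (hQ 1 x).const_mul _)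
    (fun x => ((hP 0 x).const_mul _).const_add _) (fun x => (hP 1 x).const_mul _)
    (fun x hx => by have := abs_le.1 (bQ 0 (by norm_num) x hx); rw [abs_le]; constructor <;> linarith)
    (fun x hx => by have := abs_le.1 (bQ 1 (by norm_num) x hx); rw [abs_le]; constructor <;> linarith)
    (fun x hx => by have := abs_le.1 (bQ 2 (by norm_num) x hx); rw [abs_le]; constructor <;> linarith)
    (fun x hx => by have := abs_le.1 (bP 0 (by norm_num) x hx); rw [abs_le]; constructor <;> linarith)
    (fun x hx => by have := abs_le.1 (bP 1 (by norm_num) x hx); rw [abs_le]; constructor <;> linarith)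
    (fun x hx => by have := abs_le.1 (bP 2 (by norm_num) x hx); rw [abs_le]; constructor <;> linarith)
    (by fun_prop)
    (fun x hx => by have := abs_le.1 (prod _ _ (D1 x hx) (D2 x hx)); rw [abs_le]; constructor <;> linarith) (-β)
  have F2 := fluxGen hP hQ hk hk1 hK HP HQ bP bQ (A := fun x => 1 + 1/2 * P 0 x) (A1 := fun x => 1/2 * P 1 x) (A2 := fun x => 1/2 * P 2 x)
    (B := fun x => 3/2 * Q 0 x) (B1 := fun x => 3/2 * Q 1 x) (B2 := fun x => 3/2 * Q 2 x)
    (R := fun x => -(3/4 * ((Q 0 x - (c2 + d2 * (x-m))) * (Q 0 x - (c2 + d2 * (x-m)))))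
      - 1/4 * ((P 0 x - (c1 + d1 * (x-m))) * (P 0 x - (c1 + d1 * (x-m)))))
    (fun x => ((hP 0 x).const_mul _).const_add _) (fun x => (hP 1 x).const_mul _)
    (fun x => (hQ 0 x).const_mul _) (fun x => (hQ 1 x).const_mul _)
    (fun x hx => by have := abs_le.1 (bP 0 (by norm_num) x hx); rw [abs_le]; constructor <;> linarith)
    (fun x hx => by have := abs_le.1 (bP 1 (by norm_num) x hx); rw [abs_le]; constructor <;> linarith)
    (fun x hx => by have := abs_le.1 (bP 2 (by norm_num) x hx); rw [abs_le]; constructor <;> linarith)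
    (fun x hx => by have := abs_le.1 (bQ 0 (by norm_num) x hx); rw [abs_le]; constructor <;> linarith)
    (fun x hx => by have := abs_le.1 (bQ 1 (by norm_num) x hx); rw [abs_le]; constructor <;> linarith)
    (fun x hx => by have := abs_le.1 (bQ 2 (by norm_num) x hx); rw [abs_le]; constructor <;> linarith)
    (by fun_prop)
    (fun x hx => by
      have := abs_le.1 (prod _ _ (D1 x hx) (D1 x hx)); have := abs_le.1 (prod _ _ (D2 x hx) (D2 x hx))
      rw [abs_le]; constructor <;> linarith) (-β')
  have T1 := cellB hPt hk HPt α β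
  have T2 := cellB hQt hk HQt α' β'
  rw [hI4] at F1 F2
  -- derivative of the boundary flux
  let G : ℝ → ℝ := fun x => GI ((e1 + αt) + (g1 + βt) * (x-m)) ((e2 + αt') + (g2 + βt') * (x-m))
          ((c1 + α) + (d1 + β) * (x-m)) ((c2 + α') + (d2 + β') * (x-m)) (d1 + β) (d2 + β') (α + β * (x-m)) (α' + β' * (x-m))
  have cG : Continuous G := by simp only [G, GI]; fun_prop
  let th : ℝ → ℝ := fun x => α + β * (x-m)
  let xi : ℝ → ℝ := fun x => α' + β' * (x-m)
  let w : ℝ → ℝ := fun x => c1 + d1 * (x-m)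
  let v : ℝ → ℝ := fun x => c2 + d2 * (x-m)
  let B' : ℝ → ℝ := fun x => ((Q 1 x + 1/2 * (P 1 x * Q 0 x + P 0 x * Q 1 x)) * th x + (P 1 x + 3/2 * (Q 0 x * Q 1 x) + 1/2 * (P 0 x * P 1 x)) * xi x
       - (d2 + β' + 1/2 * ((d1 + β) * (v x + xi x) + (w x + th x) * (d2 + β'))) * th x
       - (d1 + β + 3/2 * ((v x + xi x) * (d2 + β')) + 1/2 * ((w x + th x) * (d1 + β))) * xi x
       + ((Q 0 x + 1/2 * (P 0 x * Q 0 x)) - (v x + 1/2 * (w x * v x))) * β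
       + ((P 0 x + 3/4 * (Q 0 x * Q 0 x) + 1/4 * (P 0 x * P 0 x)) - (w x + 3/4 * (v x * v x) + 1/4 * (w x * w x))) * β'
       + (1/2 * d1 * (th x * xi x) + 1/4 * d2 * (th x)^2 + 3/4 * d2 * (xi x)^2))
  have hB' : ∀ x, HasDerivAt (fun x => Bv (P 0 x) (Q 0 x) (w x) (v x) (th x) (xi x)) (B' x) x := fun x =>
    Bv_deriv (hP 0 x) (hQ 0 x) (hD_lin c1 d1 m x) (hD_lin c2 d2 m x) (hD_lin α β m x) (hD_lin α' β' m x)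
  have cB' : Continuous B' := by simp only [B', th, xi, w, v]; fun_prop
  have iB : ∫ x in (m-k)..(m+k), B' x = Bp - Bm := by
    rw [intervalIntegral.integral_eq_sub_of_hasDerivAt (fun x _ => hB' x) (cB'.intervalIntegrable _ _), ← hBp, ← hBm]
    simp only [w, v, th, xi]
    congr 1 <;> congr 1 <;> ring
  -- the functions
  let X1 : ℝ → ℝ := fun x => (Pt 0 x - (e1 + g1 * (x - m))) * (α + β * (x - m))
  let X2 : ℝ → ℝ := fun x => (Qt 0 x - (e2 + g2 * (x - m))) * (α' + β' * (x - m))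
  let Y1 : ℝ → ℝ := fun x => (1/2 * Q 0 x) * (P 0 x - (c1 + d1 * (x - m))) + (1 + 1/2 * P 0 x) * (Q 0 x - (c2 + d2 * (x - m)))
     + -(1/2 * ((P 0 x - (c1 + d1 * (x-m))) * (Q 0 x - (c2 + d2 * (x-m)))))
  let Y2 : ℝ → ℝ := fun x => (1 + 1/2 * P 0 x) * (P 0 x - (c1 + d1 * (x - m))) + (3/2 * Q 0 x) * (Q 0 x - (c2 + d2 * (x - m)))
     + (-(3/4 * ((Q 0 x - (c2 + d2 * (x-m))) * (Q 0 x - (c2 + d2 * (x-m)))))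
      - 1/4 * ((P 0 x - (c1 + d1 * (x-m))) * (P 0 x - (c1 + d1 * (x-m)))))
  let R1 : ℝ → ℝ := fun x => (Pt 0 x + f1 P Q x)^2
  let R2 : ℝ → ℝ := fun x => (Qt 0 x + f2 P Q x)^2
  have cX1 : Continuous X1 := by simp only [X1]; fun_prop
  have cX2 : Continuous X2 := by simp only [X2]; fun_prop
  have cY1 : Continuous Y1 := by simp only [Y1]; fun_prop
  have cY2 : Continuous Y2 := by simp only [Y2]; fun_prop
  have cR1 : Continuous R1 := by simp only [R1]; fun_prop
  have cR2 : Continuous R2 := by simp only [R2]; fun_prop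
  have key := cint_mono (m := m) (k := k) hk.le
    (f := fun x => (α + β * (x-m)) * (αt + βt * (x-m)) + (α' + β' * (x-m)) * (αt' + βt' * (x-m)))
    (g := fun x => G x + B' x + X1 x + X2 x + (-β) * Y1 x + (-β') * Y2 x + 1/2 * R1 x + 1/2 * R2 x
      + (3 * K) * ((α + β * (x-m)) * (α + β * (x-m))) + (3 * K) * ((α' + β' * (x-m)) * (α' + β' * (x-m))))
    (by fun_prop) (by fun_prop) (by
      intro x hx
      have h := pw_bd (a := th x) (b := xi x) (r1 := Pt 0 x + f1 P Q x) (r2 := Qt 0 x + f2 P Q x) hK sl1 sl2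
      refine le_of_sub_nonneg ?_
      have := sub_nonneg.2 h
      refine this.trans (le_of_eq ?_)
      simp only [G, GI, B', X1, X2, Y1, Y2, R1, R2, th, xi, w, v, f1, f2]
      ring)
  have ii : ∀ {f : ℝ → ℝ}, Continuous f → IntervalIntegrable f MeasureTheory.volume (m-k) (m+k) := fun h => h.intervalIntegrable _ _
  rw [intervalIntegral.integral_add (ii (by fun_prop)) (ii (by fun_prop)), Lint2, Lint2] at key
  have eG : ∫ x in (m-k)..(m+k), (G x + B' x + X1 x + X2 x + (-β) * Y1 x + (-β') * Y2 x + 1/2 * R1 x + 1/2 * R2 x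
      + (3 * K) * ((α + β * (x-m)) * (α + β * (x-m))) + (3 * K) * ((α' + β' * (x-m)) * (α' + β' * (x-m)))) =
      (∫ x in (m-k)..(m+k), G x) + (Bp - Bm) + (∫ x in (m-k)..(m+k), X1 x) + (∫ x in (m-k)..(m+k), X2 x)
       + (-β) * (∫ x in (m-k)..(m+k), Y1 x) + (-β') * (∫ x in (m-k)..(m+k), Y2 x) + 1/2 * Ir1 + 1/2 * Ir2
       + (3*K) * (2 * k * (α * α) + 2/3 * k^3 * (β * β)) + (3*K) * (2 * k * (α' * α') + 2/3 * k^3 * (β' * β')) := by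
    rw [intervalIntegral.integral_add (ii (by fun_prop)) (ii (by fun_prop)), intervalIntegral.integral_add (ii (by fun_prop)) (ii (by fun_prop)),
      intervalIntegral.integral_add (ii (by fun_prop)) (ii (by fun_prop)), intervalIntegral.integral_add (ii (by fun_prop)) (ii (by fun_prop)),
      intervalIntegral.integral_add (ii (by fun_prop)) (ii (by fun_prop)), intervalIntegral.integral_add (ii (by fun_prop)) (ii (by fun_prop)),
      intervalIntegral.integral_add (ii (by fun_prop)) (ii (by fun_prop)), intervalIntegral.integral_add (ii (by fun_prop)) (ii (by fun_prop)),
      intervalIntegral.integral_add (ii (by fun_prop)) (ii (by fun_prop)), intervalIntegral.integral_const_mul,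
      intervalIntegral.integral_const_mul, intervalIntegral.integral_const_mul, intervalIntegral.integral_const_mul,
      intervalIntegral.integral_const_mul, intervalIntegral.integral_const_mul, Lint2, Lint2, iB]
    rw [← hr1, ← hr2]
  rw [eG] at key
  have F1' : (-β) * (∫ x in (m-k)..(m+k), Y1 x) ≤ _ := F1
  have F2' : (-β') * (∫ x in (m-k)..(m+k), Y2 x) ≤ _ := F2
  have T1' : (∫ x in (m-k)..(m+k), X1 x) ≤ _ := T1
  have T2' : (∫ x in (m-k)..(m+k), X2 x) ≤ _ := T2
  have KK : K ≤ K^2 := by nlinarith only [hK]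
  have rr1 : 0 ≤ Ir1 := by rw [← hr1]; exact intervalIntegral.integral_nonneg (by linarith) fun x _ => sq_nonneg _
  have rr2 : 0 ≤ Ir2 := by rw [← hr2]; exact intervalIntegral.integral_nonneg (by linarith) fun x _ => sq_nonneg _
  have II4 : 0 ≤ I4 := by
    rw [← hI4]
    exact add_nonneg (intervalIntegral.integral_nonneg (by linarith) fun x _ => sq_nonneg _) (intervalIntegral.integral_nonneg (by linarith) fun x _ => sq_nonneg _)
  change _ ≤ (∫ x in (m-k)..(m+k), G x) + _ + _ + _ + _ + _
  have E0 : cellE k α α' β β' = 2 * k * (α^2 + α'^2) + 2/3 * k^3 * (β^2 + β'^2) := rfl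
  have EN : 0 ≤ cellE k α α' β β' := by rw [E0]; positivity
  have a1 : 3 * K * cellE k α α' β β' ≤ 3 * K^2 * cellE k α α' β β' := mul_le_mul_of_nonneg_right (by linarith) EN
  have a2 : K^2 * (k^3 * (β^2 + β'^2)) ≤ 3/2 * (K^2 * cellE k α α' β β') := by
    have : 0 ≤ K^2 * (k * (α^2 + α'^2)) := by positivity
    rw [E0]; nlinarith only [this]
  have a3 : cellE k α α' β β' ≤ K^2 * cellE k α α' β β' := by nlinarith only [EN, hK, KK]
  have a4 : 0 ≤ K^2 * (k^6 * I4) := by positivity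
  have a5 : 0 ≤ K^2 * cellE k α α' β β' := by positivity
  rw [← hI3]
  rw [E0] at a1 a2 a3 a5 ⊢
  linarith only [key, F1', F2', T1', T2', a1, a2, a3, a4, a5, rr1, rr2]

def hk (N : ℕ) : ℝ := 1/(2*(N:ℝ))
def md (N j : ℕ) : ℝ := ((j:ℝ)+1/2)/N
def al (c : ℕ → ℝ) (j : ℕ) : ℝ := (c (j+1) + c j)/2
def be (N : ℕ) (c : ℕ → ℝ) (j : ℕ) : ℝ := (c (j+1) - c j) * N
def nd (N : ℕ) (f : ℝ → ℝ) (j : ℕ) : ℝ := f ((j:ℝ)/N)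
abbrev SH (N : ℕ) : Set (ℝ → ℝ) := Sh N 2 0 (fun i => (i : ℝ)/N)
abbrev SH0 (N : ℕ) : Set (ℝ → ℝ) := Sh0 N 2 0 (fun i => (i : ℝ)/N)

theorem hk_pos {N : ℕ} (hN : 0 < N) : 0 < hk N := by
  have : (0:ℝ) < N := by exact_mod_cast hN
  unfold hk; positivity

theorem N_hk {N : ℕ} (hN : 0 < N) : (N:ℝ) * hk N = 1/2 := by
  have : (0:ℝ) < N := by exact_mod_cast hN
  unfold hk; field_simp

theorem hk_le {N : ℕ} (hN : 0 < N) : hk N ≤ 1 := by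
  have := N_hk hN
  have h1 : (1:ℝ) ≤ N := by exact_mod_cast hN
  nlinarith [hk_pos hN]

theorem md_sub {N : ℕ} (hN : 0 < N) (j : ℕ) : md N j - hk N = (j:ℝ)/N := by
  have : (0:ℝ) < N := by exact_mod_cast hN
  unfold hk md; field_simp; ring

theorem md_add {N : ℕ} (hN : 0 < N) (j : ℕ) : md N j + hk N = ((j+1:ℕ):ℝ)/N := by
  have : (0:ℝ) < N := by exact_mod_cast hN
  unfold hk md; push_cast; field_simp; ring

theorem node_mem {N : ℕ} (hN : 0 < N) {j : ℕ} (hj : j ≤ N) : (j:ℝ)/N ∈ Icc (0:ℝ) 1 := by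
  have : (0:ℝ) < N := by exact_mod_cast hN
  have h2 : (j:ℝ) ≤ N := by exact_mod_cast hj
  exact ⟨by positivity, by rw [div_le_one this]; exact h2⟩

theorem cell_sub {N : ℕ} (hN : 0 < N) {j : ℕ} (hj : j < N) : Icc (md N j - hk N) (md N j + hk N) ⊆ Icc (0:ℝ) 1 := by
  rw [md_sub hN, md_add hN]
  exact Icc_subset_Icc (node_mem hN hj.le).1 (node_mem hN hj).2

theorem albe_p {N : ℕ} (hN : 0 < N) (c : ℕ → ℝ) (j : ℕ) : al c j + be N c j * hk N = c (j+1) := by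
  unfold al be; linear_combination (c (j+1) - c j) * N_hk hN

theorem albe_m {N : ℕ} (hN : 0 < N) (c : ℕ → ℝ) (j : ℕ) : al c j - be N c j * hk N = c j := by
  unfold al be; linear_combination (-(c (j+1) - c j)) * N_hk hN

theorem Sh_aff {N : ℕ} (hN : 0 < N) {f : ℝ → ℝ} (hf : f ∈ SH N) {j : ℕ} (hj : j < N) :
    ∀ y ∈ Icc (md N j - hk N) (md N j + hk N), f y = al (nd N f) j + be N (nd N f) j * (y - md N j) := by
  obtain ⟨p, hp, he⟩ := hf.2 j hj
  obtain ⟨a, b, rfl⟩ := Polynomial.exists_eq_X_add_C_of_natDegree_le_one hp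
  simp only [Polynomial.eval_add, Polynomial.eval_mul, Polynomial.eval_C, Polynomial.eval_X] at he
  rw [← md_sub hN, ← md_add hN] at he
  have k0 := hk_pos hN
  have h1 := he (md N j - hk N) ⟨le_rfl, by linarith⟩
  have h2 := he (md N j + hk N) ⟨by linarith, le_rfl⟩
  have e1 : nd N f j = a * (md N j - hk N) + b := by rw [← h1, md_sub hN]; rfl
  have e2 : nd N f (j+1) = a * (md N j + hk N) + b := by rw [← h2, md_add hN]; rfl
  intro y hy
  rw [he y hy]
  unfold al be
  rw [e1, e2]
  linear_combination (-2 * a * (y - md N j)) * N_hk hN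

theorem Sh_deriv {N : ℕ} (hN : 0 < N) {f : ℝ → ℝ} (hf : f ∈ SH N) {j : ℕ} (hj : j < N) :
    ∀ y ∈ Ioo (md N j - hk N) (md N j + hk N), HasDerivAt f (be N (nd N f) j) y := by
  intro y hy
  refine (hD_lin (al (nd N f) j) (be N (nd N f) j) (md N j) y).congr_of_eventuallyEq ?_
  filter_upwards [Icc_mem_nhds hy.1 hy.2] with z hz
  exact Sh_aff hN hf hj z hz

theorem cellsum {N : ℕ} (hN : 0 < N) {F : ℝ → ℝ} {G : ℕ → ℝ → ℝ}
    (hG : ∀ j < N, ContinuousOn (G j) (Icc (md N j - hk N) (md N j + hk N)))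
    (h : ∀ j < N, ∀ y ∈ Ioo (md N j - hk N) (md N j + hk N), F y = G j y) :
    (∫ y in (0:ℝ)..1, F y) = ∑ j ∈ Finset.range N, ∫ y in (md N j - hk N)..(md N j + hk N), G j y := by
  have k0 := hk_pos hN
  have hN' : (0:ℝ) < N := by exact_mod_cast hN
  have le : ∀ j, md N j - hk N ≤ md N j + hk N := fun j => by linarith
  have gi : ∀ j < N, IntervalIntegrable (G j) MeasureTheory.volume (md N j - hk N) (md N j + hk N) := fun j hj =>
    ContinuousOn.intervalIntegrable (by rw [uIcc_of_le (le j)]; exact hG j hj)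
  have eq : ∀ j < N, EqOn F (G j) (uIoo (md N j - hk N) (md N j + hk N)) := fun j hj => by
    rw [uIoo_of_le (le j)]; exact h j hj
  have fi : ∀ j < N, IntervalIntegrable F MeasureTheory.volume (((j:ℕ):ℝ)/N) (((j+1:ℕ):ℝ)/N) := fun j hj => by
    rw [← md_sub hN, ← md_add hN]
    exact (intervalIntegrable_congr_uIoo (eq j hj)).2 (gi j hj)
  have s := intervalIntegral.sum_integral_adjacent_intervals (a := fun j : ℕ => (j:ℝ)/N) fi
  simp only [Nat.cast_zero, zero_div, div_self hN'.ne'] at s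
  rw [← s]
  refine Finset.sum_congr rfl fun j hj => ?_
  have hj := Finset.mem_range.1 hj
  rw [← md_sub hN, ← md_add hN]
  exact intervalIntegral.integral_congr_uIoo (eq j hj)

theorem cellsum_cont {N : ℕ} (hN : 0 < N) {F : ℝ → ℝ} (hF : Continuous F) :
    ∑ j ∈ Finset.range N, ∫ y in (md N j - hk N)..(md N j + hk N), F y = (∫ y in (0:ℝ)..1, F y) :=
  (cellsum hN (fun _ _ => hF.continuousOn) (fun _ _ _ _ => rfl)).symm

/-- ramps -/
def ramp (c : ℕ → ℝ) (n : ℕ) (z : ℝ) : ℝ := c 0 + ∑ i ∈ Finset.range n, (c (i+1) - c i) * max 0 (min 1 (z - i))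

theorem ramp_spec (c : ℕ → ℝ) (n : ℕ) : (∀ z, (n:ℝ) ≤ z → ramp c n z = c n) ∧
    ∀ j < n, ∀ z ∈ Icc (j:ℝ) (j+1), ramp c n z = c j + (c (j+1) - c j) * (z - j) := by
  induction n with
  | zero => exact ⟨fun z _ => by simp [ramp], fun j hj => absurd hj (Nat.not_lt_zero _)⟩
  | succ n ih =>
    have e : ∀ z, ramp c (n+1) z = ramp c n z + (c (n+1) - c n) * max 0 (min 1 (z - n)) := fun z => by
      unfold ramp; rw [Finset.sum_range_succ]; ring
    constructor
    · intro z hz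
      push_cast at hz
      rw [e, ih.1 z (by linarith), min_eq_left (by linarith), max_eq_right zero_le_one]; ring
    · intro j hj z hz
      rcases Nat.lt_succ_iff_lt_or_eq.1 hj with h | h
      · have : (j:ℝ) + 1 ≤ n := by exact_mod_cast h
        rw [e, ih.2 j h z hz, max_eq_left ((min_le_right _ _).trans (by linarith [hz.2]))]; ring
      · subst h
        rw [e, ih.1 z hz.1, min_eq_right (by linarith [hz.2]), max_eq_right (by linarith [hz.1])]

theorem interpSh {N : ℕ} (hN : 0 < N) (c : ℕ → ℝ) : ∃ φ ∈ SH N, ∀ j ≤ N, nd N φ j = c j := by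
  have hN' : (0:ℝ) < N := by exact_mod_cast hN
  have R := ramp_spec c N
  refine ⟨fun y => ramp c N (N * y), ⟨?_, ?_⟩, ?_⟩
  · have : Continuous (fun y : ℝ => ramp c N (N * y)) := by unfold ramp; fun_prop
    exact contDiffOn_zero.2 this.continuousOn
  · intro j hj
    refine ⟨Polynomial.C ((c (j+1) - c j) * N) * Polynomial.X + Polynomial.C (c j - (c (j+1) - c j) * j),
      Polynomial.natDegree_linear_le, ?_⟩
    intro y hy
    simp only [Polynomial.eval_add, Polynomial.eval_mul, Polynomial.eval_C, Polynomial.eval_X]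
    have h1 := hy.1; have h2 := hy.2
    rw [div_le_iff₀ hN'] at h1
    rw [le_div_iff₀ hN'] at h2
    push_cast at h2
    rw [R.2 j hj (N * y) ⟨by linarith, by linarith⟩]
    ring
  · intro j hj
    unfold nd
    have e : (N:ℝ) * ((j:ℝ)/N) = j := by field_simp
    simp only [e]
    rcases hj.lt_or_eq with h | h
    · rw [R.2 j h j ⟨le_rfl, by linarith⟩]; ring
    · subst h; exact R.1 _ le_rfl

theorem interpSh0 {N : ℕ} (hN : 0 < N) (c : ℕ → ℝ) (h0 : c 0 = 0) (h1 : c N = 0) : ∃ φ ∈ SH0 N, ∀ j ≤ N, nd N φ j = c j := by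
  obtain ⟨φ, hφ, h⟩ := interpSh hN c
  have hN' : (0:ℝ) < N := by exact_mod_cast hN
  refine ⟨φ, ⟨hφ, ?_, ?_⟩, h⟩
  · have := h 0 (Nat.zero_le _); rw [h0] at this; simpa [nd] using this
  · have := h N le_rfl; rw [h1] at this; simpa [nd, div_self hN'.ne'] using this

theorem al_congr {N : ℕ} {c d : ℕ → ℝ} (h : ∀ j ≤ N, c j = d j) {j : ℕ} (hj : j < N) : al c j = al d j := by
  unfold al; rw [h j hj.le, h (j+1) hj]

theorem be_congr {N : ℕ} {c d : ℕ → ℝ} (h : ∀ j ≤ N, c j = d j) {j : ℕ} (hj : j < N) : be N c j = be N d j := by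
  unfold be; rw [h j hj.le, h (j+1) hj]

theorem al_sub (c d : ℕ → ℝ) (j : ℕ) : al (fun i => c i - d i) j = al c j - al d j := by unfold al; ring

theorem be_sub (N : ℕ) (c d : ℕ → ℝ) (j : ℕ) : be N (fun i => c i - d i) j = be N c j - be N d j := by unfold be; ring

/-- nodal values of the quasi-interpolant -/
def zz (N : ℕ) (P : ℕ → ℝ → ℝ) (j : ℕ) : ℝ := P 0 ((j:ℝ)/N) - hk N^2/3 * P 2 ((j:ℝ)/N)

theorem zz_coef {N : ℕ} (hN : 0 < N) (P : ℕ → ℝ → ℝ) (j : ℕ) : Coef P (md N j) (hk N) (al (zz N P) j) (be N (zz N P) j) := by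
  constructor
  · rw [albe_p hN, md_add hN]; rfl
  · rw [albe_m hN, md_sub hN]; rfl

/-- affine piece on cell `j` -/
def pc (N : ℕ) (c : ℕ → ℝ) (j : ℕ) (y : ℝ) : ℝ := al c j + be N c j * (y - md N j)

theorem pc_cont (N : ℕ) (c : ℕ → ℝ) (j : ℕ) : Continuous (pc N c j) := by unfold pc; fun_prop

theorem galSum {N : ℕ} (hN : 0 < N) {η u dη du φ χ : ℝ → ℝ} (hη : η ∈ SH N) (hu : u ∈ SH N) (hdη : dη ∈ SH N) (hdu : du ∈ SH N)
    (hφ : φ ∈ SH N) (hχ : χ ∈ SH N)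
    (g1 : ip dη φ + ip (deriv u) φ + (1/2) * ip (deriv (fun y => η y * u y)) φ = 0)
    (g2 : ip du χ + ip (deriv η) χ + (3/2) * ip (fun y => u y * deriv u y) χ + (1/2) * ip (fun y => η y * deriv η y) χ = 0) :
    ∑ j ∈ Finset.range N, ∫ y in (md N j - hk N)..(md N j + hk N), GI (pc N (nd N dη) j y) (pc N (nd N du) j y)
      (pc N (nd N η) j y) (pc N (nd N u) j y) (be N (nd N η) j) (be N (nd N u) j) (pc N (nd N φ) j y) (pc N (nd N χ) j y) = 0 := by
  have pcc : ∀ c j, Continuous (pc N c j) := pc_cont N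
  have a1 : ip dη φ = _ := cellsum hN (G := fun j y => pc N (nd N dη) j y * pc N (nd N φ) j y)
    (fun j _ => ((pcc _ j).mul (pcc _ j)).continuousOn) (fun j hj y hy => by
      rw [Sh_aff hN hdη hj y (Ioo_subset_Icc_self hy), Sh_aff hN hφ hj y (Ioo_subset_Icc_self hy)]; rfl)
  have a2 : ip (deriv u) φ = _ := cellsum hN (G := fun j y => be N (nd N u) j * pc N (nd N φ) j y)
    (fun j _ => (continuous_const.mul (pcc _ j)).continuousOn) (fun j hj y hy => by
      rw [(Sh_deriv hN hu hj y hy).deriv, Sh_aff hN hφ hj y (Ioo_subset_Icc_self hy)]; rfl)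
  have a3 : ip (deriv (fun y => η y * u y)) φ = _ := cellsum hN (G := fun j y =>
      (be N (nd N η) j * pc N (nd N u) j y + pc N (nd N η) j y * be N (nd N u) j) * pc N (nd N φ) j y)
    (fun j _ => ((((continuous_const.mul (pcc _ j))).add ((pcc _ j).mul continuous_const)).mul (pcc _ j)).continuousOn) (fun j hj y hy => by
      have : deriv (fun y => η y * u y) y = _ := ((Sh_deriv hN hη hj y hy).mul (Sh_deriv hN hu hj y hy)).deriv
      rw [this, Sh_aff hN hφ hj y (Ioo_subset_Icc_self hy), Sh_aff hN hη hj y (Ioo_subset_Icc_self hy), Sh_aff hN hu hj y (Ioo_subset_Icc_self hy)]; rfl)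
  have a4 : ip du χ = _ := cellsum hN (G := fun j y => pc N (nd N du) j y * pc N (nd N χ) j y)
    (fun j _ => ((pcc _ j).mul (pcc _ j)).continuousOn) (fun j hj y hy => by
      rw [Sh_aff hN hdu hj y (Ioo_subset_Icc_self hy), Sh_aff hN hχ hj y (Ioo_subset_Icc_self hy)]; rfl)
  have a5 : ip (deriv η) χ = _ := cellsum hN (G := fun j y => be N (nd N η) j * pc N (nd N χ) j y)
    (fun j _ => (continuous_const.mul (pcc _ j)).continuousOn) (fun j hj y hy => by
      rw [(Sh_deriv hN hη hj y hy).deriv, Sh_aff hN hχ hj y (Ioo_subset_Icc_self hy)]; rfl)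
  have a6 : ip (fun y => u y * deriv u y) χ = _ := cellsum hN (G := fun j y => (pc N (nd N u) j y * be N (nd N u) j) * pc N (nd N χ) j y)
    (fun j _ => (((pcc _ j).mul continuous_const).mul (pcc _ j)).continuousOn) (fun j hj y hy => by
      simp only
      rw [(Sh_deriv hN hu hj y hy).deriv, Sh_aff hN hχ hj y (Ioo_subset_Icc_self hy), Sh_aff hN hu hj y (Ioo_subset_Icc_self hy)]; rfl)
  have a7 : ip (fun y => η y * deriv η y) χ = _ := cellsum hN (G := fun j y => (pc N (nd N η) j y * be N (nd N η) j) * pc N (nd N χ) j y)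
    (fun j _ => (((pcc _ j).mul continuous_const).mul (pcc _ j)).continuousOn) (fun j hj y hy => by
      simp only
      rw [(Sh_deriv hN hη hj y hy).deriv, Sh_aff hN hχ hj y (Ioo_subset_Icc_self hy), Sh_aff hN hη hj y (Ioo_subset_Icc_self hy)]; rfl)
  have tot := congrArg₂ (fun a b : ℝ => a + b) g1 g2
  simp only [add_zero] at tot
  rw [a1, a2, a3, a4, a5, a6, a7] at tot
  rw [Finset.mul_sum, Finset.mul_sum, Finset.mul_sum] at tot
  simp only [← Finset.sum_add_distrib] at tot
  rw [← tot]
  refine Finset.sum_congr rfl fun j _ => ?_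
  have c1 := pcc (nd N dη) j
  have c2 := pcc (nd N du) j
  have c3 := pcc (nd N η) j
  have c4 := pcc (nd N u) j
  have c5 := pcc (nd N φ) j
  have c6 := pcc (nd N χ) j
  have ii : ∀ {f : ℝ → ℝ}, Continuous f → IntervalIntegrable f MeasureTheory.volume (md N j - hk N) (md N j + hk N) := fun h => h.intervalIntegrable _ _
  rw [← intervalIntegral.integral_const_mul, ← intervalIntegral.integral_const_mul, ← intervalIntegral.integral_const_mul,
    ← intervalIntegral.integral_add (ii (by fun_prop)) (ii (by fun_prop)), ← intervalIntegral.integral_add (ii (by fun_prop)) (ii (by fun_prop)),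
    ← intervalIntegral.integral_add (ii (by fun_prop)) (ii (by fun_prop)), ← intervalIntegral.integral_add (ii (by fun_prop)) (ii (by fun_prop)),
    ← intervalIntegral.integral_add (ii (by fun_prop)) (ii (by fun_prop)), ← intervalIntegral.integral_add (ii (by fun_prop)) (ii (by fun_prop))]
  refine intervalIntegral.integral_congr fun y _ => ?_
  simp only [GI]
  ring

/-- initial error -/
theorem initErr {N : ℕ} (hN : 0 < N) {f fh φ : ℝ → ℝ} {P : ℕ → ℝ → ℝ} (hP : IsJet P) {K ε : ℝ} (hK : 0 ≤ K) (hε : 0 ≤ ε)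
    (hf : ContinuousOn f (Icc 0 1)) (hfh : fh ∈ SH N) (hφ : φ ∈ SH N) (hn : ∀ j ≤ N, nd N φ j = nd N fh j - zz N P j)
    (h3 : ∀ x ∈ Icc (0:ℝ) 1, |P 3 x| ≤ K) (hcl : ∀ x ∈ Icc (0:ℝ) 1, |f x - P 0 x| ≤ ε)
    (hip : ip (fun y => f y - fh y) φ = 0) :
    ∑ j ∈ Finset.range N, (2 * hk N * (al (fun i => nd N fh i - zz N P i) j)^2 + 2/3 * hk N^3 * (be N (fun i => nd N fh i - zz N P i) j)^2)
      ≤ 36 * K^2 * hk N^6 + 4 * ε^2 := by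
  have k0 := hk_pos hN
  set θ : ℕ → ℝ := fun i => nd N fh i - zz N P i with hθ
  have sub := fun {j} (hj : j < N) => cell_sub hN hj
  have a1 : ip (fun y => f y - fh y) φ = _ := cellsum hN (G := fun j y => (f y - pc N (nd N fh) j y) * pc N θ j y)
    (fun j hj => ((hf.mono (sub hj)).sub (pc_cont _ _ j).continuousOn).mul (pc_cont _ _ j).continuousOn) (fun j hj y hy => by
      have h1 := Sh_aff hN hfh hj y (Ioo_subset_Icc_self hy)
      have h2 := Sh_aff hN hφ hj y (Ioo_subset_Icc_self hy)
      rw [al_congr hn hj, be_congr hn hj] at h2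
      simp only
      rw [h1, h2]; rfl)
  rw [hip] at a1
  have cell : ∀ j ∈ Finset.range N, (∫ y in (md N j - hk N)..(md N j + hk N), (f y - pc N (nd N fh) j y) * pc N θ j y)
      ≤ - (1/4) * (2 * hk N * (al θ j)^2 + 2/3 * hk N^3 * (be N θ j)^2) + (18 * hk N^7 * K^2 + 2 * hk N * ε^2) := by
    intro j hj
    have hj := Finset.mem_range.1 hj
    have cB := cellB hP k0 (zz_coef hN P j) (al θ j) (be N θ j)
    have c0 := hP.cont 0
    have cθ := pc_cont N θ j
    have I3 : ∫ x in (md N j - hk N)..(md N j + hk N), P 3 x ^ 2 ≤ 2 * hk N * K^2 := by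
      refine (le_abs_self _).trans (cint_abs k0.le ?_)
      intro x hx
      rw [abs_pow]
      exact pow_le_pow_left₀ (abs_nonneg _) (h3 x (sub hj hx)) 2
    have m1 : (∫ y in (md N j - hk N)..(md N j + hk N), (f y - pc N (nd N fh) j y) * pc N θ j y)
      ≤ ∫ y in (md N j - hk N)..(md N j + hk N), ((P 0 y - (al (zz N P) j + be N (zz N P) j * (y - md N j))) * (al θ j + be N θ j * (y - md N j))
          + (-(3/4)) * ((al θ j + be N θ j * (y - md N j)) * (al θ j + be N θ j * (y - md N j))) + ε^2) := by
      refine intervalIntegral.integral_mono_on (by linarith) ?_ ((by fun_prop : Continuous _).intervalIntegrable _ _) ?_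
      · refine ContinuousOn.intervalIntegrable ?_
        rw [uIcc_of_le (by linarith)]
        exact ((hf.mono (sub hj)).sub (pc_cont _ _ j).continuousOn).mul (pc_cont _ _ j).continuousOn
      · intro y hy
        have e1 : pc N (nd N fh) j y = al (zz N P) j + be N (zz N P) j * (y - md N j) + pc N θ j y := by
          simp only [pc, hθ, al_sub, be_sub]; ring
        have e2 : al θ j + be N θ j * (y - md N j) = pc N θ j y := rfl
        rw [e1, e2]
        set t := pc N θ j y
        have c := hcl y (sub hj hy)
        have c2 : (f y - P 0 y)^2 ≤ ε^2 := by rw [← sq_abs]; exact pow_le_pow_left₀ (abs_nonneg _) c 2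
        nlinarith only [c2, sq_nonneg (f y - P 0 y - t/2)]
    refine m1.trans ?_
    rw [intervalIntegral.integral_add ((by fun_prop : Continuous _).intervalIntegrable _ _) (by simp),
      intervalIntegral.integral_add ((by fun_prop : Continuous _).intervalIntegrable _ _) ((by fun_prop : Continuous _).intervalIntegrable _ _),
      intervalIntegral.integral_const_mul, Lint2, intervalIntegral.integral_const, smul_eq_mul]
    have s3 : 9 * hk N^6 * (∫ x in (md N j - hk N)..(md N j + hk N), P 3 x ^ 2) ≤ 9 * hk N^6 * (2 * hk N * K^2) :=
      mul_le_mul_of_nonneg_left I3 (by positivity)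
    nlinarith only [cB, s3]
  have S := Finset.sum_le_sum cell
  rw [← a1, Finset.sum_add_distrib, ← Finset.mul_sum, Finset.sum_const, Finset.card_range, nsmul_eq_mul] at S
  have e : (N:ℝ) * (18 * hk N^7 * K^2 + 2 * hk N * ε^2) = 9 * hk N^6 * K^2 + ε^2 := by
    linear_combination (18 * hk N^6 * K^2 + 2 * ε^2) * N_hk hN
  rw [e] at S
  linarith only [S]

set_option maxHeartbeats 2000000 in
theorem stepSum {N : ℕ} (hN : 0 < N) {P Q Pt Qt : ℕ → ℝ → ℝ} (hP : IsJet P) (hQ : IsJet Q) (hPt : IsJet Pt) (hQt : IsJet Qt)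
    (vQ : Van 1 Q) {K : ℝ} (hK : 1 ≤ K) (bP : ∀ i ≤ 3, ∀ x ∈ Icc (0:ℝ) 1, |P i x| ≤ K) (bQ : ∀ i ≤ 3, ∀ x ∈ Icc (0:ℝ) 1, |Q i x| ≤ K)
    {η u dη du : ℝ → ℝ} (hη : η ∈ SH N) (hu : u ∈ SH0 N) (hdη : dη ∈ SH N) (hdu : du ∈ SH0 N)
    (g1 : ∀ φ ∈ SH N, ip dη φ + ip (deriv u) φ + (1/2) * ip (deriv (fun y => η y * u y)) φ = 0)
    (g2 : ∀ χ ∈ SH0 N, ip du χ + ip (deriv η) χ + (3/2) * ip (fun y => u y * deriv u y) χ + (1/2) * ip (fun y => η y * deriv η y) χ = 0)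
    {θ ξ θt ξt : ℕ → ℝ} (eθ : θ = fun i => nd N η i - zz N P i) (eξ : ξ = fun i => nd N u i - zz N Q i)
    (eθt : θt = fun i => nd N dη i - zz N Pt i) (eξt : ξt = fun i => nd N du i - zz N Qt i) :
    ∑ j ∈ Finset.range N, (2 * hk N * (al θ j * al θt j + al ξ j * al ξt j) + 2/3 * hk N^3 * (be N θ j * be N θt j + be N ξ j * be N ξt j))
     ≤ 60 * K^2 * (∑ j ∈ Finset.range N, cellE (hk N) (al θ j) (al ξ j) (be N θ j) (be N ξ j))
      + 40 * K^2 * (hk N^6/2 + hk N^6 * ∫ x in (0:ℝ)..1, (P 4 x^2 + Q 4 x^2))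
      + 9 * hk N^6 * ((∫ x in (0:ℝ)..1, Pt 3 x^2) + ∫ x in (0:ℝ)..1, Qt 3 x^2)
      + ((∫ x in (0:ℝ)..1, (Pt 0 x + f1 P Q x)^2) + ∫ x in (0:ℝ)..1, (Qt 0 x + f2 P Q x)^2) := by
  have hN' : (0:ℝ) < N := by exact_mod_cast hN
  have k0 := hk_pos hN
  have NN : (N:ℝ)/N = 1 := div_self hN'.ne'
  have q0 := vQ 0 (by decide)
  have q2 := vQ 2 (by decide)
  have zQ0 : zz N Q 0 = 0 := by simp [zz, q0.1, q2.1]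
  have zQN : zz N Q N = 0 := by simp [zz, NN, q0.2, q2.2]
  have ξ0 : ξ 0 = 0 := by rw [eξ]; simp [nd, hu.2.1, zQ0]
  have ξN : ξ N = 0 := by rw [eξ]; simp [nd, NN, hu.2.2, zQN]
  obtain ⟨φ, hφ, nφ⟩ := interpSh hN θ
  obtain ⟨χ, hχ, nχ⟩ := interpSh0 hN ξ ξ0 ξN
  have gal := galSum hN hη hu.1 hdη hdu.1 hφ hχ.1 (g1 φ hφ) (g2 χ hχ)
  let Bn : ℕ → ℝ := fun j => Bv (P 0 ((j:ℝ)/N)) (Q 0 ((j:ℝ)/N)) (zz N P j) (zz N Q j) (θ j) (ξ j)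
  have B0 : Bn 0 = 0 := by simp [Bn, Bv, ξ0, zQ0, q0.1]
  have BN : Bn N = 0 := by simp [Bn, Bv, ξN, zQN, q0.2, NN]
  have cell : ∀ j ∈ Finset.range N, _ ≤ _ := fun j hj =>
    cellThm hP hQ hPt hQt k0 (hk_le hN) hK (zz_coef hN P j) (zz_coef hN Q j) (zz_coef hN Pt j) (zz_coef hN Qt j)
      (fun i hi x hx => bP i hi x (cell_sub hN (Finset.mem_range.1 hj) hx)) (fun i hi x hx => bQ i hi x (cell_sub hN (Finset.mem_range.1 hj) hx))
      (al θ j) (be N θ j) (al ξ j) (be N ξ j) (al θt j) (be N θt j) (al ξt j) (be N ξt j) (Bp := Bn (j+1)) (Bm := Bn j) rfl rfl rfl rfl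
      (by rw [albe_p hN, albe_p hN, albe_p hN, albe_p hN, md_add hN])
      (by rw [albe_m hN, albe_m hN, albe_m hN, albe_m hN, md_sub hN])
  have S := Finset.sum_le_sum cell
  have p4 := hP.cont 4
  have q4 := hQ.cont 4
  have pt3 := hPt.cont 3
  have qt3 := hQt.cont 3
  have pt0 := hPt.cont 0
  have qt0 := hQt.cont 0
  have cf1 := f1_cont hP hQ
  have cf2 := f2_cont hP hQ
  simp only [Finset.sum_add_distrib, ← Finset.mul_sum] at S
  rw [Finset.sum_range_sub, B0, BN, cellsum_cont hN (by fun_prop), cellsum_cont hN (by fun_prop), cellsum_cont hN (by fun_prop),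
    cellsum_cont hN (by fun_prop), cellsum_cont hN (by fun_prop), cellsum_cont hN (by fun_prop), Finset.sum_const, Finset.card_range, nsmul_eq_mul] at S
  have eN : (N:ℝ) * hk N^7 = hk N^6/2 := by linear_combination hk N^6 * N_hk hN
  rw [eN] at S
  have gz : ∑ j ∈ Finset.range N, (∫ x in (md N j - hk N)..(md N j + hk N),
      GI ((al (zz N Pt) j + al θt j) + (be N (zz N Pt) j + be N θt j) * (x-md N j)) ((al (zz N Qt) j + al ξt j) + (be N (zz N Qt) j + be N ξt j) * (x-md N j))
          ((al (zz N P) j + al θ j) + (be N (zz N P) j + be N θ j) * (x-md N j)) ((al (zz N Q) j + al ξ j) + (be N (zz N Q) j + be N ξ j) * (x-md N j))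
          (be N (zz N P) j + be N θ j) (be N (zz N Q) j + be N ξ j) (al θ j + be N θ j * (x-md N j)) (al ξ j + be N ξ j * (x-md N j))) = 0 := by
    rw [← gal]
    refine Finset.sum_congr rfl fun j hj => ?_
    have hj := Finset.mem_range.1 hj
    simp only [pc]
    rw [al_congr nφ hj, be_congr nφ hj, al_congr nχ hj, be_congr nχ hj]
    have a1 : al (zz N Pt) j + al θt j = al (nd N dη) j := by rw [eθt, al_sub]; ring
    have a2 : be N (zz N Pt) j + be N θt j = be N (nd N dη) j := by rw [eθt, be_sub]; ring
    have a3 : al (zz N Qt) j + al ξt j = al (nd N du) j := by rw [eξt, al_sub]; ring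
    have a4 : be N (zz N Qt) j + be N ξt j = be N (nd N du) j := by rw [eξt, be_sub]; ring
    have a5 : al (zz N P) j + al θ j = al (nd N η) j := by rw [eθ, al_sub]; ring
    have a6 : be N (zz N P) j + be N θ j = be N (nd N η) j := by rw [eθ, be_sub]; ring
    have a7 : al (zz N Q) j + al ξ j = al (nd N u) j := by rw [eξ, al_sub]; ring
    have a8 : be N (zz N Q) j + be N ξ j = be N (nd N u) j := by rw [eξ, be_sub]; ring
    rw [a1, a2, a3, a4, a5, a6, a7, a8]
  rw [gz] at S
  have sp : ∫ x in (0:ℝ)..1, (P 4 x^2 + Q 4 x^2) = (∫ x in (0:ℝ)..1, P 4 x^2) + ∫ x in (0:ℝ)..1, Q 4 x^2 :=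
    intervalIntegral.integral_add ((by fun_prop : Continuous _).intervalIntegrable _ _) ((by fun_prop : Continuous _).intervalIntegrable _ _)
  rw [sp]
  simp only [Finset.sum_add_distrib, ← Finset.mul_sum]
  linarith only [S]

theorem al_deriv {θ : ℝ → ℕ → ℝ} {θt : ℕ → ℝ} {S : Set ℝ} {s : ℝ} {N : ℕ} (h : ∀ j ≤ N, HasDerivWithinAt (fun r => θ r j) (θt j) S s)
    {j : ℕ} (hj : j < N) : HasDerivWithinAt (fun r => al (θ r) j) (al θt j) S s :=
  ((h (j+1) hj).add (h j hj.le)).div_const 2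

theorem be_deriv {θ : ℝ → ℕ → ℝ} {θt : ℕ → ℝ} {S : Set ℝ} {s : ℝ} {N : ℕ} (h : ∀ j ≤ N, HasDerivWithinAt (fun r => θ r j) (θt j) S s)
    {j : ℕ} (hj : j < N) : HasDerivWithinAt (fun r => be N (θ r) j) (be N θt j) S s :=
  ((h (j+1) hj).sub (h j hj.le)).mul_const (N:ℝ)

theorem E_deriv {θ ξ : ℝ → ℕ → ℝ} {θt ξt : ℕ → ℝ} {S : Set ℝ} {s : ℝ} {N : ℕ} (h : ∀ j ≤ N, HasDerivWithinAt (fun r => θ r j) (θt j) S s)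
    (h' : ∀ j ≤ N, HasDerivWithinAt (fun r => ξ r j) (ξt j) S s) (k : ℝ) :
    HasDerivWithinAt (fun r => ∑ j ∈ Finset.range N, cellE k (al (θ r) j) (al (ξ r) j) (be N (θ r) j) (be N (ξ r) j))
      (2 * ∑ j ∈ Finset.range N, (2 * k * (al (θ s) j * al θt j + al (ξ s) j * al ξt j)
        + 2/3 * k^3 * (be N (θ s) j * be N θt j + be N (ξ s) j * be N ξt j))) S s := by
  rw [Finset.mul_sum]
  refine HasDerivWithinAt.fun_sum fun j hj => ?_
  have hj := Finset.mem_range.1 hj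
  unfold cellE
  exact (((((al_deriv h hj).pow 2).add ((al_deriv h' hj).pow 2)).const_mul (2*k)).add
    ((((be_deriv h hj).pow 2).add ((be_deriv h' hj).pow 2)).const_mul (2/3*k^3))).congr_deriv (by simp; ring)

theorem cell_cover {N : ℕ} (hN : 0 < N) {y : ℝ} (hy : y ∈ Icc (0:ℝ) 1) : ∃ j < N, y ∈ Icc (md N j - hk N) (md N j + hk N) := by
  have hN' : (0:ℝ) < N := by exact_mod_cast hN
  rcases hy.2.lt_or_eq with h | h
  · refine ⟨⌊(N:ℝ) * y⌋₊, ?_, ?_⟩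
    · rw [Nat.floor_lt (mul_nonneg hN'.le hy.1)]; nlinarith
    · rw [md_sub hN, md_add hN]
      constructor
      · rw [div_le_iff₀ hN']; have := Nat.floor_le (mul_nonneg hN'.le hy.1); linarith
      · rw [le_div_iff₀ hN']; push_cast; have := Nat.lt_floor_add_one ((N:ℝ) * y); linarith
  · refine ⟨N - 1, Nat.sub_lt hN one_pos, ?_⟩
    have e : N - 1 + 1 = N := Nat.sub_add_cancel hN
    have k0 := hk_pos hN
    have e2 := md_add hN (N-1)
    rw [e, div_self hN'.ne'] at e2
    rw [e2, h]
    exact ⟨by linarith, le_rfl⟩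

theorem pc_small {k C a b z : ℝ} (hk : 0 < k) (hk1 : k ≤ 1) (hC : 1 ≤ C) (h : 2 * k * a^2 + 2/3 * k^3 * b^2 ≤ C * k^6) (hz : |z| ≤ k) :
    |a + b * z| ≤ 3 * C * k^2 := by
  have k54 : k^5 ≤ k^4 := pow_le_pow_of_le_one hk.le hk1 (by norm_num)
  have A : a^2 ≤ (C * k^2)^2 := by
    have h1 : 2 * k * a^2 ≤ 2 * k * (C * k^5) := by
      have : 0 ≤ 2/3 * k^3 * b^2 := by positivity
      have : 0 ≤ C * k^6 := by positivity
      nlinarith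
    have h2 := le_of_mul_le_mul_left h1 (by positivity)
    have h3 : C * k^5 ≤ C * k^4 := mul_le_mul_of_nonneg_left k54 (by linarith)
    have h4 : C * k^4 ≤ C^2 * k^4 := mul_le_mul_of_nonneg_right (by nlinarith) (by positivity)
    nlinarith
  have B : (k * b)^2 ≤ (2 * C * k^2)^2 := by
    have h1 : 2/3 * k * (k * b)^2 ≤ 2/3 * k * (4 * C * k^5) := by
      have : 0 ≤ 2 * k * a^2 := by positivity
      have : 0 ≤ C * k^6 := by positivity
      nlinarith
    have h2 := le_of_mul_le_mul_left h1 (by positivity)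
    have h3 : C * k^5 ≤ C * k^4 := mul_le_mul_of_nonneg_left k54 (by linarith)
    have h4 : C * k^4 ≤ C^2 * k^4 := mul_le_mul_of_nonneg_right (by nlinarith) (by positivity)
    nlinarith
  have A' := abs_le_of_sq (by positivity) A
  have B' := abs_le_of_sq (by positivity) B
  have h1 := abs_add_le a (b * z)
  have h2 : |b * z| ≤ |k * b| := by
    rw [abs_mul, abs_mul, abs_of_pos hk, mul_comm]
    exact mul_le_mul_of_nonneg_right hz (abs_nonneg _)
  linarith

set_option maxHeartbeats 1000000 in
theorem mainErr {T K : ℝ} (hT : 0 < T) (hK : 1 ≤ K) {N : ℕ} (hN : 0 < N) {η u : ℝ → ℝ → ℝ} {p q pt qt : ℝ → ℕ → ℝ → ℝ}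
    (A : Appr T K (hk N^6) η u p q pt qt) (cη : ContinuousOn (fun y => η y 0) (Icc 0 1)) (cu : ContinuousOn (fun y => u y 0) (Icc 0 1))
    {ηh uh dηh duh : ℝ → ℝ → ℝ} (hs : SolvesSSWGalerkin N 2 0 (fun i => (i : ℝ)/N) T ηh uh dηh duh)
    (hp1 : IsL2ProjOn (SH N) (fun y => η y 0) (ηh 0)) (hp2 : IsL2ProjOn (SH0 N) (fun y => u y 0) (uh 0)) :
    ∀ t ∈ Icc 0 T, ∀ y ∈ Icc (0:ℝ) 1,
      |η y t - ηh t y| ≤ (5 * K + 3 * ((80 * K^2 + 160 * K^3 * T) * Real.exp (120 * K^2 * T))) * hk N^2 ∧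
      |u y t - uh t y| ≤ (5 * K + 3 * ((80 * K^2 + 160 * K^3 * T) * Real.exp (120 * K^2 * T))) * hk N^2 := by
  have k0 := hk_pos hN
  have k1 := hk_le hN
  have K0 : 0 ≤ K := by linarith
  have hN' : (0:ℝ) < N := by exact_mod_cast hN
  have NN : (N:ℝ)/N = 1 := div_self hN'.ne'
  obtain ⟨hS, hD, _, hG⟩ := hs
  let θ : ℝ → ℕ → ℝ := fun s i => nd N (ηh s) i - zz N (p s) i
  let ξ : ℝ → ℕ → ℝ := fun s i => nd N (uh s) i - zz N (q s) i
  let θt : ℝ → ℕ → ℝ := fun s i => nd N (dηh s) i - zz N (pt s) i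
  let ξt : ℝ → ℕ → ℝ := fun s i => nd N (duh s) i - zz N (qt s) i
  have dθ : ∀ s ∈ Icc 0 T, ∀ j ≤ N, HasDerivWithinAt (fun r => θ r j) (θt s j) (Icc 0 T) s := fun s hs j hj =>
    (hD _ (node_mem hN hj) s hs).1.sub ((A.dp s hs 0 _).sub ((A.dp s hs 2 _).const_mul _))
  have dξ : ∀ s ∈ Icc 0 T, ∀ j ≤ N, HasDerivWithinAt (fun r => ξ r j) (ξt s j) (Icc 0 T) s := fun s hs j hj =>
    (hD _ (node_mem hN hj) s hs).2.sub ((A.dq s hs 0 _).sub ((A.dq s hs 2 _).const_mul _))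
  let E : ℝ → ℝ := fun r => ∑ j ∈ Finset.range N, cellE (hk N) (al (θ r) j) (al (ξ r) j) (be N (θ r) j) (be N (ξ r) j)
  let E' : ℝ → ℝ := fun s => 2 * ∑ j ∈ Finset.range N, (2 * hk N * (al (θ s) j * al (θt s) j + al (ξ s) j * al (ξt s) j)
        + 2/3 * hk N^3 * (be N (θ s) j * be N (θt s) j + be N (ξ s) j * be N (ξt s) j))
  have dE : ∀ s ∈ Icc 0 T, HasDerivWithinAt E (E' s) (Icc 0 T) s := fun s hs => E_deriv (dθ s hs) (dξ s hs) (hk N)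
  have z : (0:ℝ) ∈ Icc 0 T := ⟨le_rfl, hT.le⟩
  have KK : K ≤ K^2 := by nlinarith
  have KKK : K^2 ≤ K^3 := by nlinarith [sq_nonneg K]
  have ineq : ∀ s ∈ Icc 0 T, E' s ≤ 120 * K^2 * E s + 160 * K^3 * hk N^6 := by
    intro s hs
    have h := stepSum hN (A.pj s) (A.qj s) (A.ptj s) (A.qtj s) (A.qv s) hK (fun i hi x hx => (A.bd s hs i hi x hx).1)
      (fun i hi x hx => (A.bd s hs i hi x hx).2) (hS s hs).1 (hS s hs).2.1 (hS s hs).2.2.1 (hS s hs).2.2.2 (hG s hs).1 (hG s hs).2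
      (θ := θ s) (ξ := ξ s) (θt := θt s) (ξt := ξt s) rfl rfl rfl rfl
    have y4 := A.y4 s hs
    have p3 := A.p3 s hs
    have q3 := A.q3 s hs
    have r1 := A.r1 s hs
    have r2 := A.r2 s hs
    have k6 : 0 ≤ hk N^6 := by positivity
    have s1 : 40 * K^2 * (hk N^6/2 + hk N^6 * ∫ x in (0:ℝ)..1, (p s 4 x^2 + q s 4 x^2)) ≤ 40 * K^2 * (hk N^6/2 + hk N^6 * K) :=
      mul_le_mul_of_nonneg_left (by nlinarith only [y4, k6]) (by positivity)
    have s2 : 9 * hk N^6 * ((∫ x in (0:ℝ)..1, pt s 3 x^2) + ∫ x in (0:ℝ)..1, qt s 3 x^2) ≤ 9 * hk N^6 * (K + K) :=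
      mul_le_mul_of_nonneg_left (add_le_add p3 q3) (by positivity)
    have s3 : 40 * K^2 * (hk N^6/2 + hk N^6 * K) + 9 * hk N^6 * (K + K) + (hk N^6 + hk N^6) ≤ 80 * K^3 * hk N^6 := by
      have : 20 * K^2 + 40 * K^3 + 18 * K + 2 ≤ 80 * K^3 := by nlinarith only [KK, KKK, hK]
      nlinarith only [mul_le_mul_of_nonneg_right this k6]
    have eE : E s = ∑ j ∈ Finset.range N, cellE (hk N) (al (θ s) j) (al (ξ s) j) (be N (θ s) j) (be N (ξ s) j) := rfl
    have eE' : E' s = 2 * ∑ j ∈ Finset.range N, (2 * hk N * (al (θ s) j * al (θt s) j + al (ξ s) j * al (ξt s) j)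
        + 2/3 * hk N^3 * (be N (θ s) j * be N (θt s) j + be N (ξ s) j * be N (ξt s) j)) := rfl
    rw [← eE] at h
    linarith only [h, s1, s2, s3, r1, r2, eE']
  have q0 := A.qv 0 0 (by decide)
  have q2 := A.qv 0 2 (by decide)
  have ξ0 : ξ 0 0 = 0 := by simp [ξ, nd, (hS 0 z).2.1.2.1, zz, q0.1, q2.1]
  have ξN : ξ 0 N = 0 := by simp [ξ, nd, NN, (hS 0 z).2.1.2.2, zz, q0.2, q2.2]
  obtain ⟨φ, hφ, nφ⟩ := interpSh hN (θ 0)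
  obtain ⟨χ, hχ, nχ⟩ := interpSh0 hN (ξ 0) ξ0 ξN
  have E0 : E 0 ≤ 80 * K^2 * hk N^6 := by
    have h1 := initErr hN (A.pj 0) (K := K) (ε := hk N^6) K0 (by positivity) cη (hS 0 z).1 hφ nφ
      (fun x hx => (A.bd 0 z 3 le_rfl x hx).1) (fun x hx => (A.cl 0 z x hx).1) (hp1.2 φ hφ)
    have h2 := initErr hN (A.qj 0) (K := K) (ε := hk N^6) K0 (by positivity) cu (hS 0 z).2.1.1 hχ.1 nχ
      (fun x hx => (A.bd 0 z 3 le_rfl x hx).2) (fun x hx => (A.cl 0 z x hx).2) (hp2.2 χ hχ)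
    have h3 := add_le_add h1 h2
    rw [← Finset.sum_add_distrib] at h3
    have e : E 0 = ∑ j ∈ Finset.range N, ((2 * hk N * (al (θ 0) j)^2 + 2/3 * hk N^3 * (be N (θ 0) j)^2)
       + (2 * hk N * (al (ξ 0) j)^2 + 2/3 * hk N^3 * (be N (ξ 0) j)^2)) :=
      Finset.sum_congr rfl fun j _ => by unfold cellE; ring
    rw [e]
    refine h3.trans ?_
    have k6 : hk N^6 ≤ 1 := pow_le_one₀ k0.le k1
    have k6' : 0 ≤ hk N^6 := by positivity
    have K2 : 1 ≤ K^2 := by linarith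
    have : (hk N^6)^2 ≤ K^2 * hk N^6 := by nlinarith only [k6, k6', K2]
    linarith only [this]
  have G := gron (E := E) (E' := E') (S := T) (C := 120 * K^2) (D := 160 * K^3 * hk N^6) (by positivity) (by positivity)
    (fun s hs => (dE s hs).continuousWithinAt) (fun s hs => (dE s (Ioo_subset_Icc_self hs)).hasDerivAt (Icc_mem_nhds hs.1 hs.2))
    (fun s hs => ineq s (Ioo_subset_Icc_self hs))
  set C := (80 * K^2 + 160 * K^3 * T) * Real.exp (120 * K^2 * T) with hC
  have C1 : 1 ≤ C := by
    have h1 : 1 ≤ Real.exp (120 * K^2 * T) := Real.one_le_exp (by positivity)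
    have h2 : 0 ≤ 160 * K^3 * T := by positivity
    have h3 : 1 ≤ 80 * K^2 + 160 * K^3 * T := by linarith
    rw [hC]; exact one_le_mul_of_one_le_of_one_le h3 h1
  intro t ht y hy
  have Et : E t ≤ C * hk N^6 := by
    refine (G t ht).trans ?_
    have h1 : Real.exp (120 * K^2 * t) ≤ Real.exp (120 * K^2 * T) :=
      Real.exp_le_exp.2 (mul_le_mul_of_nonneg_left ht.2 (by positivity))
    have h2 : E 0 + 160 * K^3 * hk N^6 * t ≤ (80 * K^2 + 160 * K^3 * T) * hk N^6 := by
      have : 160 * K^3 * hk N^6 * t ≤ 160 * K^3 * hk N^6 * T := mul_le_mul_of_nonneg_left ht.2 (by positivity)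
      linarith
    calc _ ≤ ((80 * K^2 + 160 * K^3 * T) * hk N^6) * Real.exp (120 * K^2 * T) :=
          mul_le_mul h2 h1 (Real.exp_pos _).le (by positivity)
      _ = C * hk N^6 := by rw [hC]; ring
  obtain ⟨j, hj, hyj⟩ := cell_cover hN hy
  have Ej : cellE (hk N) (al (θ t) j) (al (ξ t) j) (be N (θ t) j) (be N (ξ t) j) ≤ C * hk N^6 := by
    refine le_trans ?_ Et
    exact Finset.single_le_sum (f := fun j => cellE (hk N) (al (θ t) j) (al (ξ t) j) (be N (θ t) j) (be N (ξ t) j))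
      (fun i _ => by unfold cellE; positivity) (Finset.mem_range.2 hj)
  have hz : |y - md N j| ≤ hk N := abs_le.2 ⟨by linarith [hyj.1], by linarith [hyj.2]⟩
  unfold cellE at Ej
  have ta : 0 ≤ 2 * hk N * (al (θ t) j)^2 + 2/3 * hk N^3 * (be N (θ t) j)^2 := by positivity
  have xa : 0 ≤ 2 * hk N * (al (ξ t) j)^2 + 2/3 * hk N^3 * (be N (ξ t) j)^2 := by positivity
  have sθ := pc_small (a := al (θ t) j) (b := be N (θ t) j) k0 k1 C1 (by linarith only [Ej, xa]) hz
  have sξ := pc_small (a := al (ξ t) j) (b := be N (ξ t) j) k0 k1 C1 (by linarith only [Ej, ta]) hz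
  have sub := cell_sub hN hj
  have D1 := cellA (A.pj t) k0 k1 K0 (zz_coef hN (p t) j) (fun x hx => (A.bd t ht 2 (by norm_num) x (sub hx)).1)
    (fun x hx => (A.bd t ht 3 le_rfl x (sub hx)).1) y hyj
  have D2 := cellA (A.qj t) k0 k1 K0 (zz_coef hN (q t) j) (fun x hx => (A.bd t ht 2 (by norm_num) x (sub hx)).2)
    (fun x hx => (A.bd t ht 3 le_rfl x (sub hx)).2) y hyj
  have cl := A.cl t ht y hy
  have k62 : hk N^6 ≤ hk N^2 := pow_le_pow_of_le_one k0.le k1 (by norm_num)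
  have Kk : hk N^2 ≤ K * hk N^2 := by nlinarith only [hK, sq_nonneg (hk N)]
  have f1 := Sh_aff hN (hS t ht).1 hj y hyj
  have f2 := Sh_aff hN (hS t ht).2.1.1 hj y hyj
  constructor
  · have e : η y t - ηh t y = (η y t - p t 0 y) + (p t 0 y - (al (zz N (p t)) j + be N (zz N (p t)) j * (y - md N j)))
        + -(al (θ t) j + be N (θ t) j * (y - md N j)) := by
      rw [f1]; simp only [θ, al_sub, be_sub]; ring
    rw [e]
    refine (abs_add_three _ _ _).trans ?_
    rw [abs_neg]
    linarith only [cl.1, D1, sθ, k62, Kk]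
  · have e : u y t - uh t y = (u y t - q t 0 y) + (q t 0 y - (al (zz N (q t)) j + be N (zz N (q t)) j * (y - md N j)))
        + -(al (ξ t) j + be N (ξ t) j * (y - md N j)) := by
      rw [f2]; simp only [ξ, al_sub, be_sub]; ring
    rw [e]
    refine (abs_add_three _ _ _).trans ?_
    rw [abs_neg]
    linarith only [cl.2, D2, sξ, k62, Kk]

theorem nrm_le {f : ℝ → ℝ} {B : ℝ} (hB : 0 ≤ B) (h : ∀ y ∈ Icc (0:ℝ) 1, |f y| ≤ B) : nrm f ≤ B := by
  unfold nrm
  rw [Real.sqrt_le_left hB]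
  have := intervalIntegral.norm_integral_le_of_norm_le_const (a := (0:ℝ)) (b := 1) (C := B^2) (f := fun y => (f y)^2) (by
    intro x hx
    rw [uIoc_of_le zero_le_one] at hx
    rw [Real.norm_eq_abs, abs_pow]
    exact pow_le_pow_left₀ (abs_nonneg _) (h x ⟨hx.1.le, hx.2⟩) 2)
  rw [Real.norm_eq_abs] at this
  have := (le_abs_self _).trans this
  simpa using this

theorem sup_le' {f : ℝ → ℝ} {B : ℝ} (h : ∀ y ∈ Icc (0:ℝ) 1, |f y| ≤ B) : sSup ((fun y => |f y|) '' Icc (0:ℝ) 1) ≤ B := by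
  refine csSup_le ⟨_, mem_image_of_mem _ (⟨le_rfl, zero_le_one⟩ : (0:ℝ) ∈ Icc 0 1)⟩ ?_
  rintro _ ⟨y, hy, rfl⟩
  exact h y hy

/-- **Optimal-order `O(h²)` L²- and L∞-error estimates for the semidiscrete
Galerkin method for (SSW) with continuous piecewise linear functions on a
uniform mesh.** -/
theorem stmt_12 (T β : ℝ) (hT : 0 < T) (hβ : 0 < β)
    (ηs us : ℕ → ℝ → ℝ → ℝ)
    (hηsm : SmoothChain T 4 1 ηs) (husm : SmoothChain T 4 1 us)
    (hsol : SSW T (ηs 0) (us 0) (ηs 1) (us 1))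
    (hlow : ∀ y ∈ Icc (0:ℝ) 1, ∀ t ∈ Icc (0:ℝ) T, β ≤ 1 + (ηs 0 y t) / 2)
    (hc10 : derivWithin (fun y => ηs 0 y 0) (Icc (0:ℝ) 1) 0 = 0)
    (hc11 : derivWithin (fun y => ηs 0 y 0) (Icc (0:ℝ) 1) 1 = 0)
    (hc30 : iteratedDerivWithin 3 (fun y => ηs 0 y 0) (Icc (0:ℝ) 1) 0 = 0)
    (hc31 : iteratedDerivWithin 3 (fun y => ηs 0 y 0) (Icc (0:ℝ) 1) 1 = 0)
    (hc20 : iteratedDerivWithin 2 (fun y => us 0 y 0) (Icc (0:ℝ) 1) 0 = 0)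
    (hc21 : iteratedDerivWithin 2 (fun y => us 0 y 0) (Icc (0:ℝ) 1) 1 = 0) :
    ∃ C : ℝ, ∀ N : ℕ, 2 ≤ N →
      ∀ ηh uh dηh duh : ℝ → ℝ → ℝ,
        SolvesSSWGalerkin N 2 0 (fun i => (i : ℝ)/N) T ηh uh dηh duh →
        IsL2ProjOn (Sh N 2 0 (fun i => (i : ℝ)/N)) (fun y => ηs 0 y 0) (ηh 0) →
        IsL2ProjOn (Sh0 N 2 0 (fun i => (i : ℝ)/N)) (fun y => us 0 y 0) (uh 0) →
        ∀ t ∈ Icc (0:ℝ) T,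
          nrm (fun y => ηs 0 y t - ηh t y) + nrm (fun y => us 0 y t - uh t y)
              ≤ C * ((1:ℝ)/N) ^ 2 ∧
          sSup ((fun y => |ηs 0 y t - ηh t y|) '' Icc (0:ℝ) 1)
              + sSup ((fun y => |us 0 y t - uh t y|) '' Icc (0:ℝ) 1)
              ≤ C * ((1:ℝ)/N) ^ 2 := by
  obtain ⟨K, hK, h⟩ := fromHyp T β hT hβ ηs us hηsm husm hsol hlow hc10 hc11 hc30 hc31 hc20 hc21
  have K0 : 0 ≤ K := by linarith
  have h0 : (0:ℝ) ∈ Icc 0 T := ⟨le_rfl, hT.le⟩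
  obtain ⟨C0, hC0⟩ : ∃ C0, C0 = 5 * K + 3 * ((80 * K^2 + 160 * K^3 * T) * Real.exp (120 * K^2 * T)) := ⟨_, rfl⟩
  have C0n : 0 ≤ C0 := by
    have := hT.le
    rw [hC0]; positivity
  refine ⟨C0, fun N hN2 ηh uh dηh duh hs hp1 hp2 t ht => ?_⟩
  have hN : 0 < N := by omega
  have hN' : (0:ℝ) < N := by exact_mod_cast hN
  obtain ⟨p, q, pt, qt, A⟩ := h (hk N^6) (pow_pos (hk_pos hN) 6)
  have M := mainErr hT hK hN A (hηsm.2.1 0 (by norm_num) 0 h0).continuousOn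
    (husm.2.1 0 (by norm_num) 0 h0).continuousOn hs hp1 hp2 t ht
  rw [← hC0] at M
  have hkN : hk N^2 = ((1:ℝ)/N)^2/4 := by
    unfold hk
    field_simp
    norm_num
  have B0 : 0 ≤ C0 * hk N^2 := by positivity
  have hB : C0 * hk N^2 + C0 * hk N^2 ≤ C0 * ((1:ℝ)/N)^2 := by
    have h1 : 0 ≤ C0 * ((1:ℝ)/N)^2 := by positivity
    have h2 : C0 * hk N^2 = C0 * ((1:ℝ)/N)^2 / 4 := by rw [hkN]; ring
    rw [h2]; linarith
  exact ⟨(add_le_add (nrm_le B0 fun y hy => (M y hy).1) (nrm_le B0 fun y hy => (M y hy).2)).trans hB,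
    (add_le_add (sup_le' fun y hy => (M y hy).1) (sup_le' fun y hy => (M y hy).2)).trans hB⟩
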